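/- arXiv:1910.13424 — 5 statements merged into one kernel-verified Lean document; each statement's English description precedes it below -/
import Mathlib

section
/- Let μ be a positive measure on (0,∞) with ∫ s dμ(s) = m for some m ∈ (0,1/2), and with ∫ dμ(s) ≤ C and ∫ s² dμ(s) ≤ C for some C > 0, and set F₀(x) = ∫_{(0,∞)} (1 − e^{−s·x}) dμ(s) for x ≥ 0. Let F be the function that is Lipschitz on [0,∞)×[0,∞), sublinear in x, satisfies 0 ≤ F(x,t) ≤ m·x, F(x,0) = F₀(x), and is a viscosity solution of (HJ) on (0,∞)×(0,∞). Then F ∈ C^∞((0,∞)×(0,∞)) and for every integer n ≥ 1 and every (x,t) ∈ (0,∞)×(0,∞): (−1)^{n+1}·∂_x^n F(x,t) ≥ 0. -/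
open Set Filter

/-- A function `ψ : [0,∞) → ℝ` is sublinear if `ψ(x)/x → 0` as `x → ∞`. -/
def Sublinear (ψ : ℝ → ℝ) : Prop :=
  Tendsto (fun x => ψ x / x) atTop (nhds 0)

/-- `F` is sublinear in `x` if `x ↦ F(x,t)` is sublinear for each `t ≥ 0`. -/
def SublinearInX (F : ℝ → ℝ → ℝ) : Prop :=
  ∀ t, 0 ≤ t → Sublinear (fun x => F x t)

/-- Viscosity subsolution of
`∂ₜF + (1/2)(∂ₓF − m)(∂ₓF − m − 1) + F/x − m = 0` on `(0,∞) × (0,∞)`. -/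
def IsSubsolutionHJ (m : ℝ) (F : ℝ → ℝ → ℝ) : Prop :=
  ∀ φ : ℝ × ℝ → ℝ, ContDiff ℝ 1 φ →
    ∀ x₀ t₀ : ℝ, 0 < x₀ → 0 < t₀ →
      IsLocalMaxOn (fun p : ℝ × ℝ => F p.1 p.2 - φ p) (Ici 0 ×ˢ Ici 0) (x₀, t₀) →
      deriv (fun s => φ (x₀, s)) t₀ +
        (1 / 2) * (deriv (fun y => φ (y, t₀)) x₀ - m) *
          (deriv (fun y => φ (y, t₀)) x₀ - m - 1) +
        F x₀ t₀ / x₀ - m ≤ 0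

/-- Viscosity supersolution of
`∂ₜF + (1/2)(∂ₓF − m)(∂ₓF − m − 1) + F/x − m = 0` on `(0,∞) × (0,∞)`. -/
def IsSupersolutionHJ (m : ℝ) (F : ℝ → ℝ → ℝ) : Prop :=
  ∀ φ : ℝ × ℝ → ℝ, ContDiff ℝ 1 φ →
    ∀ x₀ t₀ : ℝ, 0 < x₀ → 0 < t₀ →
      IsLocalMinOn (fun p : ℝ × ℝ => F p.1 p.2 - φ p) (Ici 0 ×ˢ Ici 0) (x₀, t₀) →
      deriv (fun s => φ (x₀, s)) t₀ +
        (1 / 2) * (deriv (fun y => φ (y, t₀)) x₀ - m) *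
          (deriv (fun y => φ (y, t₀)) x₀ - m - 1) +
        F x₀ t₀ / x₀ - m ≥ 0

/-- Viscosity solution of (HJ). -/
def IsSolutionHJ (m : ℝ) (F : ℝ → ℝ → ℝ) : Prop :=
  IsSubsolutionHJ m F ∧ IsSupersolutionHJ m F

/-- A Lipschitz (on the quadrant), sublinear-in-`x` viscosity solution of (HJ)
with `0 ≤ F(x,t) ≤ m·x` and initial data `F₀`. -/
def GoodSolution (m : ℝ) (F₀ : ℝ → ℝ) (F : ℝ → ℝ → ℝ) : Prop :=
  (∃ K : NNReal, LipschitzOnWith K (fun p : ℝ × ℝ => F p.1 p.2) (Ici 0 ×ˢ Ici 0)) ∧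
  SublinearInX F ∧
  (∀ x t : ℝ, 0 ≤ x → 0 ≤ t → 0 ≤ F x t ∧ F x t ≤ m * x) ∧
  (∀ x : ℝ, 0 ≤ x → F x 0 = F₀ x) ∧
  IsSolutionHJ m F

open MeasureTheory

/-- A bounded Lipschitz autonomous vector field on a Banach space has global integral curves. -/
theorem exists_global_integral_curve {E : Type*} [NormedAddCommGroup E] [NormedSpace ℝ E]
    [CompleteSpace E] {f : E → E} {K L : NNReal} (hf : LipschitzWith K f)
    (hL : ∀ x, ‖f x‖ ≤ L) (x₀ : E) :
    ∃ α : ℝ → E, α 0 = x₀ ∧ ∀ t, HasDerivAt α (f (α t)) t := by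
  have hloc : ∀ n : ℕ, ∃ α : ℝ → E, α 0 = x₀ ∧ ∀ t ∈ Icc (-((n : ℝ) + 1)) (n + 1),
      HasDerivWithinAt α (f (α t)) (Icc (-((n : ℝ) + 1)) (n + 1)) t := by
    intro n
    have h0 : (0 : ℝ) ∈ Icc (-((n : ℝ) + 1)) (n + 1) := ⟨by linarith [n.cast_nonneg (α := ℝ)],
      by positivity⟩
    have hp : IsPicardLindelof (fun _ ↦ f) (⟨0, h0⟩ : Icc (-((n : ℝ) + 1)) (n + 1)) x₀
        (L * (n + 1)) 0 L K :=
      IsPicardLindelof.of_time_independent (fun x _ => hL x) (hf.lipschitzOnWith) (by simp)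
    exact hp.exists_eq_forall_mem_Icc_hasDerivWithinAt₀
  choose α hα0 hα using hloc
  have hderiv : ∀ n : ℕ, ∀ t ∈ Ioo (-((n : ℝ) + 1)) (n + 1), HasDerivAt (α n) (f (α n t)) t :=
    fun n t ht => (hα n t (Ioo_subset_Icc_self ht)).hasDerivAt (Icc_mem_nhds ht.1 ht.2)
  have hagree : ∀ n m : ℕ, n ≤ m → EqOn (α n) (α m) (Icc (-((n : ℝ) + 1)) (n + 1)) := by
    intro n m hnm
    have hnm' : (n : ℝ) ≤ m := by exact_mod_cast hnm
    have hsub : Icc (-((n : ℝ) + 1)) (n + 1) ⊆ Icc (-((m : ℝ) + 1)) (m + 1) :=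
      Icc_subset_Icc (by linarith) (by linarith)
    refine ODE_solution_unique_of_mem_Icc (v := fun _ => f) (s := fun _ => univ) (K := K)
      (t₀ := 0) (fun _ _ => hf.lipschitzOnWith)
      ⟨by linarith [n.cast_nonneg (α := ℝ)], by positivity⟩
      (fun t ht => (hα n t ht).continuousWithinAt) (hderiv n) (fun _ _ => trivial)
      (fun t ht => (hα m t (hsub ht)).continuousWithinAt.mono hsub)
      (fun t ht => hderiv m t ⟨by linarith [ht.1], by linarith [ht.2]⟩) (fun _ _ => trivial)
      (by rw [hα0, hα0])
  refine ⟨fun t => α ⌈|t|⌉₊ t, by simp [hα0], fun t => ?_⟩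
  set n := ⌈|t|⌉₊ with hn
  have htn : |t| ≤ n := Nat.le_ceil _
  have hkey : ∀ s : ℝ, |s| < n + 1 → α ⌈|s|⌉₊ s = α (n + 1) s := by
    intro s hs
    have h1 : ⌈|s|⌉₊ ≤ n + 1 := Nat.ceil_le.2 (by push_cast; exact hs.le)
    have h2 : |s| ≤ ⌈|s|⌉₊ := Nat.le_ceil _
    refine hagree _ _ h1 (abs_le.1 (by linarith))
  have hev : (fun s => α ⌈|s|⌉₊ s) =ᶠ[nhds t] α (n + 1) := by
    have : ∀ᶠ s in nhds t, |s| < (n : ℝ) + 1 :=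
      continuous_abs.continuousAt.eventually_lt continuousAt_const (by linarith)
    exact this.mono hkey
  have h3 := hderiv (n + 1) t (by
    have := abs_le.1 htn
    push_cast
    exact ⟨by linarith [this.1], by linarith [this.2]⟩)
  rw [← hkey t (by linarith)] at h3
  exact h3.congr_of_eventuallyEq hev

/-- A scalar function whose derivative is nonnegative whenever it is negative stays nonnegative. -/
theorem nonneg_of_deriv_nonneg_of_neg {u u' : ℝ → ℝ} (hu : ∀ t, HasDerivAt u (u' t) t)
    (h0 : 0 ≤ u 0) (h : ∀ t, u t < 0 → 0 ≤ u' t) {t : ℝ} (ht : 0 ≤ t) : 0 ≤ u t := by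
  by_contra! hneg
  have hcont : Continuous u := continuous_iff_continuousAt.2 fun t => (hu t).continuousAt
  set S := {s | s ∈ Icc 0 t ∧ 0 ≤ u s} with hS
  have hSc : IsCompact S := by
    have : S = Icc 0 t ∩ u ⁻¹' Ici 0 := rfl
    rw [this]
    exact isCompact_Icc.inter_right (isClosed_Ici.preimage hcont)
  obtain ⟨r, ⟨hr1, hr2⟩, hmax⟩ := hSc.exists_isGreatest ⟨0, ⟨le_rfl, ht⟩, h0⟩
  have hrt : r < t := lt_of_le_of_ne hr1.2 (by rintro rfl; linarith)
  have hmono : MonotoneOn u (Icc r t) := by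
    refine monotoneOn_of_deriv_nonneg (convex_Icc _ _) hcont.continuousOn
      (fun x _ => (hu x).differentiableAt.differentiableWithinAt) fun x hx => ?_
    rw [interior_Icc] at hx
    rw [(hu x).deriv]
    refine h x ?_
    by_contra! hx0
    exact absurd (hmax ⟨⟨hr1.1.trans hx.1.le, hx.2.le⟩, hx0⟩) (not_le.2 hx.1)
  linarith [hmono ⟨le_rfl, hrt.le⟩ ⟨hrt.le, le_rfl⟩ hrt.le]

/-- A quasi-positive `C¹` vector field that conserves a positive linear functional has a global
forward solution from every nonnegative initial datum, and this solution is nonnegative. -/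
theorem exists_nonneg_solution {ι : Type*} [Fintype ι] {V : (ι → ℝ) → ι → ℝ}
    (hV : ContDiff ℝ 1 V)
    (hquasi : ∀ c : ι → ℝ, (∀ i, 0 ≤ c i) → ∀ i, c i = 0 → 0 ≤ V c i)
    {w : ι → ℝ} (hw : ∀ i, 0 < w i) (hcons : ∀ c, ∑ i, w i * V c i = 0)
    {c₀ : ι → ℝ} (h0 : ∀ i, 0 ≤ c₀ i) :
    ∃ c : ℝ → ι → ℝ, ContDiff ℝ 1 c ∧ c 0 = c₀ ∧
      ∀ t, 0 ≤ t → (∀ i, 0 ≤ c t i) ∧ HasDerivAt c (V (c t)) t := by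
  set W : ℝ := ∑ i, w i * c₀ i with hW
  have hW0 : 0 ≤ W := Finset.sum_nonneg fun i _ => mul_nonneg (hw i).le (h0 i)
  set b : ℝ := ∑ i, W / w i with hb
  have hb0 : 0 ≤ b := Finset.sum_nonneg fun i _ => div_nonneg hW0 (hw i).le
  have hWb : ∀ i, W / w i ≤ b := fun i =>
    Finset.single_le_sum (f := fun i => W / w i) (fun i _ => div_nonneg hW0 (hw i).le)
      (Finset.mem_univ i)
  set π : (ι → ℝ) → ι → ℝ := fun c i => max 0 (min b (c i)) with hπ
  have hπmem : ∀ c i, 0 ≤ π c i ∧ π c i ≤ b := fun c i =>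
    ⟨le_max_left _ _, max_le hb0 (min_le_left _ _)⟩
  have hπball : ∀ c, π c ∈ Metric.closedBall (0 : ι → ℝ) b := fun c => by
    rw [mem_closedBall_zero_iff, pi_norm_le_iff_of_nonneg hb0]
    intro i
    rw [Real.norm_of_nonneg (hπmem c i).1]
    exact (hπmem c i).2
  have hπlip : LipschitzWith 1 π := by
    refine LipschitzWith.of_dist_le_mul fun x y => ?_
    rw [NNReal.coe_one, one_mul, dist_pi_le_iff dist_nonneg]
    intro i
    refine le_trans ?_ (dist_le_pi_dist x y i)
    rw [Real.dist_eq, Real.dist_eq]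
    refine (abs_max_sub_max_le_max _ _ _ _).trans (max_le (by simp) ?_)
    exact (abs_min_sub_min_le_max _ _ _ _).trans (max_le (by simp) le_rfl)
  obtain ⟨K, hK⟩ := (hV.contDiffOn (s := Metric.closedBall (0 : ι → ℝ) b)).exists_lipschitzOnWith
    one_ne_zero (convex_closedBall _ _) (isCompact_closedBall _ _)
  obtain ⟨L, hL⟩ := (isCompact_closedBall (0 : ι → ℝ) b).exists_bound_of_continuousOn
    hV.continuous.continuousOn
  have hlip : LipschitzWith K (V ∘ π) := by
    have := hK.comp (hπlip.lipschitzOnWith (s := univ)) (fun c _ => hπball c)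
    rw [mul_one] at this
    exact lipschitzOnWith_univ.1 this
  obtain ⟨c, hc0, hc⟩ := exists_global_integral_curve (L := L.toNNReal) hlip
    (fun x => (hL _ (hπball x)).trans (Real.le_coe_toNNReal _)) c₀
  have hci : ∀ t i, HasDerivAt (fun t => c t i) (V (π (c t)) i) t := fun t i =>
    (hasDerivAt_pi.1 (hc t)) i
  have hcc : Continuous c := continuous_iff_continuousAt.2 fun t => (hc t).continuousAt
  have hpos : ∀ t, 0 ≤ t → ∀ i, 0 ≤ c t i := by
    intro t ht i
    refine nonneg_of_deriv_nonneg_of_neg (u := fun t => c t i) (fun t => hci t i)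
      (by simp [hc0, h0]) (fun s hs => ?_) ht
    refine hquasi _ (fun i => (hπmem _ i).1) i ?_
    exact max_eq_left ((min_le_right _ _).trans hs.le)
  have hmass : ∀ t, ∑ i, w i * c t i = W := by
    have hd : ∀ t, HasDerivAt (fun t => ∑ i, w i * c t i) 0 t := fun t => by
      have := HasDerivAt.fun_sum (u := Finset.univ) fun i _ => (hci t i).const_mul (w i)
      rwa [hcons] at this
    intro t
    have := is_const_of_deriv_eq_zero (fun t => (hd t).differentiableAt) (fun t => (hd t).deriv)
      t 0
    simpa [hc0, hW] using this
  refine ⟨c, ?_, hc0, fun t ht => ⟨hpos t ht, ?_⟩⟩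
  · rw [contDiff_one_iff_deriv]
    refine ⟨fun t => (hc t).differentiableAt, ?_⟩
    have : deriv c = fun t => (V ∘ π) (c t) := funext fun t => (hc t).deriv
    rw [this]
    exact hlip.continuous.comp hcc
  · have hπc : π (c t) = c t := by
      funext i
      have h1 : w i * c t i ≤ W := by
        rw [← hmass t]
        exact Finset.single_le_sum (f := fun i => w i * c t i)
          (fun j _ => mul_nonneg (hw j).le (hpos t ht j)) (Finset.mem_univ i)
      have h2 : c t i ≤ b := by
        refine le_trans ?_ (hWb i)
        rw [le_div_iff₀ (hw i)]
        linarith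
      simp only [hπ]
      rw [min_eq_right h2, max_eq_right (hpos t ht i)]
    have := hc t
    simp only [Function.comp, hπc] at this
    exact this

/-- The weak form of the truncated discrete coagulation–fragmentation operator with sizes `h * n`,
`n ≤ 2 * N`: particles of index at most `N` coagulate at rate `(h * a) * (h * b)`, and a particle
of index `j` breaks into each pair `(i, j - i)` at rate `h / 2`. -/
noncomputable def coagFrag (h : ℝ) (N : ℕ) (c ψ : ℕ → ℝ) : ℝ :=
  (∑ a ∈ Finset.Icc 1 N, ∑ b ∈ Finset.Icc 1 N,
    1 / 2 * ((h * a) * (h * b) * (c a * c b)) * (ψ (a + b) - ψ a - ψ b)) +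
  ∑ j ∈ Finset.range (2 * N + 1), ∑ i ∈ Finset.Ico 1 j,
    h / 2 * c j * (ψ i + ψ (j - i) - ψ j)

theorem sum_mul_coagFrag_single (h : ℝ) (N : ℕ) (c ψ : ℕ → ℝ) :
    ∑ n ∈ Finset.range (2 * N + 1), ψ n * coagFrag h N c (Pi.single n 1) =
      coagFrag h N c ψ := by
  have key : ∀ k ∈ Finset.range (2 * N + 1),
      ∑ n ∈ Finset.range (2 * N + 1), ψ n * (Pi.single n 1 : ℕ → ℝ) k = ψ k := by
    intro k hk
    simp only [Pi.single_apply, mul_ite, mul_one, mul_zero]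
    rw [Finset.sum_ite_eq, if_pos hk]
  simp only [coagFrag, mul_add, Finset.mul_sum, Finset.sum_add_distrib]
  congr 1
  · rw [Finset.sum_comm]
    refine Finset.sum_congr rfl fun a ha => ?_
    rw [Finset.sum_comm]
    refine Finset.sum_congr rfl fun b hb => ?_
    rw [Finset.mem_Icc] at ha hb
    rw [← key (a + b) (Finset.mem_range.2 (by omega)), ← key a (Finset.mem_range.2 (by omega)),
      ← key b (Finset.mem_range.2 (by omega)), ← Finset.sum_sub_distrib, ← Finset.sum_sub_distrib,
      Finset.mul_sum]
    exact Finset.sum_congr rfl fun n _ => by ring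
  · rw [Finset.sum_comm]
    refine Finset.sum_congr rfl fun j hj => ?_
    rw [Finset.sum_comm]
    refine Finset.sum_congr rfl fun i hi => ?_
    rw [Finset.mem_range] at hj
    rw [Finset.mem_Ico] at hi
    rw [← key i (Finset.mem_range.2 (by omega)), ← key (j - i) (Finset.mem_range.2 (by omega)),
      ← key j (Finset.mem_range.2 (by omega)), ← Finset.sum_add_distrib, ← Finset.sum_sub_distrib,
      Finset.mul_sum]
    exact Finset.sum_congr rfl fun n _ => by ring

/-- Global existence of nonnegative solutions of the truncated discrete
coagulation–fragmentation system. -/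
theorem exists_coagFrag_solution {h : ℝ} (hh : 0 < h) (N : ℕ) {c₀ : ℕ → ℝ} (h0 : ∀ n, 0 ≤ c₀ n) :
    ∃ c : ℕ → ℝ → ℝ, (∀ n, ContDiff ℝ 1 (c n)) ∧
      (∀ n ∈ Finset.range (2 * N + 1), c n 0 = c₀ n) ∧ (∀ n t, 0 ≤ t → 0 ≤ c n t) ∧
      ∀ n ∈ Finset.range (2 * N + 1), ∀ t, 0 ≤ t →
        HasDerivAt (c n) (coagFrag h N (fun k => c k t) (Pi.single n 1)) t := by
  set e : (Fin (2 * N + 1) → ℝ) → ℕ → ℝ := fun c n => if hn : n < 2 * N + 1 then c ⟨n, hn⟩ else 0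
    with he
  have he_cd : ∀ n, ContDiff ℝ 1 fun c => e c n := by
    intro n
    by_cases hn : n < 2 * N + 1
    · simp only [he, hn, dite_true]
      exact contDiff_apply ℝ ℝ _
    · simp only [he, hn, dite_false]
      exact contDiff_const
  have he0 : ∀ c : Fin (2 * N + 1) → ℝ, (∀ i, 0 ≤ c i) → ∀ n, 0 ≤ e c n := by
    intro c hc n
    simp only [he]
    split_ifs with hn
    exacts [hc _, le_rfl]
  have he_val : ∀ (c : Fin (2 * N + 1) → ℝ) (i : Fin (2 * N + 1)), e c i = c i :=
    fun c i => dif_pos i.2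
  set w : ℕ → ℝ := fun n => if n = 0 then 1 else n with hw
  have hw0 : ∀ n, 0 < w n := by
    intro n
    simp only [hw]
    split_ifs with hn
    · exact one_pos
    · exact_mod_cast Nat.pos_of_ne_zero hn
  have hwn : ∀ n, 1 ≤ n → w n = n := fun n hn => if_neg (by omega)
  have hcons : ∀ c : ℕ → ℝ, coagFrag h N c w = 0 := by
    intro c
    unfold coagFrag
    rw [Finset.sum_eq_zero, Finset.sum_eq_zero, add_zero]
    · intro j hj
      refine Finset.sum_eq_zero fun i hi => ?_
      rw [Finset.mem_Ico] at hi
      rw [hwn i hi.1, hwn (j - i) (by omega), hwn j (by omega), Nat.cast_sub hi.2.le]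
      ring
    · intro a ha
      refine Finset.sum_eq_zero fun b hb => ?_
      rw [Finset.mem_Icc] at ha hb
      rw [hwn a ha.1, hwn b hb.1, hwn (a + b) (by omega)]
      push_cast
      ring
  set V : (Fin (2 * N + 1) → ℝ) → Fin (2 * N + 1) → ℝ :=
    fun c i => coagFrag h N (e c) (Pi.single (i : ℕ) 1) with hV
  have hVcd : ContDiff ℝ 1 V := by
    rw [contDiff_pi]
    intro i
    show ContDiff ℝ 1 fun c => coagFrag h N (e c) (Pi.single (i : ℕ) 1)
    unfold coagFrag
    refine ContDiff.add ?_ ?_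
    · refine ContDiff.sum fun a _ => ContDiff.sum fun b _ => ?_
      exact (contDiff_const.mul (contDiff_const.mul ((he_cd a).mul (he_cd b)))).mul contDiff_const
    · refine ContDiff.sum fun a _ => ContDiff.sum fun b _ => ?_
      exact (contDiff_const.mul (he_cd a)).mul contDiff_const
  have hVquasi : ∀ c : Fin (2 * N + 1) → ℝ, (∀ i, 0 ≤ c i) → ∀ i, c i = 0 → 0 ≤ V c i := by
    intro c hc i hi
    have hci : e c i = 0 := by rw [he_val, hi]
    have hs : ∀ k, 0 ≤ (Pi.single (i : ℕ) 1 : ℕ → ℝ) k := fun k => by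
      rw [Pi.single_apply]; split_ifs <;> norm_num
    have hz : ∀ k, e c k * (Pi.single (i : ℕ) 1 : ℕ → ℝ) k = 0 := fun k => by
      rw [Pi.single_apply]
      split_ifs with hk
      · rw [hk, hci, zero_mul]
      · rw [mul_zero]
    refine add_nonneg (Finset.sum_nonneg fun a _ => Finset.sum_nonneg fun b _ => ?_)
      (Finset.sum_nonneg fun j _ => Finset.sum_nonneg fun k _ => ?_)
    · have h1 : 0 ≤ 1 / 2 * ((h * a) * (h * b) * (e c a * e c b)) *
          (Pi.single (i : ℕ) 1 : ℕ → ℝ) (a + b) := by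
        have := he0 c hc a
        have := he0 c hc b
        have := hs (a + b)
        positivity
      linear_combination h1 + (1 / 2 * ((h * a) * (h * b)) * e c b) * hz a +
        (1 / 2 * ((h * a) * (h * b)) * e c a) * hz b
    · have h1 : 0 ≤ h / 2 * e c j * ((Pi.single (i : ℕ) 1 : ℕ → ℝ) k +
          (Pi.single (i : ℕ) 1 : ℕ → ℝ) (j - k)) := by
        have := he0 c hc j
        have := hs k
        have := hs (j - k)
        positivity
      linear_combination h1 + (h / 2) * hz j
  have hVcons : ∀ c, ∑ i : Fin (2 * N + 1), w i * V c i = 0 := by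
    intro c
    have := sum_mul_coagFrag_single h N (e c) w
    rw [hcons, ← Fin.sum_univ_eq_sum_range
      (fun n => w n * coagFrag h N (e c) (Pi.single n 1))] at this
    exact this
  obtain ⟨c, hc1, hc2, hc3⟩ := exists_nonneg_solution (w := fun i => w i)
    (c₀ := fun i => c₀ i) hVcd hVquasi (fun i => hw0 _) hVcons (fun i => h0 _)
  refine ⟨fun n t => e (c t) n, fun n => (he_cd n).comp hc1, fun n hn => ?_,
    fun n t ht => he0 _ (hc3 t ht).1 n, fun n hn t ht => ?_⟩
  · have hn' := Finset.mem_range.1 hn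
    have := he_val (c 0) ⟨n, hn'⟩
    exact this.trans (congrFun hc2 _)
  · have hn' := Finset.mem_range.1 hn
    have := (hasDerivAt_pi.1 (hc3 t ht).2) ⟨n, hn'⟩
    have h2 : (fun t => e (c t) n) = fun t => c t ⟨n, hn'⟩ :=
      funext fun t => he_val (c t) ⟨n, hn'⟩
    rw [← h2] at this
    exact this

/-- The exponential moment `∑ cₙ sₙ^p e^{-sₙ x}` of a finite atomic measure. -/
noncomputable def expMoment (k : ℕ) (s c : ℕ → ℝ) (p : ℕ) (x : ℝ) : ℝ :=
  ∑ n ∈ Finset.range k, c n * s n ^ p * Real.exp (-(s n * x))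

/-- The Bernstein transform `∑ cₙ (1 - e^{-sₙ x})` of a finite atomic measure. -/
noncomputable def bernsteinSum (k : ℕ) (s c : ℕ → ℝ) (x : ℝ) : ℝ :=
  ∑ n ∈ Finset.range k, c n * (1 - Real.exp (-(s n * x)))

theorem one_sub_exp_nonneg {y : ℝ} (hy : 0 ≤ y) : 0 ≤ 1 - Real.exp (-y) := by
  have := Real.exp_le_one_iff.2 (neg_nonpos.2 hy)
  linarith

theorem riemann_sum_one_sub_exp_bounds {h x : ℝ} (hx : 0 < x) (j : ℕ) :
    h * ∑ i ∈ Finset.range j, (1 - Real.exp (-(h * i * x))) ≤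
        j * h - (1 - Real.exp (-(h * j * x))) / x ∧
      j * h - (1 - Real.exp (-(h * j * x))) / x - h * (1 - Real.exp (-(h * j * x))) ≤
        h * ∑ i ∈ Finset.range j, (1 - Real.exp (-(h * i * x))) := by
  induction j with
  | zero => simp
  | succ j ih =>
    obtain ⟨ih1, ih2⟩ := ih
    rw [Finset.sum_range_succ]
    set e := Real.exp (-(h * j * x)) with he
    have hee : Real.exp (-(h * (j + 1 : ℕ) * x)) = e * Real.exp (-(h * x)) := by
      rw [he, ← Real.exp_add]; congr 1; push_cast; ring
    have hee' : e = Real.exp (-(h * (j + 1 : ℕ) * x)) * Real.exp (h * x) := by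
      rw [he, ← Real.exp_add]; congr 1; push_cast; ring
    have h1 := Real.add_one_le_exp (-(h * x))
    have h2 := Real.add_one_le_exp (h * x)
    set e' := Real.exp (-(h * (j + 1 : ℕ) * x)) with he'
    have hepos : 0 < e := Real.exp_pos _
    have hepos' : 0 < e' := Real.exp_pos _
    have k1 : (e - e') / x ≤ h * e := by
      rw [div_le_iff₀ hx, hee]; nlinarith
    have k2 : h * e' ≤ (e - e') / x := by
      rw [le_div_iff₀ hx]; nlinarith
    have k3 : (1 - e') / x = (1 - e) / x + (e - e') / x := by ring
    push_cast
    constructor <;> rw [k3] <;> linarith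

/-- The action of the truncated coagulation–fragmentation operator on `1 - e^{-s x}`. -/
theorem coagFrag_one_sub_exp {h x : ℝ} (hh : 0 < h) (hx : 0 < x) (N : ℕ) {c : ℕ → ℝ}
    (hc : ∀ n, 0 ≤ c n) :
    ∃ K : ℝ, 0 ≤ K ∧
      K ≤ expMoment (2 * N + 1) (fun n => h * n) c 1 0 -
        expMoment (2 * N + 1) (fun n => h * n) c 1 x ∧
      expMoment (2 * N + 1) (fun n => h * n) c 1 0 -
          expMoment (2 * N + 1) (fun n => h * n) c 1 x - K ≤
        ∑ n ∈ Finset.Ico (N + 1) (2 * N + 1), h * n * c n ∧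
      |coagFrag h N c (fun n => 1 - Real.exp (-(h * n * x))) + 1 / 2 * K ^ 2 -
        (1 / 2 * (expMoment (2 * N + 1) (fun n => h * n) c 1 x +
          expMoment (2 * N + 1) (fun n => h * n) c 1 0) -
          bernsteinSum (2 * N + 1) (fun n => h * n) c x / x)| ≤
        1 / 2 * h * bernsteinSum (2 * N + 1) (fun n => h * n) c x := by
  set ψ : ℕ → ℝ := fun n => 1 - Real.exp (-(h * n * x)) with hψ
  have hψ0 : ∀ n, 0 ≤ ψ n := fun n => one_sub_exp_nonneg (by positivity)
  have hψ1 : ∀ n, ψ n ≤ 1 := fun n => by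
    have := Real.exp_pos (-(h * n * x))
    simp only [hψ]; linarith
  have hexp : ∀ n : ℕ, Real.exp (-(h * n * x)) = 1 - ψ n := fun n => by simp [hψ]
  have hMP : expMoment (2 * N + 1) (fun n => h * n) c 1 0 -
      expMoment (2 * N + 1) (fun n => h * n) c 1 x =
      ∑ n ∈ Finset.range (2 * N + 1), h * n * c n * ψ n := by
    simp only [expMoment, hexp, mul_zero, neg_zero, Real.exp_zero]
    rw [← Finset.sum_sub_distrib]
    exact Finset.sum_congr rfl fun n _ => by ring
  have hsplit : ∑ n ∈ Finset.range (2 * N + 1), h * n * c n * ψ n =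
      ∑ n ∈ Finset.Icc 1 N, h * n * c n * ψ n +
        ∑ n ∈ Finset.Ico (N + 1) (2 * N + 1), h * n * c n * ψ n := by
    rw [Finset.range_eq_Ico, ← Finset.sum_Ico_consecutive _ (Nat.zero_le (N + 1)) (by omega),
      Finset.sum_eq_sum_Ico_succ_bot (Nat.succ_pos N)]
    simp
    rfl
  have hterm : ∀ n, 0 ≤ h * n * c n := fun n => mul_nonneg (by positivity) (hc n)
  refine ⟨∑ n ∈ Finset.Icc 1 N, h * n * c n * ψ n,
    Finset.sum_nonneg fun n _ => mul_nonneg (hterm n) (hψ0 n), ?_, ?_, ?_⟩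
  · rw [hMP, hsplit]
    exact le_add_of_nonneg_right (Finset.sum_nonneg fun n _ => mul_nonneg (hterm n) (hψ0 n))
  · rw [hMP, hsplit, add_sub_cancel_left]
    exact Finset.sum_le_sum fun n _ => mul_le_of_le_one_right (hterm n) (hψ1 n)
  · have hcoag : ∑ a ∈ Finset.Icc 1 N, ∑ b ∈ Finset.Icc 1 N,
        1 / 2 * ((h * a) * (h * b) * (c a * c b)) * (ψ (a + b) - ψ a - ψ b) =
        -(1 / 2 * (∑ n ∈ Finset.Icc 1 N, h * n * c n * ψ n) ^ 2) := by
      rw [sq, Finset.sum_mul_sum, Finset.mul_sum, ← Finset.sum_neg_distrib]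
      refine Finset.sum_congr rfl fun a _ => ?_
      rw [Finset.mul_sum, ← Finset.sum_neg_distrib]
      refine Finset.sum_congr rfl fun b _ => ?_
      have : ψ (a + b) - ψ a - ψ b = -(ψ a * ψ b) := by
        have : Real.exp (-(h * (a + b : ℕ) * x)) =
            Real.exp (-(h * a * x)) * Real.exp (-(h * b * x)) := by
          rw [← Real.exp_add]; congr 1; push_cast; ring
        simp only [hψ, this]
        ring
      rw [this]
      ring
    have hfrag : ∀ j ∈ Finset.range (2 * N + 1), ∑ i ∈ Finset.Ico 1 j,
        h / 2 * c j * (ψ i + ψ (j - i) - ψ j) =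
        c j * (h * ∑ i ∈ Finset.range j, ψ i - 1 / 2 * h * (j - 1) * ψ j) := by
      intro j _
      rcases Nat.eq_zero_or_pos j with rfl | hj
      · simp [hψ]
      rw [← Finset.mul_sum, Finset.sum_sub_distrib, Finset.sum_add_distrib,
        Finset.sum_Ico_reflect ψ 1 (Nat.le_succ j), Finset.sum_const, Nat.card_Ico]
      have : ∑ i ∈ Finset.range j, ψ i = ∑ i ∈ Finset.Ico 1 j, ψ i := by
        rw [Finset.range_eq_Ico, Finset.sum_eq_sum_Ico_succ_bot hj]
        simp [hψ]
      rw [this, Nat.succ_sub_one, Nat.add_sub_cancel_left, nsmul_eq_mul, Nat.cast_sub hj]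
      push_cast
      ring
    unfold coagFrag
    rw [hcoag, Finset.sum_congr rfl hfrag]
    have htrue : 1 / 2 * (expMoment (2 * N + 1) (fun n => h * n) c 1 x +
          expMoment (2 * N + 1) (fun n => h * n) c 1 0) -
          bernsteinSum (2 * N + 1) (fun n => h * n) c x / x =
        ∑ j ∈ Finset.range (2 * N + 1), c j * (h * j - ψ j / x - 1 / 2 * h * j * ψ j) := by
      simp only [expMoment, bernsteinSum, hexp, mul_zero, neg_zero, Real.exp_zero]
      rw [← Finset.sum_add_distrib, Finset.mul_sum, Finset.sum_div, ← Finset.sum_sub_distrib]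
      exact Finset.sum_congr rfl fun n _ => by ring
    rw [htrue, neg_add_eq_sub, sub_add_cancel, ← Finset.sum_sub_distrib]
    refine (Finset.abs_sum_le_sum_abs _ _).trans ?_
    rw [bernsteinSum, Finset.mul_sum]
    refine Finset.sum_le_sum fun j _ => ?_
    rw [← mul_sub, abs_mul, abs_of_nonneg (hc j)]
    have hb := riemann_sum_one_sub_exp_bounds (h := h) hx j
    have : |h * ∑ i ∈ Finset.range j, ψ i - 1 / 2 * h * (j - 1) * ψ j -
        (h * j - ψ j / x - 1 / 2 * h * j * ψ j)| ≤ 1 / 2 * h * ψ j := by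
      rw [abs_le]
      simp only [hψ]
      constructor <;> linarith [hb.1, hb.2]
    calc _ ≤ c j * (1 / 2 * h * ψ j) := mul_le_mul_of_nonneg_left this (hc j)
      _ = _ := by simp only [hψ]; ring

/-- A nonnegative forward solution of the truncated discrete coagulation–fragmentation system. -/
structure IsCoagFragSolution (h : ℝ) (N : ℕ) (c : ℕ → ℝ → ℝ) : Prop where
  contDiff : ∀ n, ContDiff ℝ 1 (c n)
  nonneg : ∀ n t, 0 ≤ t → 0 ≤ c n t
  hasDerivAt : ∀ n ∈ Finset.range (2 * N + 1), ∀ t, 0 ≤ t →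
    HasDerivAt (c n) (coagFrag h N (fun k => c k t) (Pi.single n 1)) t

theorem coagFrag_linear (h : ℝ) (N : ℕ) (c : ℕ → ℝ) : coagFrag h N c (fun n => h * n) = 0 := by
  unfold coagFrag
  rw [Finset.sum_eq_zero, Finset.sum_eq_zero, add_zero]
  · intro j hj
    refine Finset.sum_eq_zero fun i hi => ?_
    rw [Finset.mem_Ico] at hi
    simp only [Nat.cast_sub hi.2.le]
    ring
  · intro a ha
    refine Finset.sum_eq_zero fun b hb => ?_
    push_cast
    ring

theorem coagFrag_one_le {h : ℝ} (hh : 0 < h) (N : ℕ) {c : ℕ → ℝ} (hc : ∀ n, 0 ≤ c n) :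
    coagFrag h N c (fun _ => 1) ≤ 1 / 2 * expMoment (2 * N + 1) (fun n => h * n) c 1 0 := by
  unfold coagFrag
  refine (add_le_of_nonpos_left (Finset.sum_nonpos fun a _ => Finset.sum_nonpos fun b _ => ?_)).trans
    ?_
  · have := mul_nonneg (hc a) (hc b)
    have : 0 ≤ h * a * (h * b) * (c a * c b) := by positivity
    linarith
  · rw [expMoment, Finset.mul_sum]
    refine Finset.sum_le_sum fun j _ => ?_
    rw [Finset.sum_const, Nat.card_Ico, nsmul_eq_mul]
    have h1 : ((j - 1 : ℕ) : ℝ) ≤ j := by exact_mod_cast Nat.sub_le j 1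
    have h2 : 0 ≤ h / 2 * c j := mul_nonneg (by positivity) (hc j)
    simp only [mul_zero, neg_zero, Real.exp_zero, pow_one]
    nlinarith

namespace IsCoagFragSolution

variable {h : ℝ} {N : ℕ} {c : ℕ → ℝ → ℝ}

theorem hasDerivAt_sum (H : IsCoagFragSolution h N c) (ψ : ℕ → ℝ) {t : ℝ} (ht : 0 ≤ t) :
    HasDerivAt (fun t => ∑ n ∈ Finset.range (2 * N + 1), c n t * ψ n)
      (coagFrag h N (fun k => c k t) ψ) t := by
  have h1 := HasDerivAt.fun_sum (u := Finset.range (2 * N + 1))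
    fun n hn => (H.hasDerivAt n hn t ht).mul_const (ψ n)
  rw [← sum_mul_coagFrag_single]
  exact h1.congr_deriv (Finset.sum_congr rfl fun n _ => mul_comm _ _)

theorem continuous_coeff (H : IsCoagFragSolution h N c) (n : ℕ) : Continuous (c n) :=
  (H.contDiff n).continuous

theorem mass_eq (H : IsCoagFragSolution h N c) {t : ℝ} (ht : 0 ≤ t) :
    expMoment (2 * N + 1) (fun n => h * n) (fun n => c n t) 1 0 =
      expMoment (2 * N + 1) (fun n => h * n) (fun n => c n 0) 1 0 := by
  have key := constant_of_has_deriv_right_zero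
    (f := fun t => ∑ n ∈ Finset.range (2 * N + 1), c n t * (h * n)) (a := 0) (b := t)
    (fun s hs => (H.hasDerivAt_sum _ hs.1).continuousAt.continuousWithinAt)
    (fun s hs => by
      have := H.hasDerivAt_sum (fun n => h * n) hs.1
      rw [coagFrag_linear] at this
      exact this.hasDerivWithinAt) t ⟨ht, le_rfl⟩
  simpa [expMoment] using key

theorem number_le (H : IsCoagFragSolution h N c) (hh : 0 < h)
    (hM : expMoment (2 * N + 1) (fun n => h * n) (fun n => c n 0) 1 0 ≤ 2) {t : ℝ} (ht : 0 ≤ t) :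
    ∑ n ∈ Finset.range (2 * N + 1), c n t ≤ ∑ n ∈ Finset.range (2 * N + 1), c n 0 + t := by
  have hd : ∀ s, 0 ≤ s → HasDerivAt (fun t => ∑ n ∈ Finset.range (2 * N + 1), c n t - t)
      (coagFrag h N (fun k => c k s) (fun _ => 1) - 1) s := fun s hs => by
    have := (H.hasDerivAt_sum (fun _ => 1) hs).fun_sub (hasDerivAt_id s)
    simpa using this
  have hanti : AntitoneOn (fun t => ∑ n ∈ Finset.range (2 * N + 1), c n t - t) (Ici 0) := by
    refine antitoneOn_of_deriv_nonpos (convex_Ici 0)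
      (fun s hs => (hd s hs).continuousAt.continuousWithinAt) (fun s hs => ?_) (fun s hs => ?_)
    all_goals rw [interior_Ici] at hs
    · exact (hd s (le_of_lt hs)).differentiableAt.differentiableWithinAt
    · rw [(hd s (le_of_lt hs)).deriv]
      have h1 := coagFrag_one_le hh N (c := fun k => c k s) fun n => H.nonneg n s (le_of_lt hs)
      rw [H.mass_eq (le_of_lt hs)] at h1
      linarith
  have := hanti (mem_Ici.2 le_rfl) (mem_Ici.2 ht) ht
  simp only at this
  linarith

theorem hasDerivAt_bernsteinSum_time (H : IsCoagFragSolution h N c) (x : ℝ) {t : ℝ} (ht : 0 ≤ t) :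
    HasDerivAt (fun t => bernsteinSum (2 * N + 1) (fun n => h * n) (fun n => c n t) x)
      (coagFrag h N (fun k => c k t) fun n => 1 - Real.exp (-(h * n * x))) t :=
  H.hasDerivAt_sum _ ht

end IsCoagFragSolution

theorem hasDerivAt_expMoment (k : ℕ) (s c : ℕ → ℝ) (p : ℕ) (x : ℝ) :
    HasDerivAt (expMoment k s c p) (-expMoment k s c (p + 1) x) x := by
  have h1 := HasDerivAt.fun_sum (u := Finset.range k) fun n _ =>
    ((((hasDerivAt_id x).const_mul (s n)).fun_neg).exp).const_mul (c n * s n ^ p)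
  refine h1.congr_deriv ?_
  rw [expMoment, ← Finset.sum_neg_distrib]
  refine Finset.sum_congr rfl fun n _ => ?_
  simp only [id, pow_succ]
  ring

theorem hasDerivAt_bernsteinSum (k : ℕ) (s c : ℕ → ℝ) (x : ℝ) :
    HasDerivAt (bernsteinSum k s c) (expMoment k s c 1 x) x := by
  have h1 := HasDerivAt.fun_sum (u := Finset.range k) fun n _ =>
    (((((hasDerivAt_id x).const_mul (s n)).fun_neg).exp).const_sub 1).const_mul (c n)
  refine h1.congr_deriv ?_
  rw [expMoment]
  refine Finset.sum_congr rfl fun n _ => ?_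
  simp only [id]
  ring

theorem exp_neg_le_quadratic {y : ℝ} (hy : 0 ≤ y) : Real.exp (-y) ≤ 1 - y + y ^ 2 / 2 := by
  have h1 := Real.quadratic_le_exp_of_nonneg hy
  have h2 : 0 < 1 - y + y ^ 2 / 2 := by nlinarith [sq_nonneg (y - 1)]
  have h3 : 0 < Real.exp y := Real.exp_pos y
  rw [Real.exp_neg, inv_le_iff_one_le_mul₀ h3]
  nlinarith [mul_le_mul_of_nonneg_left h1 h2.le, sq_nonneg (y ^ 2)]

theorem expMoment_nonneg {k : ℕ} {s c : ℕ → ℝ} (hs : ∀ n, 0 ≤ s n) (hc : ∀ n, 0 ≤ c n)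
    (p : ℕ) (x : ℝ) : 0 ≤ expMoment k s c p x :=
  Finset.sum_nonneg fun n _ =>
    mul_nonneg (mul_nonneg (hc n) (pow_nonneg (hs n) p)) (Real.exp_pos _).le

theorem expMoment_le_zero {k : ℕ} {s c : ℕ → ℝ} (hs : ∀ n, 0 ≤ s n) (hc : ∀ n, 0 ≤ c n)
    (p : ℕ) {x : ℝ} (hx : 0 ≤ x) :
    expMoment k s c p x ≤ expMoment k s c p 0 := by
  refine Finset.sum_le_sum fun n _ => ?_
  refine mul_le_mul_of_nonneg_left ?_ (mul_nonneg (hc n) (pow_nonneg (hs n) p))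
  rw [Real.exp_le_exp]
  nlinarith [mul_nonneg (hs n) hx]

theorem bernsteinSum_nonneg {k : ℕ} {s c : ℕ → ℝ} (hs : ∀ n, 0 ≤ s n) (hc : ∀ n, 0 ≤ c n)
    {x : ℝ} (hx : 0 ≤ x) : 0 ≤ bernsteinSum k s c x :=
  Finset.sum_nonneg fun n _ => mul_nonneg (hc n) (one_sub_exp_nonneg (mul_nonneg (hs n) hx))

theorem bernsteinSum_le_mul {k : ℕ} {s c : ℕ → ℝ} (hc : ∀ n, 0 ≤ c n) (x : ℝ) :
    bernsteinSum k s c x ≤ expMoment k s c 1 0 * x := by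
  rw [bernsteinSum, expMoment, Finset.sum_mul]
  refine Finset.sum_le_sum fun n _ => ?_
  have := Real.add_one_le_exp (-(s n * x))
  simp only [mul_zero, neg_zero, Real.exp_zero, pow_one, mul_one]
  nlinarith [hc n]

theorem bernsteinSum_le_sum {k : ℕ} {s c : ℕ → ℝ} (hc : ∀ n, 0 ≤ c n) (x : ℝ) :
    bernsteinSum k s c x ≤ ∑ n ∈ Finset.range k, c n := by
  refine Finset.sum_le_sum fun n _ => ?_
  have := Real.exp_pos (-(s n * x))
  nlinarith [hc n]

theorem mul_sub_bernsteinSum_le {k : ℕ} {s c : ℕ → ℝ} (hs : ∀ n, 0 ≤ s n) (hc : ∀ n, 0 ≤ c n)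
    {x : ℝ} (hx : 0 ≤ x) :
    expMoment k s c 1 0 * x - bernsteinSum k s c x ≤ 1 / 2 * expMoment k s c 2 0 * x ^ 2 := by
  simp only [bernsteinSum, expMoment]
  rw [Finset.sum_mul, Finset.mul_sum, Finset.sum_mul, ← Finset.sum_sub_distrib]
  refine Finset.sum_le_sum fun n _ => ?_
  have h1 : Real.exp (-(s n * x)) ≤ 1 - s n * x + (s n * x) ^ 2 / 2 := by
    exact exp_neg_le_quadratic (mul_nonneg (hs n) hx)
  simp only [mul_zero, neg_zero, Real.exp_zero, pow_one, mul_one]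
  nlinarith [hc n]

theorem tail_le_mul_sub_bernsteinSum {k : ℕ} {s c : ℕ → ℝ} (hc : ∀ n, 0 ≤ c n)
    {x : ℝ} {T : Finset ℕ} (hT : T ⊆ Finset.range k)
    (h2 : ∀ n ∈ T, 2 ≤ s n * x) :
    (∑ n ∈ T, s n * c n) * x ≤
      2 * (expMoment k s c 1 0 * x - bernsteinSum k s c x) := by
  simp only [bernsteinSum, expMoment]
  rw [Finset.sum_mul (Finset.range k), ← Finset.sum_sub_distrib, Finset.mul_sum, Finset.sum_mul]
  refine (Finset.sum_le_sum fun n hn => ?_).trans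
    (Finset.sum_le_sum_of_subset_of_nonneg hT fun n _ _ => ?_)
  · have := Real.exp_pos (-(s n * x))
    have := h2 n hn
    simp only [mul_zero, neg_zero, Real.exp_zero, pow_one, mul_one]
    nlinarith [hc n]
  · have := Real.add_one_le_exp (-(s n * x))
    simp only [mul_zero, neg_zero, Real.exp_zero, pow_one, mul_one]
    nlinarith [hc n]

theorem nonneg_of_hasDerivAt_of_le_left {f : ℝ → ℝ} {d a b : ℝ} (hab : a < b)
    (hf : HasDerivAt f d b) (h : ∀ r, a < r → r < b → f r ≤ f b) : 0 ≤ d := by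
  have h1 := (hasDerivWithinAt_iff_tendsto_slope' (s := Iio b) (by simp)).1 hf.hasDerivWithinAt
  refine ge_of_tendsto h1 ?_
  filter_upwards [Ioo_mem_nhdsLT hab] with r hr
  rw [slope_def_field]
  exact div_nonneg_of_nonpos (by linarith [h r hr.1 hr.2]) (by linarith [hr.2])

namespace IsCoagFragSolution

variable {h : ℝ} {N : ℕ} {c : ℕ → ℝ → ℝ}

theorem abs_residual_le (H : IsCoagFragSolution h N c) (hh : 0 < h) {m : ℝ} (hm : m < 1 / 2)
    (hM : expMoment (2 * N + 1) (fun n => h * n) (fun n => c n 0) 1 0 ≤ m) {x t : ℝ} (hx : 0 < x)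
    (ht : 0 ≤ t) :
    |coagFrag h N (fun k => c k t) (fun n => 1 - Real.exp (-(h * n * x))) +
        1 / 2 * (expMoment (2 * N + 1) (fun n => h * n) (fun n => c n t) 1 x - m) *
          (expMoment (2 * N + 1) (fun n => h * n) (fun n => c n t) 1 x - m - 1) +
        bernsteinSum (2 * N + 1) (fun n => h * n) (fun n => c n t) x / x - m| ≤
      1 / 2 * (m - expMoment (2 * N + 1) (fun n => h * n) (fun n => c n 0) 1 0 +
        ∑ n ∈ Finset.Ico (N + 1) (2 * N + 1), h * n * c n t +
        h * bernsteinSum (2 * N + 1) (fun n => h * n) (fun n => c n t) x) := by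
  have hc : ∀ n, 0 ≤ c n t := fun n => H.nonneg n t ht
  obtain ⟨K, hK0, hK1, hK2, hK3⟩ := coagFrag_one_sub_exp hh hx N (c := fun n => c n t) hc
  have hP0 := expMoment_nonneg (k := 2 * N + 1) (s := fun n => h * n) (c := fun n => c n t)
    (fun n => by positivity) hc 1 x
  rw [H.mass_eq ht] at hK1 hK2 hK3
  set M := expMoment (2 * N + 1) (fun n => h * n) (fun n => c n 0) 1 0
  set P := expMoment (2 * N + 1) (fun n => h * n) (fun n => c n t) 1 x
  set G := bernsteinSum (2 * N + 1) (fun n => h * n) (fun n => c n t) x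
  set τ := ∑ n ∈ Finset.Ico (N + 1) (2 * N + 1), h * n * c n t
  rw [abs_le] at hK3 ⊢
  have h1 : 0 ≤ (m - P - K) * (m - P + K) := mul_nonneg (by linarith) (by linarith)
  have h2 : (m - P - K) * (m - P + K) ≤ (m - M + τ) * 1 :=
    mul_le_mul (by linarith) (by linarith) (by linarith) (by linarith)
  constructor <;> nlinarith

theorem neg_coagFrag_le (H : IsCoagFragSolution h N c) (hh : 0 < h) {x t : ℝ} (hx : 0 < x)
    (ht : 0 ≤ t) {M q G : ℝ}
    (hM : M = expMoment (2 * N + 1) (fun n => h * n) (fun n => c n 0) 1 0)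
    (hq : q = M - expMoment (2 * N + 1) (fun n => h * n) (fun n => c n t) 1 x)
    (hG : G = bernsteinSum (2 * N + 1) (fun n => h * n) (fun n => c n t) x) :
    -coagFrag h N (fun k => c k t) (fun n => 1 - Real.exp (-(h * n * x))) ≤
      1 / 2 * q ^ 2 + 1 / 2 * q - (M * x - G) / x + 1 / 2 * h * G := by
  obtain ⟨K, hK0, hK1, hK2, hK3⟩ := coagFrag_one_sub_exp hh hx N (c := fun n => c n t)
    fun n => H.nonneg n t ht
  rw [H.mass_eq ht, ← hM, ← hG] at hK3
  rw [H.mass_eq ht, ← hM, ← hq] at hK1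
  have hP : expMoment (2 * N + 1) (fun n => h * n) (fun n => c n t) 1 x = M - q := by
    rw [hq]; ring
  rw [hP, abs_le] at hK3
  have h1 : (M * x - G) / x = M - G / x := by field_simp
  rw [h1]
  nlinarith

theorem continuous_bernsteinSum (H : IsCoagFragSolution h N c) :
    Continuous fun p : ℝ × ℝ =>
      bernsteinSum (2 * N + 1) (fun n => h * n) (fun n => c n p.2) p.1 := by
  refine continuous_finsetSum _ fun n _ => ?_
  have := H.continuous_coeff n
  exact (this.comp continuous_snd).mul (by fun_prop)

/-- A barrier for the mass defect `M x - G(x,t)` near `x = 0`, uniform in time. -/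
theorem mass_defect_le_rpow (H : IsCoagFragSolution h N c) (hh : 0 < h) (hh' : h ≤ 4 / 25)
    {A : ℝ} (hA : 1 ≤ A)
    (hM : expMoment (2 * N + 1) (fun n => h * n) (fun n => c n 0) 1 0 < 1 / 2)
    (h2 : expMoment (2 * N + 1) (fun n => h * n) (fun n => c n 0) 2 0 ≤ A) {x t : ℝ}
    (hx : 0 ≤ x) (hxA : x ≤ (1 / (2 * A)) ^ 5) (ht : 0 ≤ t) :
    expMoment (2 * N + 1) (fun n => h * n) (fun n => c n 0) 1 0 * x -
      bernsteinSum (2 * N + 1) (fun n => h * n) (fun n => c n t) x ≤ A * x ^ (6 / 5 : ℝ) := by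
  have hs : ∀ n : ℕ, 0 ≤ h * n := fun n => by positivity
  have hMpos := expMoment_nonneg (k := 2 * N + 1) (s := fun n => h * n) (c := fun n => c n 0)
    hs (fun n => H.nonneg n 0 le_rfl) 1 0
  set M := expMoment (2 * N + 1) (fun n => h * n) (fun n => c n 0) 1 0 with hMdef
  set X : ℝ := (1 / (2 * A)) ^ 5 with hX
  have hr0 : 0 < 1 / (2 * A) := by positivity
  have hr1 : 1 / (2 * A) ≤ 1 / 2 := one_div_le_one_div_of_le (by norm_num) (by linarith)
  have hX0 : 0 < X := by positivity
  have hX1 : X ≤ 1 := pow_le_one₀ hr0.le (by linarith)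
  have hXr : X ^ (1 / 5 : ℝ) = 1 / (2 * A) := by
    rw [hX, ← Real.rpow_natCast, ← Real.rpow_mul hr0.le]
    norm_num
  have hsplit : ∀ y : ℝ, 0 ≤ y → y ^ (6 / 5 : ℝ) = y ^ (1 / 5 : ℝ) * y := fun y hy => by
    rcases hy.eq_or_lt with rfl | hy
    · norm_num
    · rw [show (6 / 5 : ℝ) = 1 / 5 + 1 by norm_num, Real.rpow_add hy, Real.rpow_one]
  by_contra! hcon
  set Φ : ℝ × ℝ → ℝ := fun p => M * p.1 -
    bernsteinSum (2 * N + 1) (fun n => h * n) (fun n => c n p.2) p.1 - A * p.1 ^ (6 / 5 : ℝ)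
    with hΦ
  have hΦc : Continuous Φ := by
    have h1 := H.continuous_bernsteinSum
    have h2 : Continuous fun p : ℝ × ℝ => p.1 ^ (6 / 5 : ℝ) :=
      (Real.continuous_rpow_const (by norm_num)).comp continuous_fst
    fun_prop
  obtain ⟨⟨x₀, t₀⟩, ⟨⟨hx0, hxX⟩, ⟨ht0, htt⟩⟩, hmax⟩ :=
    ((isCompact_Icc (a := (0 : ℝ)) (b := X)).prod
      (isCompact_Icc (a := (0 : ℝ)) (b := t))).exists_isMaxOn
      ⟨(x, t), ⟨hx, hxA⟩, ht, le_rfl⟩ hΦc.continuousOn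
  simp only at hx0 hxX ht0 htt
  have hpos : 0 < Φ (x₀, t₀) := by
    have : Φ (x, t) ≤ Φ (x₀, t₀) := hmax ⟨⟨hx, hxA⟩, ht, le_rfl⟩
    refine lt_of_lt_of_le ?_ this
    simp only [hΦ]
    linarith
  have hc0 : ∀ n, 0 ≤ c n t₀ := fun n => H.nonneg n t₀ ht0
  set G := bernsteinSum (2 * N + 1) (fun n => h * n) (fun n => c n t₀) x₀ with hG
  have hG0 : 0 ≤ G := bernsteinSum_nonneg hs hc0 hx0
  have hGM : G ≤ M * x₀ := by
    rw [hMdef, ← H.mass_eq ht0]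
    exact bernsteinSum_le_mul hc0 x₀
  have hpos' : A * (x₀ ^ (1 / 5 : ℝ) * x₀) < M * x₀ - G := by
    have : 0 < M * x₀ - G - A * x₀ ^ (6 / 5 : ℝ) := hpos
    rw [hsplit x₀ hx0] at this
    linarith
  have hx0' : 0 < x₀ := by
    rcases hx0.eq_or_lt with h0 | h0
    · rw [← h0] at hpos' hGM
      norm_num at hpos' hGM
      linarith
    · exact h0
  set y := x₀ ^ (1 / 5 : ℝ) with hy
  have hxy : x₀ ≤ y := by
    have := Real.rpow_le_rpow_of_exponent_ge hx0' (hxX.trans hX1) (show (1 / 5 : ℝ) ≤ 1 by norm_num)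
    rwa [Real.rpow_one] at this
  have hyX : y ≤ 1 / (2 * A) := by
    rw [← hXr]
    exact Real.rpow_le_rpow hx0 hxX (by norm_num)
  have hAy : A * y ≤ 1 / 2 := by
    calc A * y ≤ A * (1 / (2 * A)) := by gcongr
      _ = 1 / 2 := by field_simp
  have hxX' : x₀ < X := by
    refine lt_of_le_of_ne hxX fun heq => ?_
    rw [hy, heq, hXr, ← heq] at hpos'
    have : A * (1 / (2 * A) * x₀) = 1 / 2 * x₀ := by field_simp
    rw [this] at hpos'
    linarith [mul_lt_mul_of_pos_right hM hx0']
  have ht0' : 0 < t₀ := by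
    refine lt_of_le_of_ne ht0 fun heq => ?_
    have h3 := mul_sub_bernsteinSum_le (k := 2 * N + 1) hs hc0 hx0
    rw [H.mass_eq ht0, ← hG] at h3
    rw [← heq] at h3
    have h4 : 1 / 2 * expMoment (2 * N + 1) (fun n => h * n) (fun n => c n 0) 2 0 * x₀ ^ 2 ≤
        A * (y * x₀) := by
      have := mul_le_mul_of_nonneg_right h2 (sq_nonneg x₀)
      have : x₀ ^ 2 ≤ y * x₀ := by rw [sq]; exact mul_le_mul_of_nonneg_right hxy hx0
      have : A * x₀ ^ 2 ≤ A * (y * x₀) := mul_le_mul_of_nonneg_left this (by linarith)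
      linarith [mul_nonneg (show 0 ≤ A by linarith) (sq_nonneg x₀)]
    linarith
  have hdt : 0 ≤ -coagFrag h N (fun k => c k t₀) (fun n => 1 - Real.exp (-(h * n * x₀))) := by
    refine nonneg_of_hasDerivAt_of_le_left ht0'
      (((H.hasDerivAt_bernsteinSum_time x₀ ht0).const_sub (M * x₀)).sub_const
        (A * x₀ ^ (6 / 5 : ℝ))) fun r hr0 hr => ?_
    have hmem : (x₀, r) ∈ Icc 0 X ×ˢ Icc 0 t := ⟨⟨hx0, hxX⟩, hr0.le, hr.le.trans htt⟩
    exact hmax hmem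
  have hdx : M - expMoment (2 * N + 1) (fun n => h * n) (fun n => c n t₀) 1 x₀ =
      A * (6 / 5 * y) := by
    have hd := (((hasDerivAt_id x₀).const_mul M).fun_sub (hasDerivAt_bernsteinSum (2 * N + 1)
      (fun n => h * n) (fun n => c n t₀) x₀)).fun_sub
      ((Real.hasDerivAt_rpow_const (p := 6 / 5) (Or.inl hx0'.ne')).const_mul A)
    have hloc : IsLocalMax (fun x => Φ (x, t₀)) x₀ := by
      filter_upwards [Icc_mem_nhds hx0' hxX'] with z hz
      exact hmax ⟨hz, ht0, htt⟩
    have := hloc.hasDerivAt_eq_zero hd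
    rw [show (6 / 5 - 1 : ℝ) = 1 / 5 by norm_num, ← hy] at this
    linarith
  have hkey := hdt.trans (H.neg_coagFrag_le hh hx0' ht0 hMdef hdx.symm hG)
  rw [show (A * (6 / 5 * y)) ^ 2 = 36 / 25 * (A * y * (A * y)) by ring] at hkey
  have h5 : A * y < (M * x₀ - G) / x₀ := by
    rw [lt_div_iff₀ hx0']
    linarith
  have h6 : 1 / 2 * h * G ≤ 1 / 25 * y := by
    have : G ≤ 1 / 2 * y := by linarith [mul_le_mul_of_nonneg_right hM.le hx0]
    linarith [mul_le_mul_of_nonneg_right hh' hG0]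
  have hy0 : 0 < y := lt_of_lt_of_le hx0' hxy
  have hyA : y ≤ A * y := le_mul_of_one_le_left hy0.le hA
  have hsq : (A * y) * (A * y) ≤ 1 / 2 * (A * y) := mul_le_mul_of_nonneg_right hAy (by linarith)
  linarith

theorem tail_mass_le (H : IsCoagFragSolution h N c) (hh : 0 < h) (hh' : h ≤ 4 / 25)
    {A : ℝ} (hA : 1 ≤ A)
    (hM : expMoment (2 * N + 1) (fun n => h * n) (fun n => c n 0) 1 0 < 1 / 2)
    (h2 : expMoment (2 * N + 1) (fun n => h * n) (fun n => c n 0) 2 0 ≤ A) {x t : ℝ}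
    (hx : 0 < x) (hxN : 2 ≤ h * N * x) (hxA : x ≤ (1 / (2 * A)) ^ 5) (ht : 0 ≤ t) :
    ∑ n ∈ Finset.Ico (N + 1) (2 * N + 1), h * n * c n t ≤ 2 * A * x ^ (1 / 5 : ℝ) := by
  have h1 := H.mass_defect_le_rpow hh hh' hA hM h2 hx.le hxA ht
  have h3 := tail_le_mul_sub_bernsteinSum (k := 2 * N + 1) (s := fun n => h * n)
    (c := fun n => c n t) (x := x) (T := Finset.Ico (N + 1) (2 * N + 1))
    (fun n => H.nonneg n t ht) (fun n hn => Finset.mem_range.2 (Finset.mem_Ico.1 hn).2)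
    (fun n hn => hxN.trans (by
      have : (N : ℝ) ≤ n := by exact_mod_cast (Nat.lt_of_succ_le (Finset.mem_Ico.1 hn).1).le
      gcongr))
  rw [H.mass_eq ht] at h3
  rw [show (6 / 5 : ℝ) = 1 / 5 + 1 by norm_num, Real.rpow_add hx, Real.rpow_one] at h1
  refine le_of_mul_le_mul_right ?_ hx
  linarith

end IsCoagFragSolution

theorem integral_comp_nat_eq_sum {α : Type*} [MeasurableSpace α] {ν : Measure α}
    [IsFiniteMeasure ν] {κ : α → ℕ} (hκ : Measurable κ) {k : ℕ} (hk : ∀ a, κ a < k) (f : ℕ → ℝ) :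
    Integrable (fun a => f (κ a)) ν ∧
      ∫ a, f (κ a) ∂ν = ∑ j ∈ Finset.range k, ν.real (κ ⁻¹' {j}) * f j := by
  have hmeas : ∀ j, MeasurableSet (κ ⁻¹' {j}) := fun j => hκ (measurableSet_singleton j)
  have hrep : (fun a => f (κ a)) =
      fun a => ∑ j ∈ Finset.range k, (κ ⁻¹' {j}).indicator (fun _ => f j) a := by
    funext a
    rw [Finset.sum_eq_single (κ a)]
    · simp
    · intro j _ hj
      exact indicator_of_notMem (fun h => hj h.symm) _
    · intro h
      exact absurd (Finset.mem_range.2 (hk a)) h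
  have hfint : ∀ j ∈ Finset.range k,
      Integrable (fun a => (κ ⁻¹' {j}).indicator (fun _ => f j) a) ν :=
    fun j _ => (integrable_const (f j)).indicator (hmeas j)
  rw [hrep]
  refine ⟨integrable_finsetSum _ hfint, ?_⟩
  rw [integral_finsetSum _ hfint]
  refine Finset.sum_congr rfl fun j _ => ?_
  rw [integral_indicator_const _ (hmeas j), smul_eq_mul]

/-- A finite exponential sum solving the Hamilton–Jacobi equation up to a small residual. -/
structure IsApproximant (m C : ℝ) (F₀ : ℝ → ℝ) (ε : ℝ) (k : ℕ) (s : ℕ → ℝ) (c : ℕ → ℝ → ℝ) :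
    Prop where
  size_nonneg : ∀ n, 0 ≤ s n
  contDiff : ∀ n, ContDiff ℝ 1 (c n)
  nonneg : ∀ n t, 0 ≤ t → 0 ≤ c n t
  mass_le : ∀ t, 0 ≤ t → expMoment k s (fun n => c n t) 1 0 ≤ m
  number_le : ∀ t, 0 ≤ t → ∑ n ∈ Finset.range k, c n t ≤ C + t
  initial : ∀ x, 0 ≤ x → |F₀ x - bernsteinSum k s (fun n => c n 0) x| ≤ ε * x
  residual : ∀ x t, 0 < x → 0 < t →
    |deriv (fun t => bernsteinSum k s (fun n => c n t) x) t +
      1 / 2 * (expMoment k s (fun n => c n t) 1 x - m) *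
        (expMoment k s (fun n => c n t) 1 x - m - 1) +
      bernsteinSum k s (fun n => c n t) x / x - m| ≤ ε * (1 + t)

/-- Discretization of a finite measure on `(0, ∞)` on the grid `h ℕ ∩ [0, h N]`. -/
theorem exists_discretization {μ : Measure ℝ} {m C : ℝ}
    (hμ_int₁ : IntegrableOn (fun s => s) (Ioi 0) μ)
    (hμ_m : (∫ s in Ioi (0 : ℝ), s ∂μ) = m)
    (hC : 0 < C)
    (hμ_zeroth : μ (Ioi 0) ≤ ENNReal.ofReal C)
    (hμ_int₂ : IntegrableOn (fun s => s ^ 2) (Ioi 0) μ)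
    (hμ_second : (∫ s in Ioi (0 : ℝ), s ^ 2 ∂μ) ≤ C)
    {h : ℝ} (hh : 0 < h) {N : ℕ} (hN : 0 < N) :
    ∃ c : ℕ → ℝ, (∀ n, 0 ≤ c n) ∧
      ∑ n ∈ Finset.range (2 * N + 1), c n ≤ C ∧
      expMoment (2 * N + 1) (fun n => h * n) c 1 0 ≤ m ∧
      m - expMoment (2 * N + 1) (fun n => h * n) c 1 0 ≤ C * (h + 1 / (h * N)) ∧
      expMoment (2 * N + 1) (fun n => h * n) c 2 0 ≤ C ∧
      ∀ x, 0 ≤ x → |∫ s in Ioi (0 : ℝ), (1 - Real.exp (-(s * x))) ∂μ -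
        bernsteinSum (2 * N + 1) (fun n => h * n) c x| ≤ C * (h + 1 / (h * N)) * x := by
  set ν := μ.restrict (Ioi 0) with hν
  have hνC : ν univ ≤ ENNReal.ofReal C := by rwa [hν, Measure.restrict_apply_univ]
  have : IsFiniteMeasure ν := ⟨lt_of_le_of_lt hνC ENNReal.ofReal_lt_top⟩
  have hνC' : ν.real univ ≤ C := ENNReal.toReal_le_of_le_ofReal hC.le hνC
  have hae : ∀ᵐ s ∂ν, 0 < s := ae_restrict_mem measurableSet_Ioi
  have hN' : (0 : ℝ) < N := by exact_mod_cast hN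
  set κ : ℝ → ℕ := fun s => if ⌊s / h⌋₊ ≤ N then ⌊s / h⌋₊ else 0 with hκ
  have hfl : Measurable fun s : ℝ => ⌊s / h⌋₊ :=
    Nat.measurable_floor.comp (measurable_id.div_const h)
  have hκm : Measurable κ :=
    Measurable.ite (measurableSet_le hfl measurable_const) hfl measurable_const
  have hκN : ∀ s, κ s < 2 * N + 1 := fun s => by simp only [hκ]; split_ifs <;> omega
  have hκ1 : ∀ s, 0 < s → h * κ s ≤ s := by
    intro s hs
    simp only [hκ]
    split_ifs
    · have := Nat.floor_le (div_pos hs hh).le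
      rw [le_div_iff₀ hh] at this
      linarith
    · simpa using hs.le
  have hκ2 : ∀ s, 0 < s → s - h * κ s ≤ h + 1 / (h * N) * s ^ 2 := by
    intro s hs
    have hpos : 0 ≤ 1 / (h * N) * s ^ 2 := by positivity
    simp only [hκ]
    split_ifs with hcase
    · have := Nat.lt_floor_add_one (s / h)
      rw [div_lt_iff₀ hh] at this
      linarith
    · have h1 : (N : ℝ) ≤ s / h := (Nat.le_floor_iff (div_pos hs hh).le).1 (not_le.1 hcase).le
      rw [le_div_iff₀ hh] at h1
      have h2 : s ≤ 1 / (h * N) * s ^ 2 := by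
        rw [one_div, inv_mul_eq_div, le_div_iff₀ (by positivity)]
        nlinarith
      simp only [Nat.cast_zero, mul_zero]
      linarith
  set c : ℕ → ℝ := fun n => ν.real (κ ⁻¹' {n}) with hcdef
  have hrep : ∀ f : ℕ → ℝ, Integrable (fun a => f (κ a)) ν ∧
      ∫ a, f (κ a) ∂ν = ∑ j ∈ Finset.range (2 * N + 1), c j * f j :=
    fun f => integral_comp_nat_eq_sum hκm hκN f
  have herr_int : Integrable (fun s => h + 1 / (h * N) * s ^ 2) ν :=
    (integrable_const h).add (hμ_int₂.const_mul _)
  have herr : ∫ s, (h + 1 / (h * N) * s ^ 2) ∂ν ≤ C * (h + 1 / (h * N)) := by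
    rw [integral_add (integrable_const h) (hμ_int₂.const_mul _), integral_const, integral_const_mul,
      smul_eq_mul]
    have h1 : ν.real univ * h ≤ C * h := mul_le_mul_of_nonneg_right hνC' hh.le
    have h2 : 1 / (h * N) * ∫ s, s ^ 2 ∂ν ≤ 1 / (h * N) * C :=
      mul_le_mul_of_nonneg_left hμ_second (by positivity)
    linarith
  have hM := hrep fun n => h * n
  have hM' : expMoment (2 * N + 1) (fun n => h * n) c 1 0 = ∫ a, h * κ a ∂ν := by
    rw [hM.2]; simp [expMoment]
  refine ⟨c, fun n => ENNReal.toReal_nonneg, ?_, ?_, ?_, ?_, ?_⟩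
  · have h1 := (hrep fun _ => 1).2
    simp only [mul_one, integral_const, smul_eq_mul] at h1
    rwa [← h1]
  · rw [hM', ← hμ_m]
    exact integral_mono_ae hM.1 hμ_int₁ (hae.mono hκ1)
  · rw [hM', ← hμ_m, ← integral_sub hμ_int₁ hM.1]
    exact (integral_mono_ae (hμ_int₁.sub hM.1) herr_int (hae.mono hκ2)).trans herr
  · have h1 := hrep fun n => (h * n) ^ 2
    have : expMoment (2 * N + 1) (fun n => h * n) c 2 0 = ∫ a, (h * κ a) ^ 2 ∂ν := by
      rw [h1.2]; simp [expMoment]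
    rw [this]
    refine (integral_mono_ae h1.1 hμ_int₂ (hae.mono fun s hs => ?_)).trans hμ_second
    exact pow_le_pow_left₀ (by positivity) (hκ1 s hs) 2
  · intro x hx
    have h1 := hrep fun n => 1 - Real.exp (-(h * n * x))
    have hb : bernsteinSum (2 * N + 1) (fun n => h * n) c x =
        ∫ a, (1 - Real.exp (-(h * κ a * x))) ∂ν := by
      rw [h1.2]; simp [bernsteinSum]
    have hcont : Continuous fun s : ℝ => 1 - Real.exp (-(s * x)) := by fun_prop
    have hfint : Integrable (fun s : ℝ => 1 - Real.exp (-(s * x))) ν := by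
      refine Integrable.mono' (integrable_const (1 : ℝ)) hcont.aestronglyMeasurable
        (hae.mono fun s hs => ?_)
      have := one_sub_exp_nonneg (mul_nonneg hs.le hx)
      have := Real.exp_pos (-(s * x))
      rw [Real.norm_of_nonneg (by assumption)]
      linarith
    rw [hb, ← integral_sub hfint h1.1]
    have hpt : ∀ s, 0 < s → |(1 - Real.exp (-(s * x))) - (1 - Real.exp (-(h * κ s * x)))| ≤
        (h + 1 / (h * N) * s ^ 2) * x := by
      intro s hs
      refine le_trans ?_ (mul_le_mul_of_nonneg_right (hκ2 s hs) hx)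
      have e1 : Real.exp (-(s * x)) =
          Real.exp (-(h * κ s * x)) * Real.exp (-((s - h * κ s) * x)) := by
        rw [← Real.exp_add]; congr 1; ring
      have e2 := one_sub_exp_nonneg (mul_nonneg (sub_nonneg.2 (hκ1 s hs)) hx)
      have e3 := Real.add_one_le_exp (-((s - h * κ s) * x))
      have e4 := one_sub_exp_nonneg (y := h * κ s * x) (by positivity)
      have e5 := Real.exp_pos (-(h * κ s * x))
      rw [e1, abs_of_nonneg (by nlinarith)]
      nlinarith
    calc _ ≤ ∫ s, |(1 - Real.exp (-(s * x))) - (1 - Real.exp (-(h * κ s * x)))| ∂ν :=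
          abs_integral_le_integral_abs
      _ ≤ ∫ s, (h + 1 / (h * N) * s ^ 2) * x ∂ν :=
          integral_mono_ae (hfint.sub h1.1).abs (herr_int.mul_const x) (hae.mono hpt)
      _ ≤ _ := by
          rw [integral_mul_const]
          exact mul_le_mul_of_nonneg_right herr hx

/-- Existence of arbitrarily good approximants. -/
theorem exists_isApproximant {μ : Measure ℝ} {m C : ℝ} (hm₁ : m < 1 / 2)
    (hμ_int₁ : IntegrableOn (fun s => s) (Ioi 0) μ)
    (hμ_m : (∫ s in Ioi (0 : ℝ), s ∂μ) = m)
    (hC : 0 < C)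
    (hμ_zeroth : μ (Ioi 0) ≤ ENNReal.ofReal C)
    (hμ_int₂ : IntegrableOn (fun s => s ^ 2) (Ioi 0) μ)
    (hμ_second : (∫ s in Ioi (0 : ℝ), s ^ 2 ∂μ) ≤ C)
    {F₀ : ℝ → ℝ}
    (hF₀ : ∀ x : ℝ, 0 ≤ x → F₀ x = ∫ s in Ioi (0 : ℝ), (1 - Real.exp (-(s * x))) ∂μ)
    {ε : ℝ} (hε : 0 < ε) : ∃ k s c, IsApproximant m C F₀ ε k s c := by
  set A := max 1 C with hA
  have hA1 : 1 ≤ A := le_max_left _ _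
  have hinv : Tendsto (fun n : ℕ => 1 / (n : ℝ)) atTop (nhds 0) :=
    tendsto_one_div_atTop_nhds_zero_nat
  have hlim : ∀ f : ℝ → ℝ, Continuous f → f 0 = 0 → ∀ η, 0 < η →
      ∀ᶠ n : ℕ in atTop, f (1 / (n : ℝ)) < η := by
    intro f hf hf0 η hη
    have := (hf.tendsto 0).comp hinv
    rw [hf0] at this
    exact this.eventually_lt_const hη
  obtain ⟨n, hn1, hn2, hn3, hn4, hn5, hn6, hn0⟩ :=
    ((hlim id continuous_id rfl (4 / 25) (by norm_num)).and
    ((hlim id continuous_id rfl ε hε).and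
    ((hlim (fun y => y * C) (by fun_prop) (by simp) (ε / 2) (by positivity)).and
    ((hlim (fun y => C * (y + y)) (by fun_prop) (by simp) (ε / 2) (by positivity)).and
    ((hlim (fun y => 2 * A * (2 * y) ^ (1 / 5 : ℝ))
      (continuous_const.mul ((Real.continuous_rpow_const (by norm_num)).comp (by fun_prop)))
      (by norm_num) (ε / 2) (by positivity)).and
    ((hlim (fun y => 2 * y) (by fun_prop) (by simp) ((1 / (2 * A)) ^ 5) (by positivity)).and
    (eventually_gt_atTop 0))))))).exists
  have hn : (0 : ℝ) < n := by exact_mod_cast hn0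
  set h : ℝ := 1 / (n : ℝ) with hh
  have hh0 : 0 < h := by positivity
  simp only [id] at hn1 hn2
  have hhN : h * ((n ^ 2 : ℕ) : ℝ) = n := by rw [hh]; push_cast; field_simp
  obtain ⟨c₀, hc0, hcC, hcm, hcδ, hc2, hcF⟩ := exists_discretization hμ_int₁ hμ_m hC hμ_zeroth
    hμ_int₂ hμ_second hh0 (N := n ^ 2) (by positivity)
  rw [hhN, ← hh] at hcδ hcF
  obtain ⟨c, hcd, hcini, hcpos, hcder⟩ := exists_coagFrag_solution hh0 (n ^ 2) hc0
  have H : IsCoagFragSolution h (n ^ 2) c := ⟨hcd, hcpos, hcder⟩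
  have hmom : ∀ p x, expMoment (2 * n ^ 2 + 1) (fun n => h * n) (fun n => c n 0) p x =
      expMoment (2 * n ^ 2 + 1) (fun n => h * n) c₀ p x := fun p x =>
    Finset.sum_congr rfl fun j hj => by simp only [hcini j hj]
  have hber : ∀ x, bernsteinSum (2 * n ^ 2 + 1) (fun n => h * n) (fun n => c n 0) x =
      bernsteinSum (2 * n ^ 2 + 1) (fun n => h * n) c₀ x := fun x =>
    Finset.sum_congr rfl fun j hj => by simp only [hcini j hj]
  have hnum : ∑ j ∈ Finset.range (2 * n ^ 2 + 1), c j 0 ≤ C := by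
    rwa [Finset.sum_congr rfl hcini]
  have hnumt : ∀ t, 0 ≤ t → ∑ j ∈ Finset.range (2 * n ^ 2 + 1), c j t ≤ C + t := fun t ht =>
    (H.number_le hh0 (by rw [hmom]; linarith) ht).trans (by linarith)
  refine ⟨2 * n ^ 2 + 1, fun j => h * j, c, fun j => by positivity, hcd, hcpos, ?_, hnumt, ?_, ?_⟩
  · intro t ht
    rwa [H.mass_eq ht, hmom]
  · intro x hx
    rw [hF₀ x hx, hber]
    exact (hcF x hx).trans (mul_le_mul_of_nonneg_right (by linarith) hx)
  · intro x t hx ht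
    rw [(H.hasDerivAt_bernsteinSum_time x ht.le).deriv]
    refine (H.abs_residual_le hh0 hm₁ (by rwa [hmom]) hx ht.le).trans ?_
    have htail := H.tail_mass_le hh0 hn1.le hA1 (by rw [hmom]; linarith)
      (by rw [hmom]; exact hc2.trans (le_max_right _ _)) (x := 2 * h) (by positivity)
      (by rw [hhN, hh]; field_simp; norm_num) hn6.le ht.le
    have hG := (bernsteinSum_le_sum (k := 2 * n ^ 2 + 1) (s := fun j => h * j)
      (c := fun j => c j t) (fun j => hcpos j t ht.le) x).trans (hnumt t ht.le)
    have hG' : h * bernsteinSum (2 * n ^ 2 + 1) (fun j => h * j) (fun j => c j t) x ≤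
        ε / 2 + ε * t := by
      refine (mul_le_mul_of_nonneg_left hG hh0.le).trans ?_
      have := mul_le_mul_of_nonneg_right hn2.le ht.le
      linarith
    rw [hmom]
    have := mul_nonneg hε.le ht.le
    linarith

/-- A continuous function on the quadrant with a coercive upper bound attains its maximum as soon
as it is positive somewhere. -/
theorem exists_isMaxOn_quadrant {u : ℝ × ℝ → ℝ} (hu : ContinuousOn u (Ici 0 ×ˢ Ici 0))
    {ε B L : ℝ} (hε : 0 < ε) (hB : 0 ≤ B)
    (hbd : ∀ x t, 0 ≤ x → 0 ≤ t → u (x, t) ≤ B + L * t - (ε * x + 4 * ε * (t + t ^ 2)))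
    {p : ℝ × ℝ} (hp : p ∈ Ici (0 : ℝ) ×ˢ Ici (0 : ℝ)) (hpos : 0 < u p) :
    ∃ q ∈ Ici (0 : ℝ) ×ˢ Ici (0 : ℝ), IsMaxOn u (Ici 0 ×ˢ Ici 0) q ∧ 0 < u q := by
  set b := B + L ^ 2 / (8 * ε) with hb
  have hb0 : 0 ≤ b := by positivity
  have hyoung : ∀ t, L * t ≤ 2 * ε * t ^ 2 + L ^ 2 / (8 * ε) := by
    intro t
    have : 2 * ε * t ^ 2 + L ^ 2 / (8 * ε) - L * t = (4 * ε * t - L) ^ 2 / (8 * ε) := by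
      field_simp; ring
    have h2 : 0 ≤ (4 * ε * t - L) ^ 2 / (8 * ε) := by positivity
    linarith
  have hout : ∀ x t, 0 ≤ x → 0 ≤ t → 0 < u (x, t) → x ≤ b / ε ∧ t ≤ b / ε := by
    intro x t hx ht hxt
    have h1 := hbd x t hx ht
    have h2 := hyoung t
    have h3 : 0 ≤ ε * x := by positivity
    have h4 : 0 ≤ ε * t := by positivity
    have h5 : 0 ≤ ε * t ^ 2 := by positivity
    rw [le_div_iff₀ hε, le_div_iff₀ hε]
    constructor <;> linarith
  have hsub : Icc 0 (b / ε) ×ˢ Icc 0 (b / ε) ⊆ Ici (0 : ℝ) ×ˢ Ici (0 : ℝ) :=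
    prod_mono Icc_subset_Ici_self Icc_subset_Ici_self
  have hpK : p ∈ Icc 0 (b / ε) ×ˢ Icc 0 (b / ε) := by
    have := hout p.1 p.2 hp.1 hp.2 hpos
    exact ⟨⟨hp.1, this.1⟩, hp.2, this.2⟩
  obtain ⟨q, hq, hmax⟩ := (isCompact_Icc.prod isCompact_Icc).exists_isMaxOn ⟨p, hpK⟩ (hu.mono hsub)
  have hqpos : 0 < u q := lt_of_lt_of_le hpos (hmax hpK)
  refine ⟨q, hsub hq, fun r hr => ?_, hqpos⟩
  by_cases hur : 0 < u r
  · have := hout r.1 r.2 hr.1 hr.2 hur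
    have hmem : r ∈ Icc 0 (b / ε) ×ˢ Icc 0 (b / ε) := ⟨⟨hr.1, this.1⟩, hr.2, this.2⟩
    exact hmax hmem
  · exact (not_lt.1 hur).trans hqpos.le

namespace IsApproximant

variable {m C : ℝ} {F₀ : ℝ → ℝ} {ε : ℝ} {k : ℕ} {s : ℕ → ℝ} {c : ℕ → ℝ → ℝ}

theorem contDiff_bernsteinSum (A : IsApproximant m C F₀ ε k s c) :
    ContDiff ℝ 1 fun p : ℝ × ℝ => bernsteinSum k s (fun n => c n p.2) p.1 := by
  refine ContDiff.sum fun n _ => ?_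
  have := A.contDiff n
  exact (this.comp contDiff_snd).mul (by fun_prop)

theorem differentiableAt_bernsteinSum_time (A : IsApproximant m C F₀ ε k s c) (x t : ℝ) :
    DifferentiableAt ℝ (fun t => bernsteinSum k s (fun n => c n t) x) t :=
  (A.contDiff_bernsteinSum.comp (g := fun p : ℝ × ℝ => bernsteinSum k s (fun n => c n p.2) p.1)
    (contDiff_const.prodMk contDiff_id)).differentiable one_ne_zero t

theorem moment_mem (A : IsApproximant m C F₀ ε k s c) {x t : ℝ} (hx : 0 ≤ x) (ht : 0 ≤ t) :
    0 ≤ expMoment k s (fun n => c n t) 1 x ∧ expMoment k s (fun n => c n t) 1 x ≤ m :=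
  ⟨expMoment_nonneg A.size_nonneg (fun n => A.nonneg n t ht) _ _,
    (expMoment_le_zero A.size_nonneg (fun n => A.nonneg n t ht) _ hx).trans (A.mass_le t ht)⟩

/-- Comparison of an approximant with the viscosity solution. -/
theorem abs_sub_le (A : IsApproximant m C F₀ ε k s c) {F : ℝ → ℝ → ℝ} (hF : GoodSolution m F₀ F)
    (hm₁ : m < 1 / 2) (hC : 0 ≤ C) (hε : 0 < ε) (hε1 : ε ≤ 1) (hF₀C : ∀ x, 0 ≤ x → F₀ x ≤ C)
    {x t : ℝ} (hx : 0 ≤ x) (ht : 0 ≤ t) :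
    |F x t - bernsteinSum k s (fun n => c n t) x| ≤ ε * x + 4 * ε * (t + t ^ 2) := by
  obtain ⟨⟨K, hK⟩, -, hFm, hF0, hsub, hsup⟩ := hF
  have hFc := hK.continuousOn
  have hGcd := A.contDiff_bernsteinSum
  have hGc := hGcd.continuous.continuousOn (s := Ici (0 : ℝ) ×ˢ Ici (0 : ℝ))
  have hpen : ContDiff ℝ 1 fun p : ℝ × ℝ => ε * p.1 + 4 * ε * (p.2 + p.2 ^ 2) := by fun_prop
  have hpenc := hpen.continuous.continuousOn (s := Ici (0 : ℝ) ×ˢ Ici (0 : ℝ))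
  have hFle : ∀ x t, 0 ≤ x → 0 ≤ t → F x t ≤ C + K * t := by
    intro x t hx ht
    have h1 := hK.dist_le_mul (x, t) ⟨hx, ht⟩ (x, 0) ⟨hx, mem_Ici.2 le_rfl⟩
    rw [Prod.dist_eq, dist_self, Real.dist_eq, Real.dist_eq, sub_zero, abs_of_nonneg ht,
      max_eq_right ht] at h1
    have h2 := le_abs_self (F x t - F x 0)
    have h3 := hF₀C x hx
    rw [← hF0 x hx] at h3
    linarith
  have hGnn : ∀ x t, 0 ≤ x → 0 ≤ t → 0 ≤ bernsteinSum k s (fun n => c n t) x := fun x t hx ht =>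
    bernsteinSum_nonneg A.size_nonneg (fun n => A.nonneg n t ht) hx
  have hGle : ∀ x t, 0 ≤ x → 0 ≤ t → bernsteinSum k s (fun n => c n t) x ≤ C + 1 * t :=
    fun x t hx ht => by
      rw [one_mul]
      exact (bernsteinSum_le_sum (fun n => A.nonneg n t ht) x).trans (A.number_le t ht)
  have hedge : ∀ q : ℝ × ℝ, q ∈ Ici (0 : ℝ) ×ˢ Ici (0 : ℝ) →
      ε * q.1 + 4 * ε * (q.2 + q.2 ^ 2) < |F q.1 q.2 - bernsteinSum k s (fun n => c n q.2) q.1| →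
      0 < q.1 ∧ 0 < q.2 := by
    rintro ⟨y, r⟩ ⟨hy, hr⟩ hlt
    simp only [mem_Ici] at hy hr hlt ⊢
    refine ⟨lt_of_le_of_ne hy ?_, lt_of_le_of_ne hr ?_⟩
    · rintro rfl
      have h1 := hFm 0 r le_rfl hr
      have h2 : F 0 r = 0 := by linarith [h1.1, h1.2]
      have h3 : bernsteinSum k s (fun n => c n r) 0 = 0 := by simp [bernsteinSum]
      rw [h2, h3] at hlt
      simp only [sub_self, abs_zero] at hlt
      have : 0 ≤ 4 * ε * (r + r ^ 2) := by positivity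
      linarith
    · rintro rfl
      have := A.initial y hy
      rw [hF0 y hy] at hlt
      linarith
  have hdt : ∀ r, HasDerivAt (fun t => 4 * ε * (t + t ^ 2)) (4 * ε * (1 + 2 * r)) r := fun r => by
    have := ((hasDerivAt_id r).fun_add ((hasDerivAt_id r).fun_pow 2)).const_mul (4 * ε)
    simpa using this
  have hdx : ∀ y, HasDerivAt (fun x => ε * x) ε y := fun y => by
    simpa using (hasDerivAt_id y).const_mul ε
  rw [abs_le]
  constructor
  · by_contra! hcon
    obtain ⟨⟨y, r⟩, hq, hmax, hqpos⟩ := exists_isMaxOn_quadrant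
      (u := fun p : ℝ × ℝ => bernsteinSum k s (fun n => c n p.2) p.1 - F p.1 p.2 -
        (ε * p.1 + 4 * ε * (p.2 + p.2 ^ 2))) ((hGc.sub hFc).sub hpenc) hε hC (L := 1)
      (fun x t hx ht => by
        have := hGle x t hx ht
        have := (hFm x t hx ht).1
        simp only
        linarith) (p := (x, t)) ⟨hx, ht⟩ (by simp only; linarith)
    simp only at hqpos
    have hpos := hedge (y, r) hq (by
      rw [abs_sub_comm]
      exact lt_of_lt_of_le (by simp only; linarith) (le_abs_self _))
    simp only at hpos
    obtain ⟨hy, hr⟩ := hpos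
    have hv := hsup (fun p => bernsteinSum k s (fun n => c n p.2) p.1 -
      (ε * p.1 + 4 * ε * (p.2 + p.2 ^ 2))) (hGcd.sub hpen) y r hy hr (by
        refine IsMinOn.localize fun p hp => ?_
        have := hmax hp
        simp only [mem_ofPred_eq] at this ⊢
        linarith)
    have hd1 := ((A.differentiableAt_bernsteinSum_time y r).hasDerivAt.fun_sub
      ((hdt r).const_add (ε * y))).deriv
    have hd2 := ((hasDerivAt_bernsteinSum k s (fun n => c n r) y).fun_sub
      ((hdx y).add_const (4 * ε * (r + r ^ 2)))).deriv
    simp only [hd1, hd2] at hv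
    have hres := (abs_le.1 (A.residual y r hy hr)).2
    have hP := A.moment_mem hy.le hr.le
    set P := expMoment k s (fun n => c n r) 1 y
    have hdiv : F y r / y < bernsteinSum k s (fun n => c n r) y / y := by
      have : 0 ≤ ε * y + 4 * ε * (r + r ^ 2) := by positivity
      exact div_lt_div_of_pos_right (by linarith) hy
    have hεr : 0 < ε * r := by positivity
    have hH : ε * (m - P + 1 / 2 + ε / 2) ≤ ε * 2 := by gcongr; linarith
    linarith
  · by_contra! hcon
    obtain ⟨⟨y, r⟩, hq, hmax, hqpos⟩ := exists_isMaxOn_quadrant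
      (u := fun p : ℝ × ℝ => F p.1 p.2 - bernsteinSum k s (fun n => c n p.2) p.1 -
        (ε * p.1 + 4 * ε * (p.2 + p.2 ^ 2))) ((hFc.sub hGc).sub hpenc) hε hC (L := K)
      (fun x t hx ht => by
        have := hFle x t hx ht
        have := hGnn x t hx ht
        simp only
        linarith) (p := (x, t)) ⟨hx, ht⟩ (by simp only; linarith)
    simp only at hqpos
    have hpos := hedge (y, r) hq (lt_of_lt_of_le (by simp only; linarith) (le_abs_self _))
    simp only at hpos
    obtain ⟨hy, hr⟩ := hpos
    have hv := hsub (fun p => bernsteinSum k s (fun n => c n p.2) p.1 +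
      (ε * p.1 + 4 * ε * (p.2 + p.2 ^ 2))) (hGcd.add hpen) y r hy hr (by
        refine IsMaxOn.localize fun p hp => ?_
        have := hmax hp
        simp only [mem_ofPred_eq] at this ⊢
        linarith)
    have hd1 := ((A.differentiableAt_bernsteinSum_time y r).hasDerivAt.fun_add
      ((hdt r).const_add (ε * y))).deriv
    have hd2 := ((hasDerivAt_bernsteinSum k s (fun n => c n r) y).fun_add
      ((hdx y).add_const (4 * ε * (r + r ^ 2)))).deriv
    simp only [hd1, hd2] at hv
    have hres := (abs_le.1 (A.residual y r hy hr)).1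
    have hP := A.moment_mem hy.le hr.le
    set P := expMoment k s (fun n => c n r) 1 y
    have hdiv : bernsteinSum k s (fun n => c n r) y / y < F y r / y := by
      have : 0 ≤ ε * y + 4 * ε * (r + r ^ 2) := by positivity
      exact div_lt_div_of_pos_right (by linarith) hy
    have hεr : 0 < ε * r := by positivity
    have hH : ε * (-1) ≤ ε * (P - m - 1 / 2 + ε / 2) := by gcongr; linarith
    linarith

end IsApproximant

/-- Uniform convergence on the rectangles `[a, X] × (0, T]`, `a > 0`. -/
def TendstoUniformlyOnRect (f : ℕ → ℝ → ℝ → ℝ) (l : ℝ → ℝ → ℝ) : Prop :=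
  ∀ a X T η : ℝ, 0 < a → 0 < η →
    ∀ᶠ j in atTop, ∀ x ∈ Icc a X, ∀ t ∈ Ioc 0 T, |f j x t - l x t| ≤ η

/-- A Landau-type inequality: a derivative is controlled by the function and the second
derivative. -/
theorem abs_deriv_le_of_abs_le {u u' u'' : ℝ → ℝ} {x h δ B : ℝ} (hh : 0 < h)
    (hu : ∀ y ∈ Icc x (x + h), HasDerivAt u (u' y) y)
    (hu' : ∀ y ∈ Icc x (x + h), HasDerivAt u' (u'' y) y)
    (hB : ∀ y ∈ Icc x (x + h), |u'' y| ≤ B) (h0 : |u x| ≤ δ) (h1 : |u (x + h)| ≤ δ) :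
    |u' x| ≤ 2 * δ / h + B * h := by
  obtain ⟨ξ, hξ, hξe⟩ := exists_hasDerivAt_eq_slope u u' (lt_add_of_pos_right x hh)
    (fun y hy => (hu y hy).continuousAt.continuousWithinAt)
    fun y hy => hu y (Ioo_subset_Icc_self hy)
  have h2 := (convex_Icc x (x + h)).norm_image_sub_le_of_norm_hasDerivWithin_le
    (fun y hy => (hu' y hy).hasDerivWithinAt) hB (Ioo_subset_Icc_self hξ)
    (left_mem_Icc.2 (le_add_of_nonneg_right hh.le))
  have hB0 : 0 ≤ B := (abs_nonneg _).trans (hB x (left_mem_Icc.2 (le_add_of_nonneg_right hh.le)))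
  have h3 : |u' ξ| ≤ 2 * δ / h := by
    rw [hξe, add_sub_cancel_left, abs_div, abs_of_pos hh]
    gcongr
    have := abs_sub (u (x + h)) (u x)
    linarith
  rw [Real.norm_eq_abs, Real.norm_eq_abs] at h2
  have h4 : |x - ξ| ≤ h := by
    rw [abs_le]; constructor <;> linarith [hξ.1, hξ.2]
  have h5 : B * |x - ξ| ≤ B * h := mul_le_mul_of_nonneg_left h4 hB0
  have h6 := abs_sub_abs_le_abs_sub (u' x) (u' ξ)
  linarith

theorem TendstoUniformlyOnRect.exists_deriv {f f' f'' : ℕ → ℝ → ℝ → ℝ} {l : ℝ → ℝ → ℝ}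
    (hl : TendstoUniformlyOnRect f l)
    (hf : ∀ j x t, 0 < x → 0 < t → HasDerivAt (fun x => f j x t) (f' j x t) x)
    (hf' : ∀ j x t, 0 < x → 0 < t → HasDerivAt (fun x => f' j x t) (f'' j x t) x)
    (hB : ∀ a, 0 < a → ∃ B, ∀ j x t, a ≤ x → 0 < t → |f'' j x t| ≤ B) :
    ∃ l', TendstoUniformlyOnRect f' l' := by
  have hcauchy : ∀ a X T η : ℝ, 0 < a → 0 < η →
      ∃ J, ∀ i ≥ J, ∀ j ≥ J, ∀ x ∈ Icc a X, ∀ t ∈ Ioc 0 T, |f' i x t - f' j x t| ≤ η := by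
    intro a X T η ha hη
    obtain ⟨B, hB⟩ := hB a ha
    set b := max B 1 with hb
    have hb0 : 0 < b := lt_of_lt_of_le one_pos (le_max_right _ _)
    set h := η / (4 * b) with hh
    have hh0 : 0 < h := by positivity
    obtain ⟨J, hJ⟩ := eventually_atTop.1 (hl a (X + h) T (η * h / 8) ha (by positivity))
    refine ⟨J, fun i hi j hj x hx t ht => ?_⟩
    have hd : ∀ y, a ≤ y → y ≤ X + h → |f i y t - f j y t| ≤ η * h / 4 := by
      intro y hy1 hy2
      have h1 := hJ i hi y ⟨hy1, hy2⟩ t ht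
      have h2 := hJ j hj y ⟨hy1, hy2⟩ t ht
      rw [abs_le] at h1 h2 ⊢
      constructor <;> linarith [h1.1, h1.2, h2.1, h2.2]
    have := abs_deriv_le_of_abs_le (u := fun y => f i y t - f j y t)
      (u' := fun y => f' i y t - f' j y t) (u'' := fun y => f'' i y t - f'' j y t)
      (x := x) (h := h) (δ := η * h / 4) (B := 2 * b) hh0
      (fun y hy => (hf i y t (by linarith [hx.1, hy.1]) ht.1).fun_sub
        (hf j y t (by linarith [hx.1, hy.1]) ht.1))
      (fun y hy => (hf' i y t (by linarith [hx.1, hy.1]) ht.1).fun_sub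
        (hf' j y t (by linarith [hx.1, hy.1]) ht.1))
      (fun y hy => by
        have h1 := hB i y t (by linarith [hx.1, hy.1]) ht.1
        have h2 := hB j y t (by linarith [hx.1, hy.1]) ht.1
        have h3 := abs_sub (f'' i y t) (f'' j y t)
        have h4 := le_max_left B 1
        linarith)
      (hd x hx.1 (by linarith [hx.2])) (hd (x + h) (by linarith [hx.1]) (by linarith [hx.2]))
    refine this.trans (le_of_eq ?_)
    rw [hh]
    field_simp
    ring
  have hlim : ∀ x t : ℝ, ∃ y, 0 < x → 0 < t → Tendsto (fun j => f' j x t) atTop (nhds y) := by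
    intro x t
    by_cases hxt : 0 < x ∧ 0 < t
    · have : CauchySeq fun j => f' j x t := by
        refine Metric.cauchySeq_iff.2 fun η hη => ?_
        obtain ⟨J, hJ⟩ := hcauchy x x t (η / 2) hxt.1 (by positivity)
        refine ⟨J, fun i hi j hj => ?_⟩
        rw [Real.dist_eq]
        exact (hJ i hi j hj x ⟨le_rfl, le_rfl⟩ t ⟨hxt.2, le_rfl⟩).trans_lt (by linarith)
      obtain ⟨y, hy⟩ := cauchySeq_tendsto_of_complete this
      exact ⟨y, fun _ _ => hy⟩
    · exact ⟨0, fun h1 h2 => absurd ⟨h1, h2⟩ hxt⟩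
  choose l' hl' using hlim
  refine ⟨l', fun a X T η ha hη => ?_⟩
  obtain ⟨J, hJ⟩ := hcauchy a X T η ha hη
  filter_upwards [eventually_ge_atTop J] with i hi x hx t ht
  have h1 := ((hl' x t (ha.trans_le hx.1) ht.1).const_sub (f' i x t)).abs
  refine le_of_tendsto h1 ?_
  filter_upwards [eventually_ge_atTop J] with j hj
  exact hJ i hi j hj x hx t ht

namespace TendstoUniformlyOnRect

variable {f : ℕ → ℝ → ℝ → ℝ} {l : ℝ → ℝ → ℝ}

theorem tendsto (hl : TendstoUniformlyOnRect f l) {x t : ℝ} (hx : 0 < x) (ht : 0 < t) :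
    Tendsto (fun j => f j x t) atTop (nhds (l x t)) := by
  refine Metric.tendsto_atTop'.2 fun η hη => ?_
  obtain ⟨J, hJ⟩ := eventually_atTop.1 (hl x x t (η / 2) hx (by positivity))
  refine ⟨J, fun j hj => ?_⟩
  rw [Real.dist_eq]
  exact (hJ j hj.le x ⟨le_rfl, le_rfl⟩ t ⟨ht, le_rfl⟩).trans_lt (by linarith)

theorem tendstoLocallyUniformlyOn (hl : TendstoUniformlyOnRect f l) :
    TendstoLocallyUniformlyOn (fun j (p : ℝ × ℝ) => f j p.1 p.2) (fun p => l p.1 p.2) atTop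
      (Ioi 0 ×ˢ Ioi 0) := by
  refine Metric.tendstoLocallyUniformlyOn_iff.2 fun η hη p hp => ?_
  obtain ⟨hx, ht⟩ := hp
  simp only [mem_Ioi] at hx ht
  refine ⟨Icc (p.1 / 2) (p.1 + 1) ×ˢ Ioc 0 (p.2 + 1), mem_nhdsWithin_of_mem_nhds
    (prod_mem_nhds (Icc_mem_nhds (by linarith) (by linarith))
      (Ioc_mem_nhds ht (by linarith))), ?_⟩
  filter_upwards [hl (p.1 / 2) (p.1 + 1) (p.2 + 1) (η / 2) (by positivity) (by positivity)]
    with j hj q hq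
  rw [dist_comm, Real.dist_eq]
  exact (hj q.1 hq.1 q.2 hq.2).trans_lt (by linarith)

theorem continuousOn (hl : TendstoUniformlyOnRect f l)
    (hf : ∀ j, ContinuousOn (fun p : ℝ × ℝ => f j p.1 p.2) (Ioi 0 ×ˢ Ioi 0)) :
    ContinuousOn (fun p : ℝ × ℝ => l p.1 p.2) (Ioi 0 ×ˢ Ioi 0) :=
  hl.tendstoLocallyUniformlyOn.continuousOn (Eventually.of_forall hf).frequently

theorem hasDerivAt_fst {f' : ℕ → ℝ → ℝ → ℝ} {l' : ℝ → ℝ → ℝ} (hl : TendstoUniformlyOnRect f l)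
    (hl' : TendstoUniformlyOnRect f' l')
    (hf : ∀ j x t, 0 < x → 0 < t → HasDerivAt (fun x => f j x t) (f' j x t) x) {x t : ℝ}
    (hx : 0 < x) (ht : 0 < t) : HasDerivAt (fun x => l x t) (l' x t) x := by
  refine hasDerivAt_of_tendstoLocallyUniformlyOn (s := Ioi (0 : ℝ)) (l := atTop) isOpen_Ioi
    (f' := fun j x => f' j x t) (f := fun j x => f j x t) (g' := fun x => l' x t) ?_
    (Eventually.of_forall fun j x hx => hf j x t hx ht) (fun x hx => hl.tendsto hx ht) hx
  exact hl'.tendstoLocallyUniformlyOn.comp (fun x : ℝ => (x, t)) (fun x hx => ⟨hx, ht⟩)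
    (by fun_prop)

theorem hasDerivAt_snd {f' : ℕ → ℝ → ℝ → ℝ} {l' : ℝ → ℝ → ℝ} (hl : TendstoUniformlyOnRect f l)
    (hl' : TendstoUniformlyOnRect f' l')
    (hf : ∀ j x t, 0 < x → 0 < t → HasDerivAt (fun t => f j x t) (f' j x t) t) {x t : ℝ}
    (hx : 0 < x) (ht : 0 < t) : HasDerivAt (fun t => l x t) (l' x t) t := by
  refine hasDerivAt_of_tendstoLocallyUniformlyOn (s := Ioi (0 : ℝ)) (l := atTop) isOpen_Ioi
    (f' := fun j t => f' j x t) (f := fun j t => f j x t) (g' := fun t => l' x t) ?_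
    (Eventually.of_forall fun j t ht => hf j x t hx ht) (fun t ht => hl.tendsto hx ht) ht
  exact hl'.tendstoLocallyUniformlyOn.comp (fun t : ℝ => (x, t)) (fun t ht => ⟨hx, ht⟩)
    (by fun_prop)

end TendstoUniformlyOnRect

/-- Exchange of partial derivatives on the open quadrant, assuming only that `∂ₓ∂ₜf` exists and is
continuous. -/
theorem hasDerivAt_partial_comm {f fx ft ftx : ℝ → ℝ → ℝ}
    (hfx : ∀ x t, 0 < x → 0 < t → HasDerivAt (fun x => f x t) (fx x t) x)
    (hft : ∀ x t, 0 < x → 0 < t → HasDerivAt (fun t => f x t) (ft x t) t)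
    (hftx : ∀ x t, 0 < x → 0 < t → HasDerivAt (fun x => ft x t) (ftx x t) x)
    (hcont : ContinuousOn (fun p : ℝ × ℝ => ftx p.1 p.2) (Ioi 0 ×ˢ Ioi 0))
    {x t : ℝ} (hx : 0 < x) (ht : 0 < t) : HasDerivAt (fun t => fx x t) (ftx x t) t := by
  rw [hasDerivAt_iff_isLittleO, Asymptotics.isLittleO_iff]
  intro η hη
  have hca : ContinuousAt (fun p : ℝ × ℝ => ftx p.1 p.2) (x, t) :=
    hcont.continuousAt ((isOpen_Ioi.prod isOpen_Ioi).mem_nhds ⟨hx, ht⟩)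
  obtain ⟨δ, hδ, hball⟩ := Metric.continuousAt_iff.1 hca η hη
  set r := min (δ / 2) (t / 2) with hr
  have hr0 : 0 < r := by positivity
  have hr1 : r ≤ δ / 2 := min_le_left _ _
  have hr2 : r ≤ t / 2 := min_le_right _ _
  have hnear : ∀ y ∈ Icc x (x + r), ∀ τ ∈ Icc (t - r) (t + r), |ftx y τ - ftx x t| ≤ η := by
    intro y hy τ hτ
    have : dist (y, τ) (x, t) < δ := by
      rw [Prod.dist_eq, max_lt_iff, Real.dist_eq, Real.dist_eq, abs_lt, abs_lt]
      refine ⟨⟨?_, ?_⟩, ?_, ?_⟩ <;> linarith [hy.1, hy.2, hτ.1, hτ.2]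
    exact (hball this).le
  filter_upwards [Icc_mem_nhds (show t - r < t by linarith) (show t < t + r by linarith)] with τ hτ
  have htr : t ∈ Icc (t - r) (t + r) := ⟨by linarith, by linarith⟩
  have hincr : ∀ h ∈ Ioc 0 r, |(f (x + h) τ - f x τ) - (f (x + h) t - f x t) -
      h * ftx x t * (τ - t)| ≤ η * h * |τ - t| := by
    intro h hh
    have hstep : ∀ σ ∈ Icc (t - r) (t + r), |ft (x + h) σ - ft x σ - h * ftx x t| ≤ η * h := by
      intro σ hσ
      have hσ0 : 0 < σ := by linarith [hσ.1]
      have := (convex_Icc x (x + h)).norm_image_sub_le_of_norm_hasDerivWithin_le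
        (f := fun y => ft y σ - ftx x t * y) (f' := fun y => ftx y σ - ftx x t) (C := η)
        (fun y hy => by
          have hd := (hftx y σ (hx.trans_le hy.1) hσ0).fun_sub
            ((hasDerivAt_id y).const_mul (ftx x t))
          simpa using hd.hasDerivWithinAt)
        (fun y hy => hnear y ⟨hy.1, by linarith [hy.2, hh.2]⟩ σ hσ)
        (left_mem_Icc.2 (by linarith [hh.1])) (right_mem_Icc.2 (by linarith [hh.1]))
      rw [Real.norm_eq_abs, Real.norm_eq_abs, add_sub_cancel_left, abs_of_pos hh.1] at this
      convert this using 2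
      ring
    have := (convex_Icc (t - r) (t + r)).norm_image_sub_le_of_norm_hasDerivWithin_le
      (f := fun σ => f (x + h) σ - f x σ - h * ftx x t * σ)
      (f' := fun σ => ft (x + h) σ - ft x σ - h * ftx x t) (C := η * h)
      (fun σ hσ => by
        have hσ0 : 0 < σ := by linarith [hσ.1]
        have hd := ((hft (x + h) σ (by linarith [hh.1]) hσ0).fun_sub (hft x σ hx hσ0)).fun_sub
          ((hasDerivAt_id σ).const_mul (h * ftx x t))
        simpa using hd.hasDerivWithinAt)
      hstep htr hτ
    rw [Real.norm_eq_abs, Real.norm_eq_abs] at this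
    convert this using 2
    ring
  have hslope : ∀ σ, 0 < σ → Tendsto (fun h => (f (x + h) σ - f x σ) / h)
      (nhdsWithin 0 (Ioi 0)) (nhds (fx x σ)) := by
    intro σ hσ
    have := (hfx x σ hx hσ).tendsto_slope_zero_right
    refine this.congr fun h => ?_
    simp [div_eq_inv_mul]
  have hτ0 : 0 < τ := by linarith [hτ.1]
  have hlim : Tendsto (fun h => |(f (x + h) τ - f x τ) / h - (f (x + h) t - f x t) / h -
      ftx x t * (τ - t)|) (nhdsWithin 0 (Ioi 0))
      (nhds |fx x τ - fx x t - ftx x t * (τ - t)|) :=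
    (((hslope τ hτ0).sub (hslope t ht)).sub_const _).abs
  have := le_of_tendsto (b := η * |τ - t|) hlim ?_
  · simpa [Real.norm_eq_abs, mul_comm] using this
  · filter_upwards [Ioc_mem_nhdsGT hr0] with h hh
    have h1 := hincr h hh
    have e : (f (x + h) τ - f x τ) / h - (f (x + h) t - f x t) / h - ftx x t * (τ - t) =
        ((f (x + h) τ - f x τ) - (f (x + h) t - f x t) - h * ftx x t * (τ - t)) / h := by
      have := hh.1.ne'
      field_simp
    rw [e, abs_div, abs_of_pos hh.1, div_le_iff₀ hh.1]
    linarith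

/-- The algebra of functions generated by constants, `x⁻¹` and a sequence of functions. -/
inductive DiffAlg (D : ℕ → ℝ → ℝ → ℝ) : (ℝ → ℝ → ℝ) → Prop
  | coeff (n : ℕ) : DiffAlg D (D n)
  | const (a : ℝ) : DiffAlg D fun _ _ => a
  | inv : DiffAlg D fun x _ => x⁻¹
  | add {f g : ℝ → ℝ → ℝ} : DiffAlg D f → DiffAlg D g → DiffAlg D fun x t => f x t + g x t
  | mul {f g : ℝ → ℝ → ℝ} : DiffAlg D f → DiffAlg D g → DiffAlg D fun x t => f x t * g x t

namespace DiffAlg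

variable {D : ℕ → ℝ → ℝ → ℝ} {f : ℝ → ℝ → ℝ}

theorem exists_hasDerivAt
    (hD : ∀ n x t, 0 < x → 0 < t → HasDerivAt (fun x => D n x t) (D (n + 1) x t) x)
    (hf : DiffAlg D f) :
    ∃ f', DiffAlg D f' ∧ ∀ x t, 0 < x → 0 < t → HasDerivAt (fun x => f x t) (f' x t) x := by
  induction hf with
  | coeff n => exact ⟨D (n + 1), coeff _, hD n⟩
  | const a => exact ⟨_, const 0, fun x t _ _ => hasDerivAt_const x a⟩
  | inv =>
    refine ⟨_, mul (const (-1)) (mul inv inv), fun x t hx _ => ?_⟩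
    have h := hasDerivAt_inv hx.ne'
    rwa [show -(x ^ 2)⁻¹ = -1 * (x⁻¹ * x⁻¹) by rw [sq, mul_inv, neg_one_mul]] at h
  | add _ _ hf hg =>
    obtain ⟨f', hf', hf⟩ := hf
    obtain ⟨g', hg', hg⟩ := hg
    exact ⟨_, add hf' hg', fun x t hx ht => (hf x t hx ht).fun_add (hg x t hx ht)⟩
  | mul hf₀ hg₀ hf hg =>
    obtain ⟨f', hf', hf⟩ := hf
    obtain ⟨g', hg', hg⟩ := hg
    exact ⟨_, add (mul hf' hg₀) (mul hf₀ hg'),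
      fun x t hx ht => (hf x t hx ht).fun_mul (hg x t hx ht)⟩

theorem contDiffOn {k : WithTop ℕ∞}
    (hD : ∀ n, ContDiffOn ℝ k (fun p : ℝ × ℝ => D n p.1 p.2) (Ioi 0 ×ˢ Ioi 0))
    (hf : DiffAlg D f) : ContDiffOn ℝ k (fun p : ℝ × ℝ => f p.1 p.2) (Ioi 0 ×ˢ Ioi 0) := by
  induction hf with
  | coeff n => exact hD n
  | const a => exact contDiffOn_const
  | inv => exact contDiffOn_fst.inv fun p hp => (mem_Ioi.1 hp.1).ne'
  | add _ _ hf hg => exact hf.add hg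
  | mul _ _ hf hg => exact hf.mul hg

theorem continuousOn
    (hD : ∀ n, ContinuousOn (fun p : ℝ × ℝ => D n p.1 p.2) (Ioi 0 ×ˢ Ioi 0))
    (hf : DiffAlg D f) : ContinuousOn (fun p : ℝ × ℝ => f p.1 p.2) (Ioi 0 ×ˢ Ioi 0) :=
  contDiffOn_zero.1 (hf.contDiffOn fun n => contDiffOn_zero.2 (hD n))

/-- If the time derivative of `D 0` is a differential polynomial in the `x`-derivatives, then so are
the time derivatives of all the `D n`. -/
theorem exists_hasDerivAt_time
    (hD : ∀ n x t, 0 < x → 0 < t → HasDerivAt (fun x => D n x t) (D (n + 1) x t) x)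
    (hc : ∀ n, ContinuousOn (fun p : ℝ × ℝ => D n p.1 p.2) (Ioi 0 ×ˢ Ioi 0))
    {e : ℝ → ℝ → ℝ} (he : DiffAlg D e)
    (hDe : ∀ x t, 0 < x → 0 < t → HasDerivAt (fun t => D 0 x t) (e x t) t) (n : ℕ) :
    ∃ g, DiffAlg D g ∧ ∀ x t, 0 < x → 0 < t → HasDerivAt (fun t => D n x t) (g x t) t := by
  induction n with
  | zero => exact ⟨e, he, hDe⟩
  | succ n ih =>
    obtain ⟨g, hg, hgd⟩ := ih
    obtain ⟨g', hg', hgd'⟩ := hg.exists_hasDerivAt hD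
    exact ⟨g', hg', fun x t hx ht =>
      hasDerivAt_partial_comm (hD n) hgd hgd' (hg'.continuousOn hc) hx ht⟩

end DiffAlg

theorem contDiffOn_quadrant_succ {f fx ft : ℝ → ℝ → ℝ} {k : ℕ}
    (hfx : ∀ x t, 0 < x → 0 < t → HasDerivAt (fun x => f x t) (fx x t) x)
    (hft : ∀ x t, 0 < x → 0 < t → HasDerivAt (fun t => f x t) (ft x t) t)
    (hx : ContDiffOn ℝ k (fun p : ℝ × ℝ => fx p.1 p.2) (Ioi 0 ×ˢ Ioi 0))
    (ht : ContDiffOn ℝ k (fun p : ℝ × ℝ => ft p.1 p.2) (Ioi 0 ×ˢ Ioi 0)) :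
    ContDiffOn ℝ (k + 1 : ℕ) (fun p : ℝ × ℝ => f p.1 p.2) (Ioi 0 ×ˢ Ioi 0) := by
  have hopen : IsOpen (Ioi (0 : ℝ) ×ˢ Ioi (0 : ℝ)) := isOpen_Ioi.prod isOpen_Ioi
  have hspan : ContDiff ℝ k fun a : ℝ => ContinuousLinearMap.toSpanSingleton ℝ a :=
    (ContinuousLinearMap.toSpanSingletonCLE (𝕜 := ℝ) (E := ℝ)).contDiff
  push_cast
  rw [contDiffOn_succ_iff_hasFDerivWithinAt_of_uniqueDiffOn hopen.uniqueDiffOn]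
  refine ⟨fun h => absurd h (by simp), fun p =>
    (ContinuousLinearMap.toSpanSingleton ℝ (fx p.1 p.2)).coprod
      (ContinuousLinearMap.toSpanSingleton ℝ (ft p.1 p.2)), ?_, fun p hp => ?_⟩
  · exact (ContinuousLinearMap.coprodEquivL
      (𝕜 := ℝ) (E := ℝ) (F := ℝ) (G := ℝ) ℝ).contDiff.comp_contDiffOn
      ((hspan.comp_contDiffOn hx).prodMk (hspan.comp_contDiffOn ht))
  · have hev : ∀ᶠ q in nhds p, q ∈ Ioi (0 : ℝ) ×ˢ Ioi (0 : ℝ) := hopen.mem_nhds hp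
    refine (hasStrictFDerivAt_uncurry_coprod (u := p) (f := f)
      (f₁ := fun x t => ContinuousLinearMap.toSpanSingleton ℝ (fx x t))
      (f₂ := fun x t => ContinuousLinearMap.toSpanSingleton ℝ (ft x t))
      ?_ ?_ ?_ ?_).hasFDerivAt.hasFDerivWithinAt
    · filter_upwards [hev] with q hq using (hfx q.1 q.2 hq.1 hq.2).hasFDerivAt
    · filter_upwards [hev] with q hq using (hft q.1 q.2 hq.1 hq.2).hasFDerivAt
    · exact hspan.continuous.continuousAt.comp (hx.continuousOn.continuousAt hev)
    · exact hspan.continuous.continuousAt.comp (ht.continuousOn.continuousAt hev)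

/-- A function whose `x`-derivatives are all continuous and whose time derivative is a differential
polynomial in them is smooth. -/
theorem DiffAlg.contDiffOn_coeff {D : ℕ → ℝ → ℝ → ℝ}
    (hD : ∀ n x t, 0 < x → 0 < t → HasDerivAt (fun x => D n x t) (D (n + 1) x t) x)
    (hc : ∀ n, ContinuousOn (fun p : ℝ × ℝ => D n p.1 p.2) (Ioi 0 ×ˢ Ioi 0))
    {e : ℝ → ℝ → ℝ} (he : DiffAlg D e)
    (hDe : ∀ x t, 0 < x → 0 < t → HasDerivAt (fun t => D 0 x t) (e x t) t) (n : ℕ) :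
    ContDiffOn ℝ (⊤ : ℕ∞) (fun p : ℝ × ℝ => D n p.1 p.2) (Ioi 0 ×ˢ Ioi 0) := by
  refine contDiffOn_infty.2 fun k => ?_
  induction k generalizing n with
  | zero => exact contDiffOn_zero.2 (hc n)
  | succ k ih =>
    obtain ⟨g, hg, hgd⟩ := exists_hasDerivAt_time hD hc he hDe n
    exact contDiffOn_quadrant_succ (hD n) hgd (ih (n + 1)) (hg.contDiffOn ih)

theorem iteratedDeriv_eq_of_hasDerivAt {D : ℕ → ℝ → ℝ → ℝ}
    (hD : ∀ n x t, 0 < x → 0 < t → HasDerivAt (fun x => D n x t) (D (n + 1) x t) x)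
    (n : ℕ) {x t : ℝ} (hx : 0 < x) (ht : 0 < t) :
    iteratedDeriv n (fun y => D 0 y t) x = D n x t := by
  induction n generalizing x with
  | zero => simp
  | succ n ih =>
    rw [iteratedDeriv_succ]
    refine HasDerivAt.deriv ((hD n x t hx ht).congr_of_eventuallyEq ?_)
    filter_upwards [Ioi_mem_nhds hx] with y hy using ih hy

/-- The `n`-th derivative of `bernsteinSum k s c`. -/
noncomputable def bernsteinDeriv (k : ℕ) (s c : ℕ → ℝ) : ℕ → ℝ → ℝ
  | 0, x => bernsteinSum k s c x
  | n + 1, x => (-1) ^ n * expMoment k s c (n + 1) x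

theorem hasDerivAt_bernsteinDeriv (k : ℕ) (s c : ℕ → ℝ) (n : ℕ) (x : ℝ) :
    HasDerivAt (bernsteinDeriv k s c n) (bernsteinDeriv k s c (n + 1) x) x := by
  cases n with
  | zero =>
    change HasDerivAt (bernsteinSum k s c) _ x
    simpa [bernsteinDeriv] using hasDerivAt_bernsteinSum k s c x
  | succ n =>
    change HasDerivAt (fun x => (-1) ^ n * expMoment k s c (n + 1) x) _ x
    simpa [bernsteinDeriv, pow_succ] using
      (hasDerivAt_expMoment k s c (n + 1) x).const_mul ((-1) ^ n)

theorem alternating_bernsteinDeriv_nonneg {k : ℕ} {s c : ℕ → ℝ} (hs : ∀ n, 0 ≤ s n)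
    (hc : ∀ n, 0 ≤ c n) (n : ℕ) (x : ℝ) :
    0 ≤ (-1) ^ n * bernsteinDeriv k s c (n + 1) x := by
  rw [bernsteinDeriv, ← mul_assoc, ← mul_pow]
  simpa using expMoment_nonneg hs hc (n + 1) x

theorem abs_bernsteinDeriv_le {k : ℕ} {s c : ℕ → ℝ} (hs : ∀ n, 0 ≤ s n)
    (hc : ∀ n, 0 ≤ c n) (n : ℕ) {a x : ℝ} (ha : 0 < a) (hx : a ≤ x) :
    |bernsteinDeriv k s c (n + 1) x| ≤ n.factorial / a ^ n * expMoment k s c 1 0 := by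
  rw [bernsteinDeriv, abs_mul, abs_pow, abs_neg, abs_one, one_pow, one_mul,
    abs_of_nonneg (expMoment_nonneg hs hc _ _), expMoment, expMoment, Finset.mul_sum]
  refine Finset.sum_le_sum fun i _ => ?_
  have h1 : (s i * a) ^ n / n.factorial ≤ Real.exp (s i * x) :=
    (Real.pow_div_factorial_le_exp _ (mul_nonneg (hs i) ha.le) n).trans
      (Real.exp_le_exp.2 (mul_le_mul_of_nonneg_left hx (hs i)))
  have h2 : s i ^ n * Real.exp (-(s i * x)) ≤ n.factorial / a ^ n := by
    rw [Real.exp_neg, ← div_eq_mul_inv, div_le_iff₀ (Real.exp_pos _), div_mul_eq_mul_div,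
      le_div_iff₀ (by positivity), ← mul_pow]
    rwa [div_le_iff₀' (by positivity)] at h1
  calc c i * s i ^ (n + 1) * Real.exp (-(s i * x))
      = c i * s i * (s i ^ n * Real.exp (-(s i * x))) := by ring
    _ ≤ c i * s i * (n.factorial / a ^ n) :=
        mul_le_mul_of_nonneg_left h2 (mul_nonneg (hc i) (hs i))
    _ = n.factorial / a ^ n * (c i * s i ^ 1 * Real.exp (-(s i * 0))) := by simp; ring

theorem continuous_bernsteinDeriv {k : ℕ} {s : ℕ → ℝ} {c : ℕ → ℝ → ℝ} (hc : ∀ n, Continuous (c n))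
    (n : ℕ) : Continuous fun p : ℝ × ℝ => bernsteinDeriv k s (fun i => c i p.2) n p.1 := by
  cases n with
  | zero =>
    simp only [bernsteinDeriv, bernsteinSum]
    fun_prop
  | succ n =>
    simp only [bernsteinDeriv, expMoment]
    fun_prop

/-- The data `F₀` of a measure of total mass at most `C` is bounded by `C`. -/
theorem integral_one_sub_exp_le {μ : Measure ℝ} {C : ℝ} (hC : 0 ≤ C)
    (hμ : μ (Ioi 0) ≤ ENNReal.ofReal C) (x : ℝ) :
    ∫ s in Ioi (0 : ℝ), (1 - Real.exp (-(s * x))) ∂μ ≤ C := by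
  have hfin : IsFiniteMeasure (μ.restrict (Ioi 0)) :=
    ⟨by rw [Measure.restrict_apply_univ]; exact hμ.trans_lt ENNReal.ofReal_lt_top⟩
  have h : ∫ _ in Ioi (0 : ℝ), (1 : ℝ) ∂μ ≤ C := by
    rw [integral_const, smul_eq_mul, mul_one]
    refine ENNReal.toReal_le_of_le_ofReal hC ?_
    rwa [Measure.restrict_apply_univ]
  by_cases hi : Integrable (fun s => 1 - Real.exp (-(s * x))) (μ.restrict (Ioi 0))
  · exact (integral_mono hi (integrable_const 1) fun s => by
      have := Real.exp_pos (-(s * x))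
      simp only; linarith).trans h
  · rw [integral_undef hi]; exact hC

section Limit

variable {m C : ℝ} {F₀ : ℝ → ℝ} {F : ℝ → ℝ → ℝ} {ε : ℕ → ℝ} {k : ℕ → ℕ} {s : ℕ → ℕ → ℝ}
  {c : ℕ → ℕ → ℝ → ℝ}

theorem IsApproximant.tendstoUniformlyOnRect (A : ∀ j, IsApproximant m C F₀ (ε j) (k j) (s j) (c j))
    (hF : GoodSolution m F₀ F) (hm₁ : m < 1 / 2) (hC : 0 ≤ C) (hF₀C : ∀ x, 0 ≤ x → F₀ x ≤ C)
    (hε : ∀ j, 0 < ε j) (hε1 : ∀ j, ε j ≤ 1) (hlim : Tendsto ε atTop (nhds 0)) :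
    TendstoUniformlyOnRect (fun j x t => bernsteinSum (k j) (s j) (fun n => c j n t) x) F := by
  intro a X T η ha hη
  have h : Tendsto (fun j => ε j * X + 4 * ε j * (T + T ^ 2)) atTop (nhds 0) := by
    have := (hlim.mul_const X).add ((hlim.const_mul 4).mul_const (T + T ^ 2))
    simpa using this
  filter_upwards [h.eventually_le_const hη] with j hj x hx t ht
  rw [abs_sub_comm]
  refine ((A j).abs_sub_le hF hm₁ hC (hε j) (hε1 j) hF₀C (ha.le.trans hx.1) ht.1.le).trans
    (le_trans ?_ hj)
  have := (hε j).le
  have := hx.2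
  have := ht.1.le
  have := ht.2
  gcongr

theorem IsApproximant.exists_derivs (A : ∀ j, IsApproximant m C F₀ (ε j) (k j) (s j) (c j))
    (hl : TendstoUniformlyOnRect (fun j x t => bernsteinSum (k j) (s j) (fun n => c j n t) x) F) :
    ∃ D : ℕ → ℝ → ℝ → ℝ, D 0 = F ∧ ∀ n, TendstoUniformlyOnRect
      (fun j x t => bernsteinDeriv (k j) (s j) (fun i => c j i t) n x) (D n) := by
  have step : ∀ (n : ℕ) (l : ℝ → ℝ → ℝ), ∃ l' : ℝ → ℝ → ℝ, TendstoUniformlyOnRect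
      (fun j x t => bernsteinDeriv (k j) (s j) (fun i => c j i t) n x) l → TendstoUniformlyOnRect
      (fun j x t => bernsteinDeriv (k j) (s j) (fun i => c j i t) (n + 1) x) l' := by
    intro n l
    by_cases h : TendstoUniformlyOnRect
      (fun j x t => bernsteinDeriv (k j) (s j) (fun i => c j i t) n x) l
    · obtain ⟨l', hl'⟩ := h.exists_deriv
        (f' := fun j x t => bernsteinDeriv (k j) (s j) (fun i => c j i t) (n + 1) x)
        (f'' := fun j x t => bernsteinDeriv (k j) (s j) (fun i => c j i t) (n + 2) x)
        (fun j x t _ _ => hasDerivAt_bernsteinDeriv _ _ _ _ _)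
        (fun j x t _ _ => hasDerivAt_bernsteinDeriv _ _ _ _ _)
        fun a ha => ⟨(n + 1).factorial / a ^ (n + 1) * m, fun j x t hx ht =>
          (abs_bernsteinDeriv_le (A j).size_nonneg (fun i => (A j).nonneg i t ht.le) (n + 1)
            ha hx).trans (mul_le_mul_of_nonneg_left ((A j).mass_le t ht.le) (by positivity))⟩
      exact ⟨l', fun _ => hl'⟩
    · exact ⟨0, fun h' => absurd h' h⟩
  choose next hnext using step
  refine ⟨fun n => Nat.rec F next n, rfl, fun n => ?_⟩
  induction n with
  | zero => exact hl
  | succ n ih => exact hnext n _ ih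

/-- The equation passes to the limit. -/
theorem IsApproximant.tendstoUniformlyOnRect_time
    (A : ∀ j, IsApproximant m C F₀ (ε j) (k j) (s j) (c j))
    (hm₁ : m < 1 / 2) (hlim : Tendsto ε atTop (nhds 0)) (hε : ∀ j, 0 < ε j) {P : ℝ → ℝ → ℝ}
    (hl : TendstoUniformlyOnRect (fun j x t => bernsteinSum (k j) (s j) (fun n => c j n t) x) F)
    (hl' : TendstoUniformlyOnRect (fun j x t => expMoment (k j) (s j) (fun n => c j n t) 1 x) P) :
    TendstoUniformlyOnRect
      (fun j x t => deriv (fun t => bernsteinSum (k j) (s j) (fun n => c j n t) x) t)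
      fun x t => -(1 / 2) * ((P x t + -m) * (P x t + (-m - 1))) + -1 * (F x t * x⁻¹) + m := by
  intro a X T η ha hη
  have h : Tendsto (fun j => ε j * (1 + T)) atTop (nhds 0) := by
    simpa using hlim.mul_const (1 + T)
  filter_upwards [h.eventually_le_const (show 0 < η / 3 by positivity),
    hl a X T (η / 3 * a) ha (by positivity), hl' a X T (η / 3) ha (by positivity)]
    with j h1 h2 h3 x hx t ht
  have hx0 : 0 < x := ha.trans_le hx.1
  have hr := (A j).residual x t hx0 ht.1
  have hm := (A j).moment_mem hx0.le ht.1.le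
  have hP0 : 0 ≤ P x t := ge_of_tendsto' (hl'.tendsto hx0 ht.1) fun i =>
    ((A i).moment_mem hx0.le ht.1.le).1
  have hPm : P x t ≤ m := le_of_tendsto' (hl'.tendsto hx0 ht.1) fun i =>
    ((A i).moment_mem hx0.le ht.1.le).2
  specialize h2 x hx t ht
  specialize h3 x hx t ht
  set p := expMoment (k j) (s j) (fun n => c j n t) 1 x
  set b := bernsteinSum (k j) (s j) (fun n => c j n t) x
  set d := deriv (fun t => bernsteinSum (k j) (s j) (fun n => c j n t) x) t
  have e : d - (-(1 / 2) * ((P x t + -m) * (P x t + (-m - 1))) + -1 * (F x t * x⁻¹) + m) =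
      (d + 1 / 2 * (p - m) * (p - m - 1) + b / x - m) -
        1 / 2 * ((p - P x t) * (p + P x t - 2 * m - 1)) - (b - F x t) / x := by
    field_simp
    ring
  have b1 : ε j * (1 + t) ≤ η / 3 :=
    (mul_le_mul_of_nonneg_left (by linarith [ht.2]) (hε j).le).trans h1
  have b2 : |1 / 2 * ((p - P x t) * (p + P x t - 2 * m - 1))| ≤ η / 3 := by
    have : |p + P x t - 2 * m - 1| ≤ 2 := by
      rw [abs_le]; constructor <;> linarith [hm.1, hm.2]
    rw [abs_mul, abs_mul, abs_of_pos (by norm_num : (0 : ℝ) < 1 / 2)]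
    have := mul_le_mul h3 this (abs_nonneg _) (by positivity)
    linarith
  have b3 : |(b - F x t) / x| ≤ η / 3 := by
    rw [abs_div, abs_of_pos hx0, div_le_iff₀ hx0]
    exact h2.trans (mul_le_mul_of_nonneg_left hx.1 (by positivity))
  rw [e]
  refine (abs_sub _ _).trans ?_
  have := abs_sub (d + 1 / 2 * (p - m) * (p - m - 1) + b / x - m)
    (1 / 2 * ((p - P x t) * (p + P x t - 2 * m - 1)))
  linarith

end Limit

/-- Proposition 3.9, alternating signs of the `x`-derivatives.
Under the assumptions of Statement 10, the solution `F` is smooth on `(0,∞)×(0,∞)` and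
satisfies `(−1)^{n+1}·∂ₓⁿF ≥ 0` there for every `n ≥ 1`. -/
theorem alternating_derivatives_bernstein (m C : ℝ) (hm₀ : 0 < m) (hm₁ : m < 1 / 2)
    (hC : 0 < C)
    (μ : Measure ℝ)
    (hμ_int₁ : IntegrableOn (fun s => s) (Ioi 0) μ)
    (hμ_m : (∫ s in Ioi (0 : ℝ), s ∂μ) = m)
    (hμ_zeroth : μ (Ioi 0) ≤ ENNReal.ofReal C)
    (hμ_int₂ : IntegrableOn (fun s => s ^ 2) (Ioi 0) μ)
    (hμ_second : (∫ s in Ioi (0 : ℝ), s ^ 2 ∂μ) ≤ C)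
    (F₀ : ℝ → ℝ)
    (hF₀ : ∀ x : ℝ, 0 ≤ x → F₀ x = ∫ s in Ioi (0 : ℝ), (1 - Real.exp (-(s * x))) ∂μ)
    (F : ℝ → ℝ → ℝ) (hF : GoodSolution m F₀ F) :
    ContDiffOn ℝ (⊤ : ℕ∞) (fun p : ℝ × ℝ => F p.1 p.2) (Ioi 0 ×ˢ Ioi 0) ∧
    ∀ n : ℕ, 1 ≤ n → ∀ x t : ℝ, 0 < x → 0 < t →
      0 ≤ (-1 : ℝ) ^ (n + 1) * iteratedDeriv n (fun y => F y t) x := by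
  have hε (j : ℕ) : (0 : ℝ) < 1 / (j + 1) := by positivity
  have hε1 (j : ℕ) : (1 : ℝ) / (j + 1) ≤ 1 := by
    rw [div_le_one (by positivity)]
    linarith [j.cast_nonneg (α := ℝ)]
  have hlim : Tendsto (fun j : ℕ => (1 : ℝ) / (j + 1)) atTop (nhds 0) :=
    tendsto_one_div_add_atTop_nhds_zero_nat
  choose k s c A using fun j : ℕ =>
    exists_isApproximant hm₁ hμ_int₁ hμ_m hC hμ_zeroth hμ_int₂ hμ_second hF₀ (hε j)
  have hF₀C : ∀ x, 0 ≤ x → F₀ x ≤ C := fun x hx => by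
    rw [hF₀ x hx]; exact integral_one_sub_exp_le hC.le hμ_zeroth x
  have hl := IsApproximant.tendstoUniformlyOnRect A hF hm₁ hC.le hF₀C hε hε1 hlim
  obtain ⟨D, rfl, hD⟩ := IsApproximant.exists_derivs A hl
  have hDx : ∀ n x t, 0 < x → 0 < t → HasDerivAt (fun x => D n x t) (D (n + 1) x t) x :=
    fun n x t hx ht => (hD n).hasDerivAt_fst (hD (n + 1))
      (fun j x t _ _ => hasDerivAt_bernsteinDeriv _ _ _ _ _) hx ht
  have hDc : ∀ n, ContinuousOn (fun p : ℝ × ℝ => D n p.1 p.2) (Ioi 0 ×ˢ Ioi 0) := fun n =>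
    (hD n).continuousOn fun j =>
      (continuous_bernsteinDeriv (fun i => ((A j).contDiff i).continuous) n).continuousOn
  have hl' : TendstoUniformlyOnRect
      (fun j x t => expMoment (k j) (s j) (fun n => c j n t) 1 x) (D 1) := by
    simpa [bernsteinDeriv] using hD 1
  have hDt : ∀ x t, 0 < x → 0 < t → HasDerivAt (fun t => D 0 x t)
      (-(1 / 2) * ((D 1 x t + -m) * (D 1 x t + (-m - 1))) + -1 * (D 0 x t * x⁻¹) + m) t :=
    fun x t hx ht => hl.hasDerivAt_snd
      (IsApproximant.tendstoUniformlyOnRect_time A hm₁ hlim hε hl hl')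
      (fun j x t _ _ => ((A j).differentiableAt_bernsteinSum_time x t).hasDerivAt) hx ht
  refine ⟨DiffAlg.contDiffOn_coeff hDx hDc ?_ hDt 0, fun n hn x t hx ht => ?_⟩
  · exact .add (.add (.mul (.const _) (.mul (.add (.coeff 1) (.const _))
      (.add (.coeff 1) (.const _)))) (.mul (.const _) (.mul (.coeff 0) .inv))) (.const _)
  · obtain ⟨n, rfl⟩ := Nat.exists_eq_add_of_le' hn
    rw [iteratedDeriv_eq_of_hasDerivAt hDx _ hx ht, pow_add, pow_add, pow_one, mul_assoc ((-1) ^ n),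
      neg_one_mul (-1 : ℝ), neg_neg, mul_one]
    exact ge_of_tendsto' (((hD (n + 1)).tendsto hx ht).const_mul _) fun j =>
      alternating_bernsteinDeriv_nonneg (A j).size_nonneg (fun i => (A j).nonneg i t ht.le) n x
end

section
/- Let 0 < m < 1 and let F̄:[0,∞)→ℝ be a viscosity supersolution of the stationary equation (E) on (0,∞) such that: F̄ is concave; liminf_{x→∞} F̄(x)/x > 0; and 0 ≤ F̄(x) ≤ m·x for all x ≥ 0. Then F̄(x) = m·x for all x ≥ 0. -/
open Set Filter

/-- Viscosity subsolution of the stationary equation (E):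
`(1/2)(F′ − m)(F′ − m − 1) + F/x − m = 0` on `(0,∞)`. -/
def IsSubsolutionE (m : ℝ) (F : ℝ → ℝ) : Prop :=
  ∀ φ : ℝ → ℝ, ContDiff ℝ 1 φ →
    ∀ x₀ : ℝ, 0 < x₀ →
      IsLocalMaxOn (fun x => F x - φ x) (Ici 0) x₀ →
      (1 / 2) * (deriv φ x₀ - m) * (deriv φ x₀ - m - 1) + F x₀ / x₀ - m ≤ 0

/-- Viscosity supersolution of the stationary equation (E). -/
def IsSupersolutionE (m : ℝ) (F : ℝ → ℝ) : Prop :=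
  ∀ φ : ℝ → ℝ, ContDiff ℝ 1 φ →
    ∀ x₀ : ℝ, 0 < x₀ →
      IsLocalMinOn (fun x => F x - φ x) (Ici 0) x₀ →
      (1 / 2) * (deriv φ x₀ - m) * (deriv φ x₀ - m - 1) + F x₀ / x₀ - m ≥ 0

/-- Viscosity solution of the stationary equation (E). -/
def IsSolutionE (m : ℝ) (F : ℝ → ℝ) : Prop :=
  IsSubsolutionE m F ∧ IsSupersolutionE m F

/-- A concave function on `[0,∞)` that is nonnegative at `0` has `G x / x` nonincreasing. -/
theorem ConcaveOn.antitoneOn_div_self {G : ℝ → ℝ} (hconc : ConcaveOn ℝ (Ici 0) G)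
    (h0 : 0 ≤ G 0) : AntitoneOn (fun x => G x / x) (Ioi 0) := by
  intro x hx y hy hxy
  have hx : 0 < x := hx
  have hy : 0 < y := hy
  have h := hconc.2 (mem_Ici.2 le_rfl) (mem_Ici.2 hy.le)
    (sub_nonneg.2 ((div_le_one hy).2 hxy)) (div_nonneg hx.le hy.le) (sub_add_cancel 1 (x / y))
  simp only [smul_eq_mul, mul_zero, zero_add, div_mul_cancel₀ x hy.ne'] at h
  have h1 : 0 ≤ (1 - x / y) * G 0 := mul_nonneg (sub_nonneg.2 ((div_le_one hy).2 hxy)) h0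
  change G y / y ≤ G x / x
  rw [le_div_iff₀ hx]
  calc G y / y * x = x / y * G y := by ring
    _ ≤ G x := by linarith

/-- If `G` stays between the rays `L x` and `(L + δ) x` far out, then a supersolution admits a
test parabola whose slope at the contact point is within `6 δ` of `L`. -/
theorem IsSupersolutionE.exists_slope_near {m : ℝ} {G : ℝ → ℝ} (hsuper : IsSupersolutionE m G)
    (hcont : ContinuousOn G (Ici 0)) {L δ R : ℝ} (hδ : 0 < δ) (hR : 0 < R)
    (hL : ∀ x, R ≤ x → L * x ≤ G x) (hU : ∀ x, R ≤ x → G x ≤ (L + δ) * x) :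
    ∃ e : ℝ, |e| ≤ 6 * δ ∧
      0 ≤ (1 / 2) * (L + e - m) * (L + e - m - 1) + (L + δ) - m := by
  set K : ℝ := 3 * δ / R with hK
  have hKR : K * R = 3 * δ := div_mul_cancel₀ _ hR.ne'
  have hK0 : 0 < K := by positivity
  let φ : ℝ → ℝ := fun x => L * x - K * (x - 2 * R) ^ 2
  have hφ : ContDiff ℝ 1 φ := by fun_prop
  obtain ⟨x₀, hx₀, hmin⟩ := (isCompact_Icc (a := R) (b := 3 * R)).exists_isMinOn
    (nonempty_Icc.2 (by linarith)) (f := fun x => G x - φ x)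
    ((hcont.mono fun x hx => hR.le.trans hx.1).sub hφ.continuous.continuousOn)
  have hc : G x₀ - φ x₀ ≤ G (2 * R) - φ (2 * R) :=
    hmin (show 2 * R ∈ Icc R (3 * R) from ⟨by linarith, by linarith⟩)
  have hsq : K * (x₀ - 2 * R) ^ 2 < K * R * R := by
    have h1 := hL x₀ hx₀.1
    have h2 := hU (2 * R) (by linarith)
    have h3 := mul_pos hδ hR
    simp only [φ] at hc
    rw [hKR]
    nlinarith
  have hlt : (x₀ - 2 * R) ^ 2 < R ^ 2 := by
    rw [mul_assoc, ← sq] at hsq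
    exact lt_of_mul_lt_mul_left hsq hK0.le
  obtain ⟨hlo, hhi⟩ := abs_lt.1 (abs_lt_of_sq_lt_sq hlt hR.le)
  have hx₀pos : 0 < x₀ := hR.trans_le hx₀.1
  have hloc : IsLocalMin (fun x => G x - φ x) x₀ :=
    hmin.isLocalMin (Icc_mem_nhds (by linarith) (by linarith))
  have hder : HasDerivAt φ (L + -(2 * K * (x₀ - 2 * R))) x₀ := by
    have h1 := ((hasDerivAt_id x₀).sub_const (2 * R)).pow 2
    have h2 := ((hasDerivAt_id x₀).const_mul L).sub (h1.const_mul K)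
    refine h2.congr_deriv ?_
    simp
    ring
  have h := hsuper φ hφ x₀ hx₀pos (hloc.on _)
  rw [hder.deriv] at h
  refine ⟨-(2 * K * (x₀ - 2 * R)), ?_, ?_⟩
  · rw [abs_le]
    constructor <;> nlinarith
  · have h1 : G x₀ / x₀ ≤ L + δ := (div_le_iff₀ hx₀pos).2 (hU x₀ hx₀.1)
    linarith

/-- Lemma 5.1, characterization of concave supersolutions.
Let `0 < m < 1` and `F̄` be a continuous viscosity supersolution of (E) which is concave,
satisfies `liminf_{x→∞} F̄(x)/x > 0` and `0 ≤ F̄(x) ≤ m·x`. Then `F̄(x) = m·x` on `[0,∞)`. -/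
theorem concave_supersolution_is_linear (m : ℝ) (hm₀ : 0 < m) (hm₁ : m < 1)
    (G : ℝ → ℝ)
    (hcont : ContinuousOn G (Ici 0))
    (hsuper : IsSupersolutionE m G)
    (hconc : ConcaveOn ℝ (Ici 0) G)
    (hliminf : 0 < liminf (fun x => G x / x) atTop)
    (hBd : ∀ x : ℝ, 0 ≤ x → 0 ≤ G x ∧ G x ≤ m * x) :
    ∀ x : ℝ, 0 ≤ x → G x = m * x := by
  have hanti := hconc.antitoneOn_div_self (hBd 0 le_rfl).1
  have hbdd : IsBoundedUnder (· ≥ ·) atTop (fun x => G x / x) :=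
    isBoundedUnder_of_eventually_ge (a := 0) <| by
      filter_upwards [eventually_ge_atTop 0] with x hx
      exact div_nonneg (hBd x hx).1 hx
  obtain ⟨c, hc0, hc⟩ := exists_between hliminf
  have hcle : ∀ x, 0 < x → c ≤ G x / x := by
    intro x hx
    obtain ⟨y, hy, hxy⟩ :=
      ((eventually_lt_of_lt_liminf hc hbdd).and (eventually_ge_atTop x)).exists
    exact hy.le.trans (hanti hx (hx.trans_le hxy) hxy)
  set S : Set ℝ := (fun x => G x / x) '' Ioi 0
  have hSne : S.Nonempty := nonempty_Ioi.image _
  have hSc : ∀ s ∈ S, c ≤ s := by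
    rintro _ ⟨x, hx, rfl⟩
    exact hcle x hx
  set L : ℝ := sInf S
  have hL0 : 0 < L := hc0.trans_le (le_csInf hSne hSc)
  have hLle : ∀ x, 0 < x → L * x ≤ G x := fun x hx =>
    (le_div_iff₀ hx).1 (csInf_le ⟨c, hSc⟩ ⟨x, hx, rfl⟩)
  have hmL : m ≤ L := by
    by_contra! hlt
    have hd1 : 0 < 1 - (m - L) := by linarith
    have hd0 : 0 < m - L := by linarith
    obtain ⟨d, hd⟩ : ∃ d, d = m - L := ⟨_, rfl⟩
    rw [← hd] at hd0 hd1
    obtain ⟨δ, hδ⟩ : ∃ δ, δ = d * (1 - d) / 100 := ⟨_, rfl⟩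
    have hδ0 : 0 < δ := by rw [hδ]; positivity
    have hδ1 : δ ≤ 1 / 100 := by rw [hδ]; nlinarith
    obtain ⟨_, ⟨R, hR, rfl⟩, hRlt⟩ := exists_lt_of_csInf_lt hSne (lt_add_of_pos_right L hδ0)
    have hR : 0 < R := hR
    obtain ⟨e, he, h⟩ := hsuper.exists_slope_near hcont hδ0 hR
      (fun x hx => hLle x (hR.trans_le hx)) fun x hx =>
        (div_le_iff₀ (hR.trans_le hx)).1 ((hanti hR (hR.trans_le hx) hx).trans hRlt.le)
    obtain ⟨he1, he2⟩ := abs_le.1 he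
    have hLm : L = m - d := by linarith
    rw [hLm] at h
    have hesq : e ^ 2 ≤ δ := by nlinarith
    have hde : -(d * e) ≤ 6 * δ := by nlinarith
    nlinarith
  intro x hx
  refine le_antisymm (hBd x hx).2 ?_
  rcases hx.eq_or_lt with rfl | hx
  · simpa using (hBd 0 le_rfl).1
  · exact (mul_le_mul_of_nonneg_right hmL hx.le).trans (hLle x hx)
end

section
/- Let 0 < m < 1 and let F₀ be Lipschitz and sublinear with 0 ≤ F₀(x) ≤ m·x. Let F be the function that is Lipschitz on [0,∞)×[0,∞), sublinear in x, satisfies 0 ≤ F(x,t) ≤ m·x, F(x,0) = F₀(x), and is a viscosity solution of (HJ) on (0,∞)×(0,∞). Then F(x,t) ≥ min{ (1/4)·m·(1−m)·x, (1/4)·m·(1−m)·t } for all (x,t) ∈ [0,∞)×[0,∞); in particular, liminf_{t→∞} F(x,t) ≥ (1/4)·m·(1−m)·x for every x ≥ 0, locally uniformly on [0,∞). -/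
open Set Filter

/-- A smooth strict subsolution of (HJ) lying below `min (c * x) (c * t)`, penalized so as to tend
to `-∞` at infinity. -/
noncomputable def barrier (c ε : ℝ) (p : ℝ × ℝ) : ℝ :=
  c / 2 * (p.1 + p.2 - √((p.1 - p.2) ^ 2 + ε ^ 2)) - ε * (p.1 + 2 * p.2 + p.2 ^ 2)

section Barrier

variable {c ε : ℝ}

lemma sub_sq_add_sq_pos (hε : 0 < ε) (x t : ℝ) : 0 < (x - t) ^ 2 + ε ^ 2 := by positivity

lemma contDiff_barrier (hε : 0 < ε) : ContDiff ℝ 1 (barrier c ε) := by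
  have h : ContDiff ℝ 1 fun p : ℝ × ℝ => √((p.1 - p.2) ^ 2 + ε ^ 2) :=
    ContDiff.sqrt (by fun_prop) fun p => (sub_sq_add_sq_pos hε p.1 p.2).ne'
  unfold barrier
  fun_prop

lemma abs_sub_le_sqrt (x t : ℝ) : |x - t| ≤ √((x - t) ^ 2 + ε ^ 2) :=
  Real.abs_le_sqrt (by nlinarith [sq_nonneg ε])

lemma barrier_le_mul_left (hc : 0 ≤ c) (x t : ℝ) :
    barrier c ε (x, t) ≤ c * x - ε * (x + 2 * t + t ^ 2) := by
  have h := (neg_le_abs (x - t)).trans (abs_sub_le_sqrt (ε := ε) x t)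
  simp only [barrier]
  nlinarith

lemma barrier_le_mul_right (hc : 0 ≤ c) (x t : ℝ) :
    barrier c ε (x, t) ≤ c * t - ε * (x + 2 * t + t ^ 2) := by
  have h := (le_abs_self (x - t)).trans (abs_sub_le_sqrt (ε := ε) x t)
  simp only [barrier]
  nlinarith

lemma hasDerivAt_barrier_fst (hε : 0 < ε) (x t : ℝ) :
    HasDerivAt (fun y => barrier c ε (y, t))
      (c * ((1 - (x - t) / √((x - t) ^ 2 + ε ^ 2)) / 2) - ε) x := by
  have h := ((((hasDerivAt_id x).sub_const t).pow 2).add_const (ε ^ 2)).sqrt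
    (sub_sq_add_sq_pos hε x t).ne'
  have h2 := ((((hasDerivAt_id x).add_const t).sub h).const_mul (c / 2)).sub
    ((((hasDerivAt_id x).add_const (2 * t)).add_const (t ^ 2)).const_mul ε)
  have hs := (Real.sqrt_pos.2 (sub_sq_add_sq_pos hε x t)).ne'
  refine HasDerivAt.congr_deriv h2 ?_
  simp
  field_simp

lemma hasDerivAt_barrier_snd (hε : 0 < ε) (x t : ℝ) :
    HasDerivAt (fun s => barrier c ε (x, s))
      (c * ((1 + (x - t) / √((x - t) ^ 2 + ε ^ 2)) / 2) - 2 * ε - 2 * ε * t) t := by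
  have h := ((((hasDerivAt_id t).const_sub x).pow 2).add_const (ε ^ 2)).sqrt
    (sub_sq_add_sq_pos hε x t).ne'
  have h2 := ((((hasDerivAt_id t).const_add x).sub h).const_mul (c / 2)).sub
    (((((hasDerivAt_id t).const_mul 2).const_add x).add ((hasDerivAt_id t).pow 2)).const_mul ε)
  have hs := (Real.sqrt_pos.2 (sub_sq_add_sq_pos hε x t)).ne'
  refine HasDerivAt.congr_deriv h2 ?_
  simp
  field_simp
  ring

lemma tendsto_barrier (c x t : ℝ) :
    Tendsto (fun ε => barrier c ε (x, t)) (nhdsWithin 0 (Ioi 0)) (nhds (c * min x t)) := by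
  have hcont : Continuous fun ε => barrier c ε (x, t) := by unfold barrier; fun_prop
  have h0 : barrier c 0 (x, t) = c * min x t := by
    simp only [barrier, ne_eq, OfNat.ofNat_ne_zero, not_false_eq_true, zero_pow, add_zero,
      Real.sqrt_sq_eq_abs, zero_mul, sub_zero]
    rcases le_total x t with h | h
    · rw [min_eq_left h, abs_of_nonpos (sub_nonpos.2 h)]
      ring
    · rw [min_eq_right h, abs_of_nonneg (sub_nonneg.2 h)]
      ring
  exact h0 ▸ (hcont.tendsto 0).mono_left nhdsWithin_le_nhds

end Barrier

/-- Strict negativity of the Hamiltonian along convex combinations of the gradients of `c * x` and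
`c * t`, with a small perturbation. -/
lemma hamiltonian_neg {m ε s t c : ℝ} (hm₀ : 0 < m) (hm₁ : m < 1) (hc : c = 1 / 4 * m * (1 - m))
    (hε₀ : 0 < ε) (hε₁ : ε < 1) (hs₀ : 0 ≤ s) (hs₁ : s ≤ 1) (ht : 0 ≤ t) :
    c * (1 - s) - 2 * ε - 2 * ε * t + 1 / 2 * (c * s - ε - m) * (c * s - ε - m - 1) + c - m < 0 := by
  have hc₀ : 0 ≤ c := by rw [hc]; nlinarith [mul_pos hm₀ (sub_pos.2 hm₁)]
  have hc₁ : c ≤ m := by rw [hc]; nlinarith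
  have h₁ : 0 ≤ ε * (c * s) := by positivity
  have h₂ : 0 ≤ ε * t := by positivity
  have h₃ : 0 ≤ c * s * (m + 3 / 2 - c * s / 2) := by
    have : c * s ≤ c := mul_le_of_le_one_right hc₀ hs₁
    exact mul_nonneg (mul_nonneg hc₀ hs₀) (by linarith)
  nlinarith [mul_pos hε₀ (sub_pos.2 hε₁), mul_pos hε₀ (sub_pos.2 hm₁)]

lemma barrier_le_of_isSupersolutionHJ {m c ε : ℝ} {F : ℝ → ℝ → ℝ} (hm₀ : 0 < m) (hm₁ : m < 1)
    (hc : c = 1 / 4 * m * (1 - m)) (hε₀ : 0 < ε) (hε₁ : ε < 1)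
    (hcont : ContinuousOn (fun p : ℝ × ℝ => F p.1 p.2) (Ici 0 ×ˢ Ici 0))
    (hnonneg : ∀ x t : ℝ, 0 ≤ x → 0 ≤ t → 0 ≤ F x t) (hF : IsSupersolutionHJ m F)
    {x t : ℝ} (hx : 0 ≤ x) (ht : 0 ≤ t) : barrier c ε (x, t) ≤ F x t := by
  by_contra! hlt
  have hc₀ : 0 ≤ c := by rw [hc]; nlinarith [mul_pos hm₀ (sub_pos.2 hm₁)]
  set g : ℝ × ℝ → ℝ := fun p => F p.1 p.2 - barrier c ε p with hg
  set R : ℝ := c ^ 2 / (4 * ε ^ 2) with hR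
  have hRε : ε * R * (4 * ε) = c ^ 2 := by rw [hR]; field_simp
  have hbox : ∀ p : ℝ × ℝ, p ∈ Ici (0 : ℝ) ×ˢ Ici (0 : ℝ) → g p < 0 →
      p ∈ Icc (0 : ℝ) R ×ˢ Icc (0 : ℝ) R := by
    rintro ⟨y, s⟩ ⟨hy, hs⟩ hneg
    simp only [mem_Ici] at hy hs
    have h₁ := hnonneg y s hy hs
    have h₂ := barrier_le_mul_right (ε := ε) hc₀ y s
    have h₃ : c * s - ε * s ^ 2 ≤ ε * R := by
      refine le_of_mul_le_mul_right ?_ (show 0 < 4 * ε by positivity)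
      rw [hRε]
      nlinarith [sq_nonneg (c - 2 * ε * s)]
    have h₄ : ε * (y + 2 * s) < ε * R := by simp only [hg] at hneg; linarith
    have h₅ := lt_of_mul_lt_mul_left h₄ hε₀.le
    exact ⟨⟨hy, by dsimp only; linarith⟩, ⟨hs, by dsimp only; linarith⟩⟩
  have hmem : (x, t) ∈ Ici (0 : ℝ) ×ˢ Ici (0 : ℝ) := mk_mem_prod hx ht
  have hxt : g (x, t) < 0 := sub_neg.2 hlt
  have hsub : Icc (0 : ℝ) R ×ˢ Icc (0 : ℝ) R ⊆ Ici 0 ×ˢ Ici 0 :=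
    prod_mono Icc_subset_Ici_self Icc_subset_Ici_self
  have hgc : ContinuousOn g (Ici 0 ×ˢ Ici 0) :=
    hcont.sub (contDiff_barrier hε₀).continuous.continuousOn
  obtain ⟨⟨x₀, t₀⟩, hp, hmin⟩ := (isCompact_Icc.prod isCompact_Icc).exists_isMinOn
    ⟨_, hbox _ hmem hxt⟩ (hgc.mono hsub)
  have hp' := hsub hp
  have hneg : g (x₀, t₀) < 0 := (hmin (hbox _ hmem hxt)).trans_lt hxt
  have hmin' : IsMinOn g (Ici 0 ×ˢ Ici 0) (x₀, t₀) := fun q hq => by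
    by_cases hq' : g q < 0
    · exact hmin (hbox q hq hq')
    · exact hneg.le.trans (not_lt.1 hq')
  obtain ⟨hx₀ : 0 ≤ x₀, ht₀ : 0 ≤ t₀⟩ := hp'
  have hF₀ := hnonneg x₀ t₀ hx₀ ht₀
  have hlt₀ : F x₀ t₀ < barrier c ε (x₀, t₀) := sub_neg.1 hneg
  have hpen : 0 ≤ ε * (x₀ + 2 * t₀ + t₀ ^ 2) := by positivity
  have hleft := barrier_le_mul_left (ε := ε) hc₀ x₀ t₀
  have hright := barrier_le_mul_right (ε := ε) hc₀ x₀ t₀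
  have hx₀' : 0 < x₀ := hx₀.lt_of_ne' (by rintro rfl; linarith)
  have ht₀' : 0 < t₀ := ht₀.lt_of_ne' (by rintro rfl; linarith)
  have hineq := hF _ (contDiff_barrier hε₀) x₀ t₀ hx₀' ht₀' hmin'.localize
  rw [(hasDerivAt_barrier_fst hε₀ x₀ t₀).deriv, (hasDerivAt_barrier_snd hε₀ x₀ t₀).deriv] at hineq
  have hquot : F x₀ t₀ / x₀ ≤ c := by rw [div_le_iff₀ hx₀']; linarith
  have hr : |(x₀ - t₀) / √((x₀ - t₀) ^ 2 + ε ^ 2)| ≤ 1 := by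
    rw [abs_div, abs_of_nonneg (Real.sqrt_nonneg _)]
    exact div_le_one_of_le₀ (abs_sub_le_sqrt x₀ t₀) (Real.sqrt_nonneg _)
  obtain ⟨hr₁, hr₂⟩ := abs_le.1 hr
  set r := (x₀ - t₀) / √((x₀ - t₀) ^ 2 + ε ^ 2)
  have hH := hamiltonian_neg (s := (1 - r) / 2) hm₀ hm₁ hc hε₀ hε₁ (by linarith) (by linarith) ht₀
  linarith

/-- Lemma 5.2, lower bound for the solution.
Let `0 < m < 1` and `F` be the Lipschitz, sublinear viscosity solution of (HJ). Then
`F(x,t) ≥ min{(1/4)m(1−m)x, (1/4)m(1−m)t}` on `[0,∞)×[0,∞)`; in particular,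
`liminf_{t→∞} F(x,t) ≥ (1/4)m(1−m)x` for every `x ≥ 0`. -/
theorem lower_bound_large_time (m : ℝ) (hm₀ : 0 < m) (hm₁ : m < 1)
    (F₀ : ℝ → ℝ)
    (hLip : ∃ K : NNReal, LipschitzOnWith K F₀ (Ici 0))
    (hSub : Sublinear F₀)
    (hBd : ∀ x : ℝ, 0 ≤ x → 0 ≤ F₀ x ∧ F₀ x ≤ m * x)
    (F : ℝ → ℝ → ℝ) (hF : GoodSolution m F₀ F) :
    (∀ x t : ℝ, 0 ≤ x → 0 ≤ t →
      min ((1 / 4) * m * (1 - m) * x) ((1 / 4) * m * (1 - m) * t) ≤ F x t) ∧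
    (∀ x : ℝ, 0 ≤ x → (1 / 4) * m * (1 - m) * x ≤ liminf (fun t => F x t) atTop) := by
  have hc : 0 ≤ 1 / 4 * m * (1 - m) := by nlinarith [mul_pos hm₀ (sub_pos.2 hm₁)]
  obtain ⟨⟨K, hK⟩, -, hbd, -, -, hsuper⟩ := hF
  have hlower : ∀ x t : ℝ, 0 ≤ x → 0 ≤ t →
      min ((1 / 4) * m * (1 - m) * x) ((1 / 4) * m * (1 - m) * t) ≤ F x t := by
    intro x t hx ht
    rw [← mul_min_of_nonneg _ _ hc]
    refine le_of_tendsto (tendsto_barrier _ x t) ?_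
    filter_upwards [Ioo_mem_nhdsGT (zero_lt_one' ℝ)] with ε hε
    exact barrier_le_of_isSupersolutionHJ hm₀ hm₁ rfl hε.1 hε.2 hK.continuousOn
      (fun x t hx ht => (hbd x t hx ht).1) hsuper hx ht
  refine ⟨hlower, fun x hx => le_liminf_of_le ?_ ?_⟩
  · refine IsBoundedUnder.isCoboundedUnder_ge ⟨m * x, eventually_map.2 ?_⟩
    filter_upwards [eventually_ge_atTop (0 : ℝ)] with t ht using (hbd x t hx ht).2
  · filter_upwards [eventually_ge_atTop x] with t ht
    exact (min_eq_left (mul_le_mul_of_nonneg_left ht hc)).ge.trans (hlower x t hx (hx.trans ht))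
end

section
/- Let 0 < m < 1 and let F₀ ∈ C²([0,∞)) be Lipschitz and sublinear with 0 ≤ F₀(x) ≤ m·x, satisfying (A1) and (A2). Let F be the function that is Lipschitz on [0,∞)×[0,∞), sublinear in x, satisfies 0 ≤ F(x,t) ≤ m·x, F(x,0) = F₀(x), and is a viscosity solution of (HJ) on (0,∞)×(0,∞). Then F(x,t) → m·x as t → ∞, locally uniformly for x ∈ [0,∞); i.e., for every compact K ⊂ [0,∞), sup_{x ∈ K} |F(x,t) − m·x| → 0 as t → ∞. -/
open Set Filter

/-- First derivative of `F₀` on `[0,∞)`. -/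
noncomputable def D1 (F₀ : ℝ → ℝ) : ℝ → ℝ := derivWithin F₀ (Ici 0)

/-- Second derivative of `F₀` on `[0,∞)`. -/
noncomputable def D2 (F₀ : ℝ → ℝ) : ℝ → ℝ := derivWithin (derivWithin F₀ (Ici 0)) (Ici 0)

/-- The decaying coefficient `c(x,t) = M ((1 + x²) / (1 + x² + t²)) ^ α`; the function `x c(x,t)` is
the barrier that dominates `m x - F`. -/
noncomputable def barrierCoeff (M α x t : ℝ) : ℝ :=
  M * Real.exp (α * (Real.log (1 + x ^ 2) - Real.log (1 + x ^ 2 + t ^ 2)))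

lemma barrierCoeff_nonneg {M : ℝ} (hM : 0 ≤ M) (α x t : ℝ) : 0 ≤ barrierCoeff M α x t := by
  unfold barrierCoeff; positivity

lemma barrierCoeff_le {M α : ℝ} (hM : 0 ≤ M) (hα : 0 ≤ α) (x t : ℝ) :
    barrierCoeff M α x t ≤ M := by
  have h : Real.log (1 + x ^ 2) ≤ Real.log (1 + x ^ 2 + t ^ 2) :=
    Real.log_le_log (by positivity) (by nlinarith [sq_nonneg t])
  have h1 : Real.exp (α * (Real.log (1 + x ^ 2) - Real.log (1 + x ^ 2 + t ^ 2))) ≤ 1 :=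
    Real.exp_le_one_iff.2 (mul_nonpos_of_nonneg_of_nonpos hα (by linarith))
  unfold barrierCoeff
  nlinarith

lemma barrierCoeff_ge {M α x t : ℝ} (hM : 0 ≤ M) (hα : 0 ≤ α) (ht : 0 ≤ t) (htx : t ≤ x) :
    M * (1 - α) ≤ barrierCoeff M α x t := by
  have hpos : 0 < 1 + x ^ 2 := by positivity
  have h : Real.log (1 + x ^ 2 + t ^ 2) - Real.log (1 + x ^ 2) ≤ 1 := by
    rw [← Real.log_div (by positivity) (by positivity)]
    refine (Real.log_le_sub_one_of_pos (by positivity)).trans ?_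
    rw [sub_le_iff_le_add, div_le_iff₀ hpos]
    nlinarith
  have h1 := Real.add_one_le_exp (α * (Real.log (1 + x ^ 2) - Real.log (1 + x ^ 2 + t ^ 2)))
  unfold barrierCoeff
  exact mul_le_mul_of_nonneg_left (by nlinarith) hM

lemma contDiff_barrierCoeff (M α : ℝ) :
    ContDiff ℝ 1 (fun p : ℝ × ℝ => barrierCoeff M α p.1 p.2) := by
  unfold barrierCoeff
  refine contDiff_const.mul (Real.contDiff_exp.comp (contDiff_const.mul (ContDiff.sub ?_ ?_)))
  · exact ContDiff.log (by fun_prop) fun p => by positivity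
  · exact ContDiff.log (by fun_prop) fun p => by positivity

lemma hasDerivAt_barrierCoeff_space (M α x t : ℝ) :
    HasDerivAt (fun y => barrierCoeff M α y t)
      (barrierCoeff M α x t * (α * (2 * x / (1 + x ^ 2) - 2 * x / (1 + x ^ 2 + t ^ 2)))) x := by
  have h1 : HasDerivAt (fun y : ℝ => 1 + y ^ 2) (2 * x) x := by
    simpa using (hasDerivAt_pow 2 x).const_add 1
  have h2 := h1.log (by positivity)
  have h3 := (h1.add_const (t ^ 2)).log (by positivity)
  refine ((((h2.sub h3).const_mul α).exp).const_mul M).congr_deriv ?_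
  simp only [barrierCoeff, Pi.sub_apply]
  ring

lemma hasDerivAt_barrierCoeff_time (M α x t : ℝ) :
    HasDerivAt (fun s => barrierCoeff M α x s)
      (-(barrierCoeff M α x t * (α * (2 * t / (1 + x ^ 2 + t ^ 2))))) t := by
  have h1 : HasDerivAt (fun s : ℝ => 1 + x ^ 2 + s ^ 2) (2 * t) t := by
    simpa using (hasDerivAt_pow 2 t).const_add (1 + x ^ 2)
  have h2 := h1.log (by positivity)
  refine ((((h2.const_sub (Real.log (1 + x ^ 2))).const_mul α).exp).const_mul M).congr_deriv ?_
  unfold barrierCoeff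
  ring

/-- The differential inequality behind the barrier: `c` is its coefficient, `q = x ∂ₓc` and
`r = -x ∂ₜc`. -/
lemma barrier_inequality {M α c q r : ℝ} (hM : M ≤ 1) (hα : 0 ≤ α) (hMα : 12 * α ≤ 1 - M)
    (hc : 0 ≤ c) (hcM : c ≤ M) (hq : 0 ≤ q) (hqc : q ≤ 2 * α * c) (hr : r ≤ α * c) :
    r + (1 / 2) * (c + q) * (c + q + 1) - c ≤ 0 := by
  have h1 : (c + q) * (c + q + 1) ≤ (c + 2 * α * c) * (c + 2 * α * c + 1) :=
    mul_le_mul (by linarith) (by linarith) (by linarith) (by positivity)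
  have hα1 : α ≤ 1 := by linarith
  have hc1 : c ≤ 1 := hcM.trans hM
  have h2 : 4 * α * c ≤ 4 * α := by nlinarith
  have h3 : 4 * α ^ 2 * c ≤ 4 * α := by nlinarith [mul_nonneg hα hα]
  have h4 : 2 * α + (1 + 2 * α) * (c + 2 * α * c + 1) - 2 ≤ 0 := by nlinarith
  nlinarith [mul_nonpos_of_nonneg_of_nonpos hc h4]

/-- A nonnegative viscosity supersolution of (HJ) lies above `m x - x c(x,t)`, up to an arbitrarily
small multiple of `t²`. -/
lemma supersolution_ge_barrier {m M α : ℝ} {F : ℝ → ℝ → ℝ} (hm1 : m ≤ 1)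
    (hM0 : 0 ≤ M) (hM : M ≤ 1) (hα : 0 ≤ α) (hMα : 12 * α ≤ 1 - M) (hmM : m ≤ M * (1 - α))
    (hcont : ContinuousOn (fun p : ℝ × ℝ => F p.1 p.2) (Ici 0 ×ˢ Ici 0))
    (hF0 : ∀ x t : ℝ, 0 ≤ x → 0 ≤ t → 0 ≤ F x t)
    (hinit : ∀ x : ℝ, 0 ≤ x → m * x - x * barrierCoeff M α x 0 ≤ F x 0)
    (hsup : IsSupersolutionHJ m F) {ε : ℝ} (hε : 0 < ε) {x t : ℝ} (hx : 0 ≤ x) (ht : 0 ≤ t) :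
    m * x - x * barrierCoeff M α x t - ε * t ^ 2 ≤ F x t := by
  by_contra! hneg
  set φ : ℝ × ℝ → ℝ := fun p => m * p.1 - p.1 * barrierCoeff M α p.1 p.2 - ε * p.2 ^ 2 with hφ
  have hφC : ContDiff ℝ 1 φ := by
    have := contDiff_barrierCoeff M α
    fun_prop
  have hout : ∀ y s : ℝ, 0 ≤ y → 0 ≤ s → F y s - φ (y, s) < 0 → y ≤ 1 / ε ∧ s ≤ 1 / ε := by
    intro y s hy hs hlt
    have hFy := hF0 y s hy hs
    have hc := barrierCoeff_nonneg hM0 α y s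
    simp only [hφ] at hlt
    have hys : y < s := by
      by_contra! hsy
      have := barrierCoeff_ge hM0 hα hs hsy
      have h2 : m * y ≤ y * barrierCoeff M α y s := by nlinarith
      nlinarith [mul_nonneg hε.le (sq_nonneg s)]
    have hsε : s ≤ 1 / ε := by
      rw [le_div_iff₀ hε]
      by_contra! hlarge
      have hmy : m * y ≤ y := mul_le_of_le_one_left hy hm1
      nlinarith [mul_nonneg hy hc]
    exact ⟨hys.le.trans hsε, hsε⟩
  have hxt : F x t - φ (x, t) < 0 := by simp only [hφ]; linarith
  have hsub : Icc (0 : ℝ) (1 / ε) ×ˢ Icc (0 : ℝ) (1 / ε) ⊆ Ici 0 ×ˢ Ici 0 :=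
    prod_mono Icc_subset_Ici_self Icc_subset_Ici_self
  obtain ⟨hx', ht'⟩ := hout x t hx ht hxt
  obtain ⟨⟨y, s⟩, hmem, hmin⟩ := (isCompact_Icc.prod isCompact_Icc).exists_isMinOn
    ⟨(x, t), ⟨hx, hx'⟩, ⟨ht, ht'⟩⟩
    ((hcont.sub hφC.continuous.continuousOn).mono hsub)
  have hyneg : F y s - φ (y, s) < 0 :=
    (hmin (show (x, t) ∈ _ from ⟨⟨hx, hx'⟩, ⟨ht, ht'⟩⟩)).trans_lt hxt
  have hy0 : 0 ≤ y := hmem.1.1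
  have hs0 : 0 ≤ s := hmem.2.1
  have hglob : IsMinOn (fun p : ℝ × ℝ => F p.1 p.2 - φ p) (Ici 0 ×ˢ Ici 0) (y, s) := by
    rintro ⟨z, r⟩ ⟨hz, hr⟩
    rcases lt_or_ge (F z r - φ (z, r)) 0 with h | h
    · obtain ⟨h1, h2⟩ := hout z r hz hr h
      exact hmin (show (z, r) ∈ _ from ⟨⟨hz, h1⟩, ⟨hr, h2⟩⟩)
    · exact hyneg.le.trans h
  have hFy := hF0 y s hy0 hs0
  have hy : 0 < y := by
    refine hy0.lt_of_ne ?_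
    rintro rfl
    simp only [hφ] at hyneg
    nlinarith [mul_nonneg hε.le (sq_nonneg s)]
  have hs : 0 < s := by
    refine hs0.lt_of_ne ?_
    rintro rfl
    have := hinit y hy0
    simp only [hφ] at hyneg
    nlinarith
  have hvisc := hsup φ hφC y s hy hs hglob.localize
  set c := barrierCoeff M α y s with hc
  have hdt : deriv (fun r => φ (y, r)) s =
      y * (c * (α * (2 * s / (1 + y ^ 2 + s ^ 2)))) - ε * (2 * s) := by
    have h := (((hasDerivAt_barrierCoeff_time M α y s).const_mul y).const_sub (m * y)).sub
      ((hasDerivAt_pow 2 s).const_mul ε)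
    refine h.deriv.trans ?_
    simp [hc]
  have hdx : deriv (fun z => φ (z, s)) y =
      m - (c + y * (c * (α * (2 * y / (1 + y ^ 2) - 2 * y / (1 + y ^ 2 + s ^ 2))))) := by
    have h := ((((hasDerivAt_id y).const_mul m).sub
      ((hasDerivAt_id y).mul (hasDerivAt_barrierCoeff_space M α y s))).sub_const (ε * s ^ 2))
    refine h.deriv.trans ?_
    simp [hc]
  have hc0 : 0 ≤ c := barrierCoeff_nonneg hM0 α y s
  have hcM : c ≤ M := barrierCoeff_le hM0 hα y s
  have hFdiv : F y s / y < m - c := by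
    rw [div_lt_iff₀ hy]
    simp only [hφ, ← hc] at hyneg
    nlinarith [mul_nonneg hε.le (sq_nonneg s)]
  have hr : y * (c * (α * (2 * s / (1 + y ^ 2 + s ^ 2)))) ≤ α * c := by
    have h : 2 * y * s / (1 + y ^ 2 + s ^ 2) ≤ 1 := by
      rw [div_le_one (by positivity)]
      nlinarith [sq_nonneg (y - s)]
    calc y * (c * (α * (2 * s / (1 + y ^ 2 + s ^ 2))))
        = (α * c) * (2 * y * s / (1 + y ^ 2 + s ^ 2)) := by ring
      _ ≤ (α * c) * 1 := by gcongr
      _ = α * c := mul_one _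
  have hfrac : 2 * y / (1 + y ^ 2 + s ^ 2) ≤ 2 * y / (1 + y ^ 2) :=
    div_le_div_of_nonneg_left (by positivity) (by positivity) (by nlinarith [sq_nonneg s])
  have hq0 : 0 ≤ y * (c * (α * (2 * y / (1 + y ^ 2) - 2 * y / (1 + y ^ 2 + s ^ 2)))) :=
    mul_nonneg hy0 (mul_nonneg hc0 (mul_nonneg hα (sub_nonneg.2 hfrac)))
  have hqc : y * (c * (α * (2 * y / (1 + y ^ 2) - 2 * y / (1 + y ^ 2 + s ^ 2)))) ≤ 2 * α * c := by
    have h1 : y * (2 * y / (1 + y ^ 2)) ≤ 2 := by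
      rw [← mul_div_assoc, div_le_iff₀ (by positivity)]
      nlinarith
    have h2 : 0 ≤ y * (2 * y / (1 + y ^ 2 + s ^ 2)) := by positivity
    calc y * (c * (α * (2 * y / (1 + y ^ 2) - 2 * y / (1 + y ^ 2 + s ^ 2))))
        = (α * c) * (y * (2 * y / (1 + y ^ 2)) - y * (2 * y / (1 + y ^ 2 + s ^ 2))) := by ring
      _ ≤ (α * c) * 2 := by gcongr; linarith
      _ = 2 * α * c := by ring
  have hbar := barrier_inequality hM hα hMα hc0 hcM hq0 hqc hr
  rw [hdt, hdx] at hvisc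
  have hεs : 0 < ε * (2 * s) := by positivity
  linarith

lemma tendsto_barrier_bound {α : ℝ} (hα : 0 < α) (R : ℝ) :
    Tendsto (fun t : ℝ => R * Real.exp (α * (Real.log (1 + R ^ 2) - Real.log (1 + t ^ 2))))
      atTop (nhds 0) := by
  have h1 : Tendsto (fun t : ℝ => Real.log (1 + t ^ 2)) atTop atTop :=
    Real.tendsto_log_atTop.comp
      (tendsto_atTop_add_const_left _ 1 (tendsto_pow_atTop (two_ne_zero)))
  have h2 : Tendsto (fun t : ℝ => α * (Real.log (1 + R ^ 2) - Real.log (1 + t ^ 2))) atTop atBot :=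
    (tendsto_atBot_add_const_left _ _ (tendsto_neg_atTop_atBot.comp h1)).const_mul_atBot hα
  simpa using (Real.tendsto_exp_atBot.comp h2).const_mul R

/-- Theorem 1.8, large time behavior for `0 < m < 1`.
Let `0 < m < 1`, `F₀ ∈ C²` Lipschitz, sublinear with `0 ≤ F₀ ≤ m·x` satisfying (A1),(A2),
and let `F` be the Lipschitz sublinear viscosity solution of (HJ). Then `F(x,t) → m·x` as
`t → ∞`, locally uniformly on `[0,∞)`. -/
theorem large_time_behavior (m : ℝ) (hm₀ : 0 < m) (hm₁ : m < 1)
    (F₀ : ℝ → ℝ) (hC2 : ContDiffOn ℝ 2 F₀ (Ici 0))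
    (hLip : ∃ K : NNReal, LipschitzOnWith K F₀ (Ici 0))
    (hSub : Sublinear F₀)
    (hBd : ∀ x : ℝ, 0 ≤ x → 0 ≤ F₀ x ∧ F₀ x ≤ m * x)
    (hA1 : (∀ x : ℝ, 0 ≤ x → 0 ≤ D1 F₀ x ∧ D1 F₀ x ≤ m) ∧ D1 F₀ 0 = m)
    (hA2 : ∃ C > 0, ∀ x : ℝ, 0 < x → -C ≤ D2 F₀ x ∧ D2 F₀ x ≤ 0)
    (F : ℝ → ℝ → ℝ) (hF : GoodSolution m F₀ F) :
    ∀ K : Set ℝ, IsCompact K → K ⊆ Ici 0 →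
      TendstoUniformlyOn (fun t x => F x t) (fun x => m * x) atTop K := by
  obtain ⟨⟨L, hFLip⟩, -, hFbd, -, -, hsup⟩ := hF
  intro K hK hK0
  set M := (1 + m) / 2 with hMdef
  set α := (1 - m) / 24 with hαdef
  have hM0 : 0 ≤ M := by linarith
  have hM1 : M ≤ 1 := by linarith
  have hα : 0 < α := by linarith
  have hmM : m ≤ M * (1 - α) := by nlinarith
  have hinit : ∀ x : ℝ, 0 ≤ x → m * x - x * barrierCoeff M α x 0 ≤ F x 0 := by
    intro x hx
    have h := barrierCoeff_ge hM0 hα.le le_rfl hx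
    nlinarith [(hFbd x 0 hx le_rfl).1]
  have hlow : ∀ x t : ℝ, 0 ≤ x → 0 ≤ t → m * x - x * barrierCoeff M α x t ≤ F x t := by
    intro x t hx ht
    have hlim : Tendsto (fun ε : ℝ => m * x - x * barrierCoeff M α x t - ε * t ^ 2)
        (nhdsWithin 0 (Ioi 0)) (nhds (m * x - x * barrierCoeff M α x t)) := by
      have h : Continuous fun ε : ℝ => m * x - x * barrierCoeff M α x t - ε * t ^ 2 := by fun_prop
      simpa using (h.tendsto 0).mono_left nhdsWithin_le_nhds
    refine le_of_tendsto hlim ?_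
    filter_upwards [self_mem_nhdsWithin] with ε hε
    exact supersolution_ge_barrier hm₁.le hM0 hM1 hα.le (by linarith) hmM hFLip.continuousOn
      (fun x t hx ht => (hFbd x t hx ht).1) hinit hsup hε hx ht
  obtain ⟨R, hR⟩ := hK.bddAbove
  rw [Metric.tendstoUniformlyOn_iff]
  intro δ hδ
  filter_upwards [(tendsto_barrier_bound hα R).eventually (gt_mem_nhds hδ), eventually_ge_atTop 0]
    with t htδ ht x hxK
  have hx : 0 ≤ x := hK0 hxK
  have hxR : x ≤ R := hR hxK
  rw [Real.dist_eq, abs_of_nonneg (sub_nonneg.2 (hFbd x t hx ht).2)]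
  have hlogR : Real.log (1 + x ^ 2) ≤ Real.log (1 + R ^ 2) :=
    Real.log_le_log (by positivity) (by nlinarith)
  have hlogt : Real.log (1 + t ^ 2) ≤ Real.log (1 + x ^ 2 + t ^ 2) :=
    Real.log_le_log (by positivity) (by nlinarith [sq_nonneg x])
  have hc : barrierCoeff M α x t ≤
      Real.exp (α * (Real.log (1 + R ^ 2) - Real.log (1 + t ^ 2))) := by
    unfold barrierCoeff
    refine (mul_le_of_le_one_left (Real.exp_pos _).le hM1).trans ?_
    gcongr
  calc m * x - F x t ≤ x * barrierCoeff M α x t := by linarith [hlow x t hx ht]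
    _ ≤ R * Real.exp (α * (Real.log (1 + R ^ 2) - Real.log (1 + t ^ 2))) :=
      mul_le_mul hxR hc (barrierCoeff_nonneg hM0 α x t) (hx.trans hxR)
    _ < δ := htδ
end

section
/- For m = 1, there exists a function F:[0,∞)→ℝ which is Lipschitz continuous, sublinear, satisfies 0 ≤ F(x) ≤ x for all x ≥ 0, and is a viscosity solution of the stationary equation (1/2)(F′(x) − 1)(F′(x) − 2) + F(x)/x − 1 = 0 on (0,∞); moreover F can be taken to be a Bernstein function, i.e., F ∈ C^∞((0,∞)) with (−1)^{n+1}·F^{(n)}(x) ≥ 0 for all integers n ≥ 1 and all x > 0. -/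
open Set Filter

open Topology

/-- A family of functions on `(0,∞)`, each nonnegative and with derivative the negative of a member
of the family, consists of completely monotone functions. -/
theorem alternating_iteratedDeriv_of_family {S : Set (ℝ → ℝ)}
    (hnonneg : ∀ f ∈ S, ∀ x, 0 < x → 0 ≤ f x)
    (hderiv : ∀ f ∈ S, ∃ g ∈ S, ∀ x, 0 < x → HasDerivAt f (-g x) x) (n : ℕ) :
    ∀ f ∈ S, ∀ x, 0 < x → 0 ≤ (-1 : ℝ) ^ n * iteratedDeriv n f x := by
  induction n with
  | zero => intro f hf x hx; simpa using hnonneg f hf x hx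
  | succ n ih =>
    intro f hf x hx
    obtain ⟨g, hg, hfg⟩ := hderiv f hf
    have heq : EqOn (deriv f) (fun y => -g y) (Ioi 0) := fun y hy => (hfg y hy).deriv
    rw [iteratedDeriv_succ', heq.iteratedDeriv_of_isOpen isOpen_Ioi n hx, iteratedDeriv_fun_neg]
    have := ih g hg x hx
    rw [pow_succ]
    linarith

/-- A family of functions on `(0,∞)` closed under differentiation up to sign consists of smooth
functions. -/
theorem contDiffOn_of_family {S : Set (ℝ → ℝ)}
    (hderiv : ∀ f ∈ S, ∃ g ∈ S, ∀ x, 0 < x → HasDerivAt f (-g x) x) (n : ℕ) :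
    ∀ f ∈ S, ContDiffOn ℝ n f (Ioi 0) := by
  induction n with
  | zero =>
    intro f hf
    obtain ⟨g, -, hfg⟩ := hderiv f hf
    exact contDiffOn_zero.2 fun x hx => (hfg x hx).continuousAt.continuousWithinAt
  | succ n ih =>
    intro f hf
    obtain ⟨g, hg, hfg⟩ := hderiv f hf
    push_cast
    rw [contDiffOn_succ_iff_deriv_of_isOpen isOpen_Ioi]
    refine ⟨fun x hx => (hfg x hx).differentiableAt.differentiableWithinAt, by simp, ?_⟩
    exact (ih g hg).neg.congr fun x hx => (hfg x hx).deriv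

/-- The semiring of functions generated by two functions and the nonnegative constants. -/
inductive PosPoly (u v : ℝ → ℝ) : (ℝ → ℝ) → Prop
  | const (c : ℝ) (hc : 0 ≤ c) : PosPoly u v (fun _ => c)
  | left : PosPoly u v u
  | right : PosPoly u v v
  | add {f g : ℝ → ℝ} : PosPoly u v f → PosPoly u v g → PosPoly u v (fun x => f x + g x)
  | mul {f g : ℝ → ℝ} : PosPoly u v f → PosPoly u v g → PosPoly u v (fun x => f x * g x)

theorem PosPoly.nonneg {u v : ℝ → ℝ} (hu : ∀ x, 0 < x → 0 ≤ u x) (hv : ∀ x, 0 < x → 0 ≤ v x)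
    {f : ℝ → ℝ} (hf : PosPoly u v f) : ∀ x, 0 < x → 0 ≤ f x := by
  induction hf with
  | const c hc => exact fun _ _ => hc
  | left => exact hu
  | right => exact hv
  | add _ _ ihf ihg => exact fun x hx => add_nonneg (ihf x hx) (ihg x hx)
  | mul _ _ ihf ihg => exact fun x hx => mul_nonneg (ihf x hx) (ihg x hx)

theorem PosPoly.exists_hasDerivAt {u v : ℝ → ℝ}
    (hu : ∃ g, PosPoly u v g ∧ ∀ x, 0 < x → HasDerivAt u (-g x) x)
    (hv : ∃ g, PosPoly u v g ∧ ∀ x, 0 < x → HasDerivAt v (-g x) x)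
    {f : ℝ → ℝ} (hf : PosPoly u v f) :
    ∃ g, PosPoly u v g ∧ ∀ x, 0 < x → HasDerivAt f (-g x) x := by
  induction hf with
  | const c hc =>
    exact ⟨_, .const 0 le_rfl, fun x _ => by simpa using hasDerivAt_const x c⟩
  | left => exact hu
  | right => exact hv
  | add _ _ ihf ihg =>
    obtain ⟨f', hf', hdf⟩ := ihf
    obtain ⟨g', hg', hdg⟩ := ihg
    exact ⟨_, hf'.add hg', fun x hx => ((hdf x hx).add (hdg x hx)).congr_deriv (by ring)⟩
  | mul hf hg ihf ihg =>
    obtain ⟨f', hf', hdf⟩ := ihf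
    obtain ⟨g', hg', hdg⟩ := ihg
    exact ⟨_, (hf'.mul hg).add (hf.mul hg'),
      fun x hx => ((hdf x hx).mul (hdg x hx)).congr_deriv (by ring)⟩

/-- `p x` is a root in `(0,1]` of `x p³ + p = 1` for every `x ≥ 0`. -/
def IsCubicRoot (p : ℝ → ℝ) : Prop :=
  ∀ x, 0 ≤ x → 0 < p x ∧ p x ≤ 1 ∧ x * p x ^ 3 + p x = 1

theorem exists_isCubicRoot : ∃ p, IsCubicRoot p := by
  have h : ∀ x : ℝ, ∃ p : ℝ, 0 ≤ x → 0 < p ∧ p ≤ 1 ∧ x * p ^ 3 + p = 1 := by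
    intro x
    by_cases hx : 0 ≤ x
    · have hc : ContinuousOn (fun p : ℝ => x * p ^ 3 + p) (Icc 0 1) := by fun_prop
      obtain ⟨p, ⟨hp0, hp1⟩, hp⟩ := intermediate_value_Icc zero_le_one hc
        (show (1 : ℝ) ∈ Icc _ _ by constructor <;> simp [hx])
      refine ⟨p, fun _ => ⟨hp0.lt_of_ne ?_, hp1, hp⟩⟩
      rintro rfl
      simp at hp
    · exact ⟨0, fun h => absurd h hx⟩
  choose p hp using h
  exact ⟨p, hp⟩

namespace IsCubicRoot

variable {p : ℝ → ℝ}

theorem sub_mul_eq (hp : IsCubicRoot p) {x y : ℝ} (hx : 0 ≤ x) (hy : 0 ≤ y) :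
    (p y - p x) * (1 + x * (p x ^ 2 + p x * p y + p y ^ 2)) = -(y - x) * p y ^ 3 := by
  linear_combination (hp y hy).2.2 - (hp x hx).2.2

theorem lipschitzOnWith (hp : IsCubicRoot p) : LipschitzOnWith 1 p (Ici 0) := by
  refine LipschitzOnWith.of_dist_le_mul fun y hy x hx => ?_
  obtain ⟨ha, -, -⟩ := hp x hx
  obtain ⟨hb, hb1, -⟩ := hp y hy
  have hx' : 0 ≤ x := hx
  have h := congrArg abs (hp.sub_mul_eq hx hy)
  have hD : 1 ≤ 1 + x * (p x ^ 2 + p x * p y + p y ^ 2) := by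
    have : 0 ≤ x * (p x ^ 2 + p x * p y + p y ^ 2) := by positivity
    linarith
  rw [abs_mul, abs_mul, abs_neg, abs_of_pos (zero_lt_one.trans_le hD),
    abs_of_pos (pow_pos hb 3)] at h
  rw [Real.dist_eq, Real.dist_eq, NNReal.coe_one, one_mul]
  calc |p y - p x| ≤ |p y - p x| * (1 + x * (p x ^ 2 + p x * p y + p y ^ 2)) :=
        le_mul_of_one_le_right (abs_nonneg _) hD
    _ = |y - x| * p y ^ 3 := h
    _ ≤ |y - x| := mul_le_of_le_one_right (abs_nonneg _) (pow_le_one₀ hb.le hb1)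

theorem hasDerivAt (hp : IsCubicRoot p) {x : ℝ} (hx : 0 < x) :
    HasDerivAt p (-(p x ^ 4 * (3 - 2 * p x)⁻¹)) x := by
  obtain ⟨ha, ha1, he⟩ := hp x hx.le
  have hcont : ContinuousAt p x :=
    hp.lipschitzOnWith.continuousOn.continuousAt (Ici_mem_nhds hx)
  have hD : 1 + x * (p x ^ 2 + p x * p x + p x ^ 2) ≠ 0 := by positivity
  have hval : -(p x ^ 4 * (3 - 2 * p x)⁻¹)
      = -p x ^ 3 / (1 + x * (p x ^ 2 + p x * p x + p x ^ 2)) := by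
    have h3 : 3 - 2 * p x ≠ 0 := by linarith
    rw [neg_div, neg_inj, ← div_eq_mul_inv, div_eq_div_iff h3 hD]
    linear_combination 3 * p x ^ 3 * he
  rw [hasDerivAt_iff_tendsto_slope, hval]
  have hlim : Tendsto (fun y => -p y ^ 3 / (1 + x * (p x ^ 2 + p x * p y + p y ^ 2))) (𝓝[≠] x)
      (𝓝 (-p x ^ 3 / (1 + x * (p x ^ 2 + p x * p x + p x ^ 2)))) := by
    have : ContinuousAt (fun y => -p y ^ 3 / (1 + x * (p x ^ 2 + p x * p y + p y ^ 2))) x := by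
      fun_prop (disch := assumption)
    exact this.tendsto.mono_left nhdsWithin_le_nhds
  refine hlim.congr' ?_
  filter_upwards [self_mem_nhdsWithin, mem_nhdsWithin_of_mem_nhds (Ioi_mem_nhds hx)] with y hy hy0
  have hy0' : 0 < y := hy0
  obtain ⟨hb, -, -⟩ := hp y hy0'.le
  have hD' : 1 + x * (p x ^ 2 + p x * p y + p y ^ 2) ≠ 0 := by positivity
  have hyx : y - x ≠ 0 := sub_ne_zero.2 hy
  rw [slope_def_field, div_eq_div_iff hD' hyx, hp.sub_mul_eq hx.le hy0'.le]
  ring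

theorem posPoly_exists_hasDerivAt (hp : IsCubicRoot p) {f : ℝ → ℝ}
    (hf : PosPoly p (fun x => (3 - 2 * p x)⁻¹) f) :
    ∃ g, PosPoly p (fun x => (3 - 2 * p x)⁻¹) g ∧ ∀ x, 0 < x → HasDerivAt f (-g x) x := by
  have hq : PosPoly p (fun x => (3 - 2 * p x)⁻¹) (fun x => p x * p x * (p x * p x) *
      (3 - 2 * p x)⁻¹) := .mul (.mul (.mul .left .left) (.mul .left .left)) .right
  refine PosPoly.exists_hasDerivAt ⟨_, hq, fun x hx => ?_⟩
    ⟨_, .mul (.mul (.const 2 zero_le_two) hq) (.mul .right .right), fun x hx => ?_⟩ hf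
  · exact (hp.hasDerivAt hx).congr_deriv (by ring)
  · have h3 : 3 - 2 * p x ≠ 0 := by linarith [(hp x hx.le).2.1]
    refine ((((hp.hasDerivAt hx).const_mul 2).const_sub 3).inv h3).congr_deriv ?_
    field_simp

theorem alternating_iteratedDeriv (hp : IsCubicRoot p) (n : ℕ) {x : ℝ} (hx : 0 < x) :
    0 ≤ (-1 : ℝ) ^ n * iteratedDeriv n p x := by
  refine alternating_iteratedDeriv_of_family
    (S := {f | PosPoly p (fun x => (3 - 2 * p x)⁻¹) f})
    (fun f hf => PosPoly.nonneg (fun y hy => (hp y hy.le).1.le) (fun y hy => ?_) hf)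
    (fun f hf => hp.posPoly_exists_hasDerivAt hf) n p .left x hx
  exact inv_nonneg.2 (by linarith [(hp y hy.le).2.1])

theorem contDiffOn (hp : IsCubicRoot p) : ContDiffOn ℝ (⊤ : ℕ∞) p (Ioi 0) :=
  contDiffOn_infty.2 fun n => contDiffOn_of_family
    (S := {f | PosPoly p (fun x => (3 - 2 * p x)⁻¹) f})
    (fun _ hf => hp.posPoly_exists_hasDerivAt hf) n p .left

theorem tendsto_zero (hp : IsCubicRoot p) : Tendsto p atTop (𝓝 0) := by
  rw [Metric.tendsto_nhds]
  intro ε hε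
  filter_upwards [eventually_gt_atTop (1 / ε ^ 3)] with x hx
  have hx0 : 0 < x := lt_trans (by positivity) hx
  obtain ⟨ha, -, he⟩ := hp x hx0.le
  rw [Real.dist_eq, sub_zero, abs_of_pos ha]
  by_contra! hle
  have h1 : 1 < x * ε ^ 3 := by rwa [div_lt_iff₀ (by positivity)] at hx
  have h2 : x * ε ^ 3 ≤ x * p x ^ 3 := by gcongr
  linarith

/-- The function `x p (3 - p) / 2` is an antiderivative of `p`. -/
theorem hasDerivAt_primitive (hp : IsCubicRoot p) {x : ℝ} (hx : 0 < x) :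
    HasDerivAt (fun x => x * (p x * (3 - p x) / 2)) (p x) x := by
  have h3 : 3 - 2 * p x ≠ 0 := by linarith [(hp x hx.le).2.1]
  have hd := hp.hasDerivAt hx
  refine ((hasDerivAt_id x).mul ((hd.mul (hd.const_sub 3)).div_const 2)).congr_deriv ?_
  simp only [id, Pi.mul_apply]
  linear_combination (-(x * p x ^ 4) / 2) * mul_inv_cancel₀ h3 - (p x / 2) * (hp x hx.le).2.2

end IsCubicRoot

/-- A function that is differentiable on `(0,∞)` and satisfies (E) classically is a viscosity
solution. -/
theorem isSolutionE_of_hasDerivAt {m : ℝ} {F F' : ℝ → ℝ}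
    (hF : ∀ x, 0 < x → HasDerivAt F (F' x) x)
    (heq : ∀ x, 0 < x → (1 / 2) * (F' x - m) * (F' x - m - 1) + F x / x - m = 0) :
    IsSolutionE m F := by
  have key : ∀ φ : ℝ → ℝ, ContDiff ℝ 1 φ → ∀ x, 0 < x →
      IsLocalExtr (fun x => F x - φ x) x → deriv φ x = F' x := by
    intro φ hφ x hx hext
    have hd := (hF x hx).sub ((hφ.differentiable one_ne_zero) x).hasDerivAt
    have := hext.hasDerivAt_eq_zero hd
    linarith
  refine ⟨fun φ hφ x hx hmax => ?_, fun φ hφ x hx hmin => ?_⟩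
  · rw [key φ hφ x hx (.inr (hmax.isLocalMax (Ici_mem_nhds hx)))]
    exact (heq x hx).le
  · rw [key φ hφ x hx (.inl (hmin.isLocalMin (Ici_mem_nhds hx)))]
    exact (heq x hx).ge

/-- Proposition 4.3, existence of a Bernstein equilibrium for `m = 1`.
There exists a Lipschitz, sublinear function `F` with `0 ≤ F(x) ≤ x` which is a viscosity
solution of `(1/2)(F′ − 1)(F′ − 2) + F/x − 1 = 0` on `(0,∞)`; moreover `F` can be taken
to be a Bernstein function: `F ∈ C^∞((0,∞))` with `(−1)^{n+1}F^{(n)} ≥ 0` for all `n ≥ 1`. -/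
theorem existence_equilibrium_m_one :
    ∃ F : ℝ → ℝ,
      (∃ K : NNReal, LipschitzOnWith K F (Ici 0)) ∧
      Sublinear F ∧
      (∀ x : ℝ, 0 ≤ x → 0 ≤ F x ∧ F x ≤ x) ∧
      IsSolutionE 1 F ∧
      ContDiffOn ℝ (⊤ : ℕ∞) F (Ioi 0) ∧
      (∀ n : ℕ, 1 ≤ n → ∀ x : ℝ, 0 < x →
        0 ≤ (-1 : ℝ) ^ (n + 1) * iteratedDeriv n F x) := by
  obtain ⟨p, hp⟩ := exists_isCubicRoot
  have hF : ∀ x, 0 < x → HasDerivAt (fun x => x * (p x * (3 - p x) / 2)) (p x) x :=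
    fun x hx => hp.hasDerivAt_primitive hx
  refine ⟨fun x => x * (p x * (3 - p x) / 2), ⟨1, ?_⟩, ?_, fun x hx => ?_, ?_, ?_, ?_⟩
  · have hcont : ContinuousOn (fun x => x * (p x * (3 - p x) / 2)) (Ici 0) := by
      have := hp.lipschitzOnWith.continuousOn
      fun_prop
    rw [← closure_Ioi (0 : ℝ)] at hcont ⊢
    refine LipschitzOnWith.closure hcont ?_
    refine (convex_Ioi 0).lipschitzOnWith_of_nnnorm_hasDerivWithin_le
      (fun x hx => (hF x hx).hasDerivWithinAt) fun x hx => ?_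
    obtain ⟨h0, h1, -⟩ := hp x (le_of_lt hx)
    rw [← NNReal.coe_le_coe, coe_nnnorm, Real.norm_of_nonneg h0.le]
    exact h1
  · have hlim : Tendsto (fun x => p x * (3 - p x) / 2) atTop (𝓝 (0 * (3 - 0) / 2)) :=
      (hp.tendsto_zero.mul (hp.tendsto_zero.const_sub 3)).div_const 2
    rw [zero_mul, zero_div] at hlim
    refine hlim.congr' ?_
    filter_upwards [eventually_gt_atTop 0] with x hx
    field_simp
  · obtain ⟨h0, h1, -⟩ := hp x hx
    refine ⟨mul_nonneg hx (by nlinarith), mul_le_of_le_one_right hx (by nlinarith)⟩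
  · refine isSolutionE_of_hasDerivAt hF fun x hx => ?_
    field_simp
    ring
  · rw [contDiffOn_infty_iff_deriv_of_isOpen isOpen_Ioi]
    exact ⟨fun x hx => (hF x hx).differentiableAt.differentiableWithinAt,
      hp.contDiffOn.congr fun x hx => (hF x hx).deriv⟩
  · intro n hn x hx
    obtain ⟨n, rfl⟩ := Nat.exists_eq_succ_of_ne_zero (Nat.one_le_iff_ne_zero.1 hn)
    have heq : EqOn (deriv fun x => x * (p x * (3 - p x) / 2)) p (Ioi 0) :=
      fun y hy => (hF y hy).deriv
    rw [Nat.succ_eq_add_one, iteratedDeriv_succ', heq.iteratedDeriv_of_isOpen isOpen_Ioi n hx,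
      pow_add, pow_add]
    simpa using hp.alternating_iteratedDeriv n hx
end
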